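/- arXiv:1602.06894 — 2 statements merged into one kernel-verified Lean document; each statement's English description precedes it below -/
import Mathlib

section
/- Let Q ⊂ ℝ^{d+1} be a polytope combinatorially equivalent to the k-fold pyramid over Δ_n × Δ_m with k+n+m = d+1, which is a minimal (d+1)-extension of the d-polytope P = π_d(Q) (i.e. the number of facets of Q equals xc(P)). Then all but at most 2 vertices of Q are strictly preserved under π_d, and every vertex of Q that is preserved is strictly preserved. Moreover, any vertex of Q that is not strictly preserved is the intersection of all facets of Q except two; these two exceptional facets are not pyramidal, and they are either the only two upper facets of Q or the only two lower facets of Q. -/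
open Set

noncomputable section

/-- A polytope: the convex hull of a finite set of points. -/
def IsPolytope {N : ℕ} (P : Set (Fin N → ℝ)) : Prop :=
  ∃ S : Finset (Fin N → ℝ), P = convexHull ℝ (S : Set (Fin N → ℝ))

/-- Dimension of a set: the dimension of its affine hull (with `-1` for the empty set). -/
def pdim {N : ℕ} (P : Set (Fin N → ℝ)) : ℤ :=
  haveI := Classical.dec P.Nonempty
  if P.Nonempty then (Module.finrank ℝ (affineSpan ℝ P).direction : ℤ) else -1

/-- `F` is a face of `P`: the subset of `P` where some linear functional bounded above on `P`
attains its maximum value.  This includes `∅` and `P` itself. -/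
def IsFaceOf {N : ℕ} (F P : Set (Fin N → ℝ)) : Prop :=
  ∃ (c : Fin N → ℝ) (b : ℝ),
    (∀ x ∈ P, ∑ i, c i * x i ≤ b) ∧ F = {x ∈ P | ∑ i, c i * x i = b}

/-- A facet: a face of dimension one less than the polytope. -/
def IsFacetOf {N : ℕ} (F P : Set (Fin N → ℝ)) : Prop :=
  IsFaceOf F P ∧ pdim F + 1 = pdim P

/-- A ridge: a face of dimension two less than the polytope. -/
def IsRidgeOf {N : ℕ} (F P : Set (Fin N → ℝ)) : Prop :=
  IsFaceOf F P ∧ pdim F + 2 = pdim P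

def IsVertexOf {N : ℕ} (v : Fin N → ℝ) (P : Set (Fin N → ℝ)) : Prop :=
  IsFaceOf {v} P

def vertexSet {N : ℕ} (P : Set (Fin N → ℝ)) : Set (Fin N → ℝ) :=
  {v | IsVertexOf v P}

def vertexCount {N : ℕ} (P : Set (Fin N → ℝ)) : ℕ := (vertexSet P).ncard

def facetCount {N : ℕ} (P : Set (Fin N → ℝ)) : ℕ := {F | IsFacetOf F P}.ncard

/-- Extension complexity: the minimal number of facets of a polytope (in any dimension)
admitting an affine projection onto `P`. -/
def xc {N : ℕ} (P : Set (Fin N → ℝ)) : ℕ :=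
  sInf {n | ∃ (e : ℕ) (Q : Set (Fin e → ℝ)) (π : (Fin e → ℝ) →ᵃ[ℝ] (Fin N → ℝ)),
    IsPolytope Q ∧ π '' Q = P ∧ facetCount Q = n}

/-- Combinatorial equivalence: an inclusion-preserving bijection between face lattices. -/
def CombEquiv {M N : ℕ} (P : Set (Fin M → ℝ)) (Q : Set (Fin N → ℝ)) : Prop :=
  ∃ φ : {F : Set (Fin M → ℝ) // IsFaceOf F P} ≃ {G : Set (Fin N → ℝ) // IsFaceOf G Q},
    ∀ F₁ F₂ : {F : Set (Fin M → ℝ) // IsFaceOf F P},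
      F₁.1 ⊆ F₂.1 ↔ (φ F₁).1 ⊆ (φ F₂).1

/-- A full-dimensional `n`-simplex in `ℝ^n` with the origin in its (relative) interior. -/
def simplexF (n : ℕ) : Set (Fin n → ℝ) :=
  convexHull ℝ ((Set.range fun i : Fin n => Pi.single i (1 : ℝ)) ∪ {fun _ => -1})

/-- The Cartesian product `Δ_n × Δ_m`, realized in `ℝ^{n+m}`. -/
def prodP (n m : ℕ) : Set (Fin (n + m) → ℝ) :=
  {z | ∃ a ∈ simplexF n, ∃ b ∈ simplexF m, z = Fin.append a b}

/-- The direct sum `Δ_n ⊕ Δ_m`, realized in `ℝ^{n+m}`. -/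
def sumP (n m : ℕ) : Set (Fin (n + m) → ℝ) :=
  convexHull ℝ (((fun a : Fin n → ℝ => Fin.append a (0 : Fin m → ℝ)) '' simplexF n) ∪
    ((fun b : Fin m → ℝ => Fin.append (0 : Fin n → ℝ) b) '' simplexF m))

/-- The join `A ⋆ B` of two polytopes, realized in `ℝ^{p+q+1}` with the two copies
placed in skew affine subspaces. -/
def joinP {p q : ℕ} (A : Set (Fin p → ℝ)) (B : Set (Fin q → ℝ)) :
    Set (Fin (p + q + 1) → ℝ) :=
  convexHull ℝ
    (((fun a : Fin p → ℝ =>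
        Fin.append (Fin.append a (0 : Fin q → ℝ)) (fun _ : Fin 1 => (0 : ℝ))) '' A) ∪
     ((fun b : Fin q → ℝ =>
        Fin.append (Fin.append (0 : Fin p → ℝ) b) (fun _ : Fin 1 => (1 : ℝ))) '' B))

/-- The canonical `k`-fold iterated pyramid over `X`, realized in `ℝ^{p+k}`. -/
def pyrK {p : ℕ} (k : ℕ) (X : Set (Fin p → ℝ)) : Set (Fin (p + k) → ℝ) :=
  convexHull ℝ (((fun x : Fin p → ℝ => Fin.append x (0 : Fin k → ℝ)) '' X) ∪
    Set.range (fun j : Fin k => Fin.append (0 : Fin p → ℝ) (Pi.single j (1 : ℝ))))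

/-- Transport a subset of `ℝ^a` to `ℝ^b` along a proof that `a = b`. -/
def castSet {a b : ℕ} (h : a = b) (X : Set (Fin a → ℝ)) : Set (Fin b → ℝ) :=
  (fun x : Fin a → ℝ => fun i : Fin b => x (Fin.cast h.symm i)) '' X

/-- Projective equivalence of two subsets of `ℝ^N`: `Q` is the image of `P` under a
projective transformation `x ↦ (A x + b) / (⟨c, x⟩ + δ)` whose associated
`(N+1) × (N+1)` matrix is invertible and whose denominator is positive on `P`. -/
def ProjEquiv {N : ℕ} (P Q : Set (Fin N → ℝ)) : Prop :=
  ∃ (A : (Fin N → ℝ) →ₗ[ℝ] (Fin N → ℝ)) (b c : Fin N → ℝ) (δ : ℝ),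
    Function.Bijective
      (fun z : (Fin N → ℝ) × ℝ => (A z.1 + z.2 • b, (∑ i, c i * z.1 i) + δ * z.2)) ∧
    (∀ x ∈ P, 0 < (∑ i, c i * x i) + δ) ∧
    Q = (fun x : Fin N → ℝ => ((∑ i, c i * x i) + δ)⁻¹ • (A x + b)) '' P

/-- `P` is a pyramid with base `B`: the convex hull of `B` and a point outside
the affine hull of `B`. -/
def IsPyramidOver {N : ℕ} (P B : Set (Fin N → ℝ)) : Prop :=
  ∃ a : Fin N → ℝ, a ∉ affineSpan ℝ B ∧ P = convexHull ℝ (B ∪ {a})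

/-- `P` is a `k`-fold iterated pyramid over `B`. -/
def IsKFoldPyramidOver {N : ℕ} : ℕ → Set (Fin N → ℝ) → Set (Fin N → ℝ) → Prop
  | 0, P, B => P = B
  | k + 1, P, B => ∃ P' : Set (Fin N → ℝ), IsPyramidOver P P' ∧ IsKFoldPyramidOver k P' B

/-- `P` is a pyramid: the convex hull of one of its facets together with one more vertex. -/
def IsPyramidPolytope {N : ℕ} (P : Set (Fin N → ℝ)) : Prop :=
  ∃ (F : Set (Fin N → ℝ)) (v : Fin N → ℝ),
    IsFacetOf F P ∧ IsVertexOf v P ∧ P = convexHull ℝ (F ∪ {v})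

/-- A facet is pyramidal if it contains all vertices of the polytope but one. -/
def IsPyramidalFacet {N : ℕ} (F P : Set (Fin N → ℝ)) : Prop :=
  IsFacetOf F P ∧ ∃ v, IsVertexOf v P ∧ v ∉ F ∧ ∀ w, IsVertexOf w P → w ≠ v → w ∈ F

/-- The projection `π_d : ℝ^{d+1} → ℝ^d` forgetting the last coordinate. -/
def projFun (d : ℕ) : (Fin (d + 1) → ℝ) → (Fin d → ℝ) :=
  fun x i => x i.castSucc

/-- `c` is an outer normal vector exposing the face `F` of `Q`. -/
def IsOuterNormal {N : ℕ} (Q F : Set (Fin N → ℝ)) (c : Fin N → ℝ) : Prop :=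
  ∃ b : ℝ, (∀ x ∈ Q, ∑ i, c i * x i ≤ b) ∧ F = {x ∈ Q | ∑ i, c i * x i = b}

/-- An upper facet: outer normal with positive last coordinate. -/
def IsUpperFacet {d : ℕ} (F Q : Set (Fin (d + 1) → ℝ)) : Prop :=
  IsFacetOf F Q ∧ ∃ c, IsOuterNormal Q F c ∧ 0 < c (Fin.last d)

/-- A lower facet: outer normal with negative last coordinate. -/
def IsLowerFacet {d : ℕ} (F Q : Set (Fin (d + 1) → ℝ)) : Prop :=
  IsFacetOf F Q ∧ ∃ c, IsOuterNormal Q F c ∧ c (Fin.last d) < 0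

/-- A vertical facet: every outer normal has vanishing last coordinate. -/
def IsVerticalFacet {d : ℕ} (F Q : Set (Fin (d + 1) → ℝ)) : Prop :=
  IsFacetOf F Q ∧ ∀ c, IsOuterNormal Q F c → c (Fin.last d) = 0

/-- An equatorial ridge: a ridge that is the intersection of an upper and a lower facet. -/
def IsEquatorialRidge {d : ℕ} (F Q : Set (Fin (d + 1) → ℝ)) : Prop :=
  IsRidgeOf F Q ∧ ∃ F₁ F₂ : Set (Fin (d + 1) → ℝ),
    IsUpperFacet F₁ Q ∧ IsLowerFacet F₂ Q ∧ F = F₁ ∩ F₂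

/-- A face `F` of `Q` is preserved under the projection forgetting the last coordinate. -/
def PreservedFace {d : ℕ} (Q F : Set (Fin (d + 1) → ℝ)) : Prop :=
  IsFaceOf (projFun d '' F) (projFun d '' Q) ∧ projFun d ⁻¹' (projFun d '' F) ∩ Q = F

/-- A face `F` of `Q` is strictly preserved: preserved and of the same dimension as its image. -/
def StrictlyPreservedFace {d : ℕ} (Q F : Set (Fin (d + 1) → ℝ)) : Prop :=
  PreservedFace Q F ∧ pdim (projFun d '' F) = pdim F

/-- A hexagon: a 2-dimensional polytope with exactly 6 vertices. -/
def IsHexagon {N : ℕ} (P : Set (Fin N → ℝ)) : Prop :=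
  IsPolytope P ∧ pdim P = 2 ∧ vertexCount P = 6

/-- Three lines are concurrent: they share a common point, or they are pairwise parallel. -/
def ConcurrentLines {N : ℕ} (L₁ L₂ L₃ : AffineSubspace ℝ (Fin N → ℝ)) : Prop :=
  (∃ x, x ∈ L₁ ∧ x ∈ L₂ ∧ x ∈ L₃) ∨
    (AffineSubspace.Parallel L₁ L₂ ∧ AffineSubspace.Parallel L₂ L₃ ∧
      AffineSubspace.Parallel L₁ L₃)

/-- A cyclic labeling of the vertices of a hexagon: consecutive points are joined by edges. -/
def CyclicLabeling {N : ℕ} (P : Set (Fin N → ℝ)) (p : Fin 6 → (Fin N → ℝ)) : Prop :=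
  Function.Injective p ∧ Set.range p = vertexSet P ∧
    ∀ i : Fin 6, IsFaceOf (segment ℝ (p i) (p (i + 1))) P

/-- A Desarguian hexagon. -/
def Desarguian {N : ℕ} (P : Set (Fin N → ℝ)) : Prop :=
  ∃ p : Fin 6 → (Fin N → ℝ), CyclicLabeling P p ∧
    ConcurrentLines (affineSpan ℝ {p 0, p 1}) (affineSpan ℝ {p 5, p 2})
      (affineSpan ℝ {p 3, p 4})

/-- A polytope is simplicial if every facet is a simplex. -/
def IsSimplicial {N : ℕ} (P : Set (Fin N → ℝ)) : Prop :=
  ∀ F : Set (Fin N → ℝ), IsFacetOf F P →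
    ∃ S : Finset (Fin N → ℝ),
      AffineIndependent ℝ (Subtype.val : {x // x ∈ S} → (Fin N → ℝ)) ∧
      F = convexHull ℝ (S : Set (Fin N → ℝ))

namespace PolytopeProjection

variable {N : ℕ}

lemma convex_dotProduct_le (c : Fin N → ℝ) (b : ℝ) : Convex ℝ {x : Fin N → ℝ | c ⬝ᵥ x ≤ b} :=
  convex_halfSpace_le
    (IsLinearMap.mk (dotProduct_add c) (fun r x => dotProduct_smul r c x) :
      IsLinearMap ℝ fun x => c ⬝ᵥ x) b

lemma dotProduct_le_of_mem_convexHull {G : Set (Fin N → ℝ)} {c : Fin N → ℝ} {b : ℝ}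
    (h : ∀ g ∈ G, c ⬝ᵥ g ≤ b) : ∀ x ∈ convexHull ℝ G, c ⬝ᵥ x ≤ b :=
  fun _ hx => convexHull_min h (convex_dotProduct_le c b) hx

lemma mem_convexHull_of_dotProduct_eq {G : Set (Fin N → ℝ)} {c : Fin N → ℝ} {b : ℝ}
    (h : ∀ g ∈ G, c ⬝ᵥ g ≤ b) {x : Fin N → ℝ} (hx : x ∈ convexHull ℝ G) (hxb : c ⬝ᵥ x = b) :
    x ∈ convexHull ℝ {g ∈ G | c ⬝ᵥ g = b} := by
  let T : Set (Fin N → ℝ) :=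
    {x | c ⬝ᵥ x ≤ b ∧ (c ⬝ᵥ x = b → x ∈ convexHull ℝ {g ∈ G | c ⬝ᵥ g = b})}
  have hT : Convex ℝ T := by
    rw [convex_iff_forall_pos]
    rintro x ⟨hx, hx'⟩ y ⟨hy, hy'⟩ p q hp hq hpq
    have e : c ⬝ᵥ (p • x + q • y) = p * (c ⬝ᵥ x) + q * (c ⬝ᵥ y) := by
      simp [dotProduct_add, dotProduct_smul]
    have hb : b = p * b + q * b := by rw [← add_mul, hpq, one_mul]
    have h1 := mul_le_mul_of_nonneg_left hx hp.le
    have h2 := mul_le_mul_of_nonneg_left hy hq.le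
    refine ⟨by rw [e]; linarith, fun hz => ?_⟩
    rw [e] at hz
    have h3 : p * (c ⬝ᵥ x) = p * b := by linarith
    have h4 : q * (c ⬝ᵥ y) = q * b := by linarith
    exact convex_convexHull ℝ _ (hx' (mul_left_cancel₀ hp.ne' h3))
      (hy' (mul_left_cancel₀ hq.ne' h4)) hp.le hq.le hpq
  have hGT : G ⊆ T := fun g hg => ⟨h g hg, fun hgb => subset_convexHull ℝ _ ⟨hg, hgb⟩⟩
  exact (convexHull_min hGT hT hx).2 hxb

lemma exists_dotProduct_eq (f : (Fin N → ℝ) →ₗ[ℝ] ℝ) : ∃ c : Fin N → ℝ, ∀ x, f x = c ⬝ᵥ x := by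
  refine ⟨fun i => f (Pi.single i 1), fun x => ?_⟩
  rw [dotProduct_comm]
  conv_lhs => rw [pi_eq_sum_univ' x]
  simp [dotProduct]

section Faces

variable {P F G : Set (Fin N → ℝ)}

lemma isFaceOf_iff : IsFaceOf F P ↔
    ∃ (c : Fin N → ℝ) (b : ℝ), (∀ x ∈ P, c ⬝ᵥ x ≤ b) ∧ F = {x ∈ P | c ⬝ᵥ x = b} := Iff.rfl

lemma isFaceOf_empty (P : Set (Fin N → ℝ)) : IsFaceOf ∅ P :=
  isFaceOf_iff.2 ⟨0, 1, by simp, by simp⟩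

lemma subset_of_isFaceOf (h : IsFaceOf F P) : F ⊆ P := by
  obtain ⟨c, b, -, rfl⟩ := h
  exact fun x hx => hx.1

lemma eq_convexHull_of_isFaceOf {S : Set (Fin N → ℝ)} (h : IsFaceOf F (convexHull ℝ S)) :
    F = convexHull ℝ (S ∩ F) := by
  obtain ⟨c, b, hb, rfl⟩ := isFaceOf_iff.1 h
  have hS : S ∩ {x ∈ convexHull ℝ S | c ⬝ᵥ x = b} = {g ∈ S | c ⬝ᵥ g = b} := by
    ext g
    exact ⟨fun hg => ⟨hg.1, hg.2.2⟩, fun hg => ⟨hg.1, subset_convexHull ℝ _ hg.1, hg.2⟩⟩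
  rw [hS]
  refine Subset.antisymm (fun x hx => mem_convexHull_of_dotProduct_eq
    (fun g hg => hb g (subset_convexHull ℝ _ hg)) hx.1 hx.2) fun x hx => ?_
  refine ⟨convexHull_mono (fun g hg => hg.1) hx, le_antisymm
    (hb x (convexHull_mono (fun g hg => hg.1) hx)) ?_⟩
  have := dotProduct_le_of_mem_convexHull (c := -c) (b := -b)
    (fun g (hg : g ∈ {g ∈ S | c ⬝ᵥ g = b}) => by simp [hg.2]) x hx
  simpa using this

lemma convex_of_isPolytope (h : IsPolytope P) : Convex ℝ P := by
  obtain ⟨S, rfl⟩ := h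
  exact convex_convexHull ℝ _

lemma isCompact_of_isPolytope (h : IsPolytope P) : IsCompact P := by
  obtain ⟨S, rfl⟩ := h
  exact S.finite_toSet.isCompact_convexHull ℝ

lemma isPolytope_of_finite {S : Set (Fin N → ℝ)} (h : S.Finite) : IsPolytope (convexHull ℝ S) :=
  ⟨h.toFinset, by simp⟩

lemma isPolytope_of_isFaceOf (h : IsPolytope P) (hF : IsFaceOf F P) : IsPolytope F := by
  obtain ⟨S, rfl⟩ := h
  rw [eq_convexHull_of_isFaceOf hF]
  exact isPolytope_of_finite (S.finite_toSet.inter_of_left F)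

lemma finite_setOf_isFaceOf (h : IsPolytope P) : {F | IsFaceOf F P}.Finite := by
  obtain ⟨S, rfl⟩ := h
  refine (S.finite_toSet.finite_subsets.image (convexHull ℝ)).subset fun F hF => ?_
  exact ⟨_, inter_subset_left, (eq_convexHull_of_isFaceOf hF).symm⟩

lemma mem_of_isVertexOf {v : Fin N → ℝ} (h : IsVertexOf v P) : v ∈ P :=
  subset_of_isFaceOf h rfl

lemma mem_of_isVertexOf_convexHull {S : Set (Fin N → ℝ)} {v : Fin N → ℝ}
    (h : IsVertexOf v (convexHull ℝ S)) : v ∈ S := by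
  by_contra hv
  have := eq_convexHull_of_isFaceOf h
  rw [inter_singleton_eq_empty.2 hv, convexHull_empty] at this
  exact singleton_ne_empty v this

lemma isVertexOf_of_dotProduct_lt {S : Set (Fin N → ℝ)} {v : Fin N → ℝ} (hv : v ∈ S)
    (c : Fin N → ℝ) (h : ∀ w ∈ S, w ≠ v → c ⬝ᵥ w < c ⬝ᵥ v) : IsVertexOf v (convexHull ℝ S) := by
  have hle : ∀ w ∈ S, c ⬝ᵥ w ≤ c ⬝ᵥ v := fun w hw => by
    rcases eq_or_ne w v with rfl | hwv
    · exact le_rfl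
    · exact (h w hw hwv).le
  refine isFaceOf_iff.2 ⟨c, c ⬝ᵥ v, dotProduct_le_of_mem_convexHull hle, ?_⟩
  refine Subset.antisymm (singleton_subset_iff.2 ⟨subset_convexHull ℝ _ hv, rfl⟩) fun x hx => ?_
  have hx' := mem_convexHull_of_dotProduct_eq hle hx.1 hx.2
  have : {g ∈ S | c ⬝ᵥ g = c ⬝ᵥ v} ⊆ {v} := fun g hg => by
    by_contra hgv
    exact (h g hg.1 hgv).ne hg.2
  simpa using convexHull_mono this hx'

lemma exists_vertices_eq_convexHull (h : IsPolytope P) :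
    ∃ S : Finset (Fin N → ℝ), P = convexHull ℝ (S : Set (Fin N → ℝ)) ∧ ∀ v ∈ S, IsVertexOf v P := by
  classical
  have hex : ∃ n, ∃ S : Finset (Fin N → ℝ),
      P = convexHull ℝ (S : Set (Fin N → ℝ)) ∧ S.card = n := by
    obtain ⟨S, hS⟩ := h
    exact ⟨_, S, hS, rfl⟩
  obtain ⟨S, hS, hcard⟩ := Nat.find_spec hex
  refine ⟨S, hS, fun v hv => ?_⟩
  have hnot : v ∉ convexHull ℝ ((S.erase v : Finset _) : Set (Fin N → ℝ)) := fun hmem => by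
    refine Nat.find_min hex (m := (S.erase v).card) ?_ ⟨S.erase v, ?_, rfl⟩
    · rw [← hcard]
      exact Finset.card_erase_lt_of_mem hv
    · rw [hS]
      refine Subset.antisymm (convexHull_min (fun w hw => ?_) (convex_convexHull ℝ _))
        (convexHull_mono (by exact_mod_cast Finset.erase_subset v S))
      rcases eq_or_ne w v with rfl | hwv
      · exact hmem
      · exact subset_convexHull ℝ _ (by simpa [hwv] using hw)
  obtain ⟨f, u, hf, hu⟩ := geometric_hahn_banach_closed_point (convex_convexHull ℝ _)
    ((Finset.finite_toSet _).isClosed_convexHull ℝ) hnot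
  obtain ⟨c, hc⟩ := exists_dotProduct_eq (f : (Fin N → ℝ) →ₗ[ℝ] ℝ)
  rw [hS]
  refine isVertexOf_of_dotProduct_lt (by exact_mod_cast hv) c fun w hw hwv => ?_
  rw [← hc, ← hc]
  exact (hf w (subset_convexHull ℝ _ (by simpa [hwv] using hw))).trans hu

lemma exists_isVertexOf_mem (h : IsPolytope P) (hF : IsFaceOf F P) (hne : F.Nonempty) :
    ∃ v ∈ F, IsVertexOf v P := by
  obtain ⟨S, rfl, hS⟩ := exists_vertices_eq_convexHull h
  rw [eq_convexHull_of_isFaceOf hF, convexHull_nonempty_iff] at hne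
  obtain ⟨v, hv, hvF⟩ := hne
  exact ⟨v, hvF, hS v hv⟩

/-- A nonempty polytope contains a point such that every face through it is the whole polytope. -/
lemma exists_mem_forall_dotProduct_eq (h : IsPolytope P) (hne : P.Nonempty) :
    ∃ x ∈ P, ∀ (c : Fin N → ℝ) (b : ℝ), (∀ y ∈ P, c ⬝ᵥ y ≤ b) → c ⬝ᵥ x = b →
      ∀ y ∈ P, c ⬝ᵥ y = b := by
  obtain ⟨S, rfl⟩ := h
  have hSne : S.Nonempty := by simpa using hne
  have hcard : (0 : ℝ) < S.card := by exact_mod_cast hSne.card_pos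
  refine ⟨S.centerMass (fun _ => (1 : ℝ)) id, S.centerMass_id_mem_convexHull (by simp)
    (by simpa using hSne), fun c b hb hx => ?_⟩
  have hsum : ∑ s ∈ S, (b - c ⬝ᵥ s) = 0 := by
    rw [Finset.centerMass, dotProduct_smul, dotProduct_sum] at hx
    simp only [Finset.sum_const, nsmul_eq_mul, mul_one, one_smul, id, smul_eq_mul] at hx
    rw [Finset.sum_sub_distrib, Finset.sum_const, nsmul_eq_mul, ← hx]
    field_simp
    ring
  have hS := (Finset.sum_eq_zero_iff_of_nonneg fun s hs =>
    sub_nonneg.2 (hb s (subset_convexHull ℝ _ hs))).1 hsum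
  intro y hy
  refine le_antisymm (hb y hy) ?_
  have := dotProduct_le_of_mem_convexHull (c := -c) (b := -b)
    (fun s hs => by rw [neg_dotProduct]; linarith [hS s hs]) y hy
  simpa using this

end Faces

section Dimension

variable {P F G : Set (Fin N → ℝ)}

lemma pdim_of_nonempty (h : P.Nonempty) :
    pdim P = (Module.finrank ℝ (vectorSpan ℝ P) : ℤ) := by
  rw [pdim, if_pos h, direction_affineSpan]

lemma pdim_empty : pdim (∅ : Set (Fin N → ℝ)) = -1 := by
  rw [pdim, if_neg Set.not_nonempty_empty]

lemma pdim_nonneg_of_nonempty (h : P.Nonempty) : 0 ≤ pdim P := by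
  rw [pdim_of_nonempty h]
  exact Int.natCast_nonneg _

lemma pdim_singleton (x : Fin N → ℝ) : pdim {x} = 0 := by
  rw [pdim_of_nonempty (singleton_nonempty x), vectorSpan_singleton]
  simp

lemma pdim_lt_of_notMem_affineSpan (h : F ⊆ P) {y : Fin N → ℝ} (hy : y ∈ P)
    (hyF : y ∉ affineSpan ℝ F) : pdim F < pdim P := by
  rcases F.eq_empty_or_nonempty with rfl | hF
  · rw [pdim_empty]
    linarith [pdim_nonneg_of_nonempty ⟨y, hy⟩]
  · rw [pdim_of_nonempty hF, pdim_of_nonempty (hF.mono h), ← direction_affineSpan,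
      ← direction_affineSpan]
    have hlt : affineSpan ℝ F < affineSpan ℝ P :=
      lt_of_le_of_ne (affineSpan_mono ℝ h) fun e => hyF (e ▸ mem_affineSpan ℝ hy)
    exact_mod_cast Submodule.finrank_lt_finrank_of_lt
      (AffineSubspace.direction_lt_of_nonempty hlt ((affineSpan_nonempty ℝ).2 hF))

lemma dotProduct_eq_of_mem_affineSpan {c : Fin N → ℝ} {b : ℝ} (h : ∀ x ∈ F, c ⬝ᵥ x = b)
    {y : Fin N → ℝ} (hy : y ∈ affineSpan ℝ F) : c ⬝ᵥ y = b := by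
  refine affineSpan_induction (p := fun y => c ⬝ᵥ y = b) hy h fun r u v w hu hv hw => ?_
  simp [dotProduct_add, dotProduct_smul, dotProduct_sub, hu, hv, hw]

lemma pdim_lt_of_isFaceOf (hF : IsFaceOf F P) (hG : G ⊆ P) (hFG : F ⊆ G) (hne : F ≠ G) :
    pdim F < pdim G := by
  obtain ⟨y, hyG, hyF⟩ := exists_of_ssubset (hFG.ssubset_of_ne hne)
  obtain ⟨c, b, hb, rfl⟩ := isFaceOf_iff.1 hF
  exact pdim_lt_of_notMem_affineSpan hFG hyG fun hy =>
    hyF ⟨hG hyG, dotProduct_eq_of_mem_affineSpan (fun x hx => hx.2) hy⟩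

lemma ne_of_isFacetOf (hF : IsFacetOf F P) : F ≠ P := by
  rintro rfl
  linarith [hF.2]

lemma eq_or_eq_of_isFacetOf_subset (hF : IsFacetOf F P) (hG : IsFaceOf G P) (hFG : F ⊆ G) :
    G = F ∨ G = P := by
  by_contra! hne
  have h1 := pdim_lt_of_isFaceOf hF.1 (subset_of_isFaceOf hG) hFG hne.1.symm
  have h2 := pdim_lt_of_isFaceOf hG Subset.rfl (subset_of_isFaceOf hG) hne.2
  linarith [hF.2]

lemma finite_setOf_isFacetOf (h : IsPolytope P) : {F | IsFacetOf F P}.Finite :=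
  (finite_setOf_isFaceOf h).subset fun _ hF => hF.1

end Dimension

/-- If a ray leaves a full-dimensional polytope at `x`, then it crosses the hyperplane of a facet
through `x`. -/
lemma exists_isFacetOf_of_ray {Q : Set (Fin N → ℝ)} (hQ : IsPolytope Q)
    (htop : affineSpan ℝ Q = ⊤) {x u : Fin N → ℝ} (hx : x ∈ Q)
    (hu : ∀ ε : ℝ, 0 < ε → x + ε • u ∉ Q) :
    ∃ (F : Set (Fin N → ℝ)) (c : Fin N → ℝ) (b : ℝ), IsFacetOf F Q ∧
      (∀ y ∈ Q, c ⬝ᵥ y ≤ b) ∧ F = {y ∈ Q | c ⬝ᵥ y = b} ∧ x ∈ F ∧ 0 < c ⬝ᵥ u := by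
  have hconv := convex_of_isPolytope hQ
  have hclosed := (isCompact_of_isPolytope hQ).isClosed
  have hinterior : (interior Q).Nonempty := hconv.interior_nonempty_iff_affineSpan_eq_top.2 htop
  have hclos : closure (interior Q) = Q := by
    rw [hconv.closure_interior_eq_closure_of_nonempty_interior hinterior, hclosed.closure_eq]
  obtain ⟨δ, hδ, hball⟩ : ∃ δ > 0, ∀ F, IsFaceOf F Q → ∀ p ∈ F, p ∈ Metric.ball x δ → x ∈ F := by
    have hfin : {F | IsFaceOf F Q ∧ x ∉ F}.Finite :=
      (finite_setOf_isFaceOf hQ).subset fun _ h => h.1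
    have hcl : IsClosed (⋃ F ∈ {F | IsFaceOf F Q ∧ x ∉ F}, F) :=
      hfin.isClosed_biUnion fun F hF =>
        (isCompact_of_isPolytope (isPolytope_of_isFaceOf hQ hF.1)).isClosed
    obtain ⟨δ, hδ, hsub⟩ := Metric.isOpen_iff.1 hcl.isOpen_compl x (by
      simp only [mem_compl_iff, mem_iUnion, not_exists]
      exact fun F hF => hF.2)
    refine ⟨δ, hδ, fun F hF p hp hpb => ?_⟩
    by_contra hxF
    exact hsub hpb (mem_biUnion (⟨hF, hxF⟩ : F ∈ {F | IsFaceOf F Q ∧ x ∉ F}) hp)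
  obtain ⟨ε, hε, hzb⟩ : ∃ ε : ℝ, 0 < ε ∧ x + ε • u ∈ Metric.ball x δ := by
    have hcont : Filter.Tendsto (fun ε : ℝ => x + ε • u) (nhdsWithin 0 (Ioi 0)) (nhds x) := by
      have : Continuous fun ε : ℝ => x + ε • u := by fun_prop
      simpa using (this.tendsto 0).mono_left nhdsWithin_le_nhds
    obtain ⟨ε, h1, h2⟩ := ((hcont.eventually (Metric.ball_mem_nhds x hδ)).and
      self_mem_nhdsWithin).exists
    exact ⟨ε, h2, h1⟩
  set z := x + ε • u with hz
  have hzQ : z ∉ Q := hu ε hε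
  obtain ⟨V, hV⟩ := hQ
  obtain ⟨y, ⟨hyQ, hyb⟩, hygen⟩ : ∃ y ∈ interior Q ∩ Metric.ball x δ, ∀ S ⊆ (V : Set (Fin N → ℝ)),
      affineSpan ℝ (insert z S) ≠ ⊤ → y ∉ affineSpan ℝ (insert z S) := by
    have hopen : IsOpen (interior Q ∩ Metric.ball x δ) := isOpen_interior.inter Metric.isOpen_ball
    have hne : (interior Q ∩ Metric.ball x δ).Nonempty := by
      rw [inter_comm]
      exact mem_closure_iff.1 (hclos.symm ▸ hx) _ Metric.isOpen_ball (Metric.mem_ball_self hδ)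
    by_contra! hcon
    let 𝒮 : Set (Set (Fin N → ℝ)) := {S | S ⊆ (V : Set (Fin N → ℝ)) ∧ affineSpan ℝ (insert z S) ≠ ⊤}
    have hfin : 𝒮.Finite := V.finite_toSet.finite_subsets.subset fun S hS => hS.1
    have hzero : MeasureTheory.volume
        (⋃ S ∈ 𝒮, (affineSpan ℝ (insert z S) : Set (Fin N → ℝ))) = 0 :=
      (MeasureTheory.measure_biUnion_null_iff hfin.countable).2 fun S hS =>
        MeasureTheory.Measure.addHaar_affineSubspace _ _ hS.2
    refine (hopen.measure_pos MeasureTheory.volume hne).ne'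
      (MeasureTheory.measure_mono_null ?_ hzero)
    intro y hy
    obtain ⟨S, hS, hStop, hyS⟩ := hcon y hy
    exact mem_biUnion (⟨hS, hStop⟩ : S ∈ 𝒮) hyS
  obtain ⟨p, hp, hpf⟩ : ((segment ℝ y z) ∩ frontier Q).Nonempty := by
    by_contra hcon
    rw [not_nonempty_iff_eq_empty, ← disjoint_iff_inter_eq_empty] at hcon
    have hpre := (convex_segment (𝕜 := ℝ) y z).isPreconnected
    have hsub := hpre.subset_or_subset (u := interior Q) (v := Qᶜ) isOpen_interior
      hclosed.isOpen_compl (disjoint_compl_right.mono_left interior_subset) fun w hw => by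
        by_cases hwQ : w ∈ Q
        · refine Or.inl (by_contra fun hwi => disjoint_left.1 hcon hw ?_)
          exact ⟨subset_closure hwQ, hwi⟩
        · exact Or.inr hwQ
    rcases hsub with h | h
    · exact hzQ (interior_subset (h (right_mem_segment ℝ y z)))
    · exact h (left_mem_segment ℝ y z) (interior_subset hyQ)
  have hpQ : p ∈ Q := hclosed.frontier_subset hpf
  obtain ⟨f, hf⟩ := geometric_hahn_banach_open_point hconv.interior isOpen_interior hpf.2
  obtain ⟨c, hc⟩ := exists_dotProduct_eq (f : (Fin N → ℝ) →ₗ[ℝ] ℝ)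
  have hlt : ∀ a ∈ interior Q, c ⬝ᵥ a < c ⬝ᵥ p := fun a ha => by
    rw [← hc, ← hc]
    exact hf a ha
  have hle : ∀ a ∈ Q, c ⬝ᵥ a ≤ c ⬝ᵥ p := by
    have hcl : IsClosed {a : Fin N → ℝ | c ⬝ᵥ a ≤ c ⬝ᵥ p} :=
      isClosed_le (by fun_prop) continuous_const
    intro a ha
    rw [← hclos] at ha
    exact closure_minimal (fun a ha => (hlt a ha).le) hcl ha
  obtain ⟨s, t, hs, ht, hst, hpst⟩ := hp
  have hs0 : s ≠ 0 := by
    rintro rfl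
    rw [zero_add] at hst
    rw [hst, zero_smul, zero_add, one_smul] at hpst
    exact hzQ (hpst ▸ hpQ)
  have hcz : c ⬝ᵥ p < c ⬝ᵥ z := by
    have e : c ⬝ᵥ p = s * (c ⬝ᵥ y) + t * (c ⬝ᵥ z) := by
      rw [← hpst]
      simp [dotProduct_add, dotProduct_smul]
    by_contra! hcon
    have h1 := mul_lt_mul_of_pos_left (hlt y hyQ) (lt_of_le_of_ne hs hs0.symm)
    have h2 := mul_le_mul_of_nonneg_left hcon ht
    have h3 : c ⬝ᵥ p = s * (c ⬝ᵥ p) + t * (c ⬝ᵥ p) := by rw [← add_mul, hst, one_mul]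
    linarith
  have hpb : p ∈ Metric.ball x δ := (convex_ball x δ).segment_subset hyb hzb
    ⟨s, t, hs, ht, hst, hpst⟩
  set F := {y ∈ Q | c ⬝ᵥ y = c ⬝ᵥ p} with hF
  have hface : IsFaceOf F Q := isFaceOf_iff.2 ⟨c, _, hle, rfl⟩
  have hpF : p ∈ F := ⟨hpQ, rfl⟩
  have hxF : x ∈ F := hball F hface p hpF hpb
  refine ⟨F, c, c ⬝ᵥ p, ⟨hface, ?_⟩, hle, rfl, hxF, ?_⟩
  · have hspan : affineSpan ℝ (insert z F) = ⊤ := by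
      have hFS : F = convexHull ℝ ((V : Set (Fin N → ℝ)) ∩ F) := by
        rw [hV] at hface
        exact eq_convexHull_of_isFaceOf hface
      have hpS : p ∈ affineSpan ℝ ((V : Set (Fin N → ℝ)) ∩ F) := by
        rw [← affineSpan_convexHull, ← hFS]
        exact mem_affineSpan ℝ hpF
      have hsub : affineSpan ℝ (insert z ((V : Set (Fin N → ℝ)) ∩ F)) ≤ affineSpan ℝ (insert z F) :=
        affineSpan_mono ℝ (insert_subset_insert inter_subset_right)
      by_contra hne
      refine hygen _ inter_subset_left (fun h => hne (top_le_iff.1 (h ▸ hsub))) ?_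
      have hy : y = AffineMap.lineMap z p s⁻¹ := by
        rw [AffineMap.lineMap_apply_module, ← hpst, eq_sub_of_add_eq' hst]
        ext i
        simp only [Pi.add_apply, Pi.smul_apply, smul_eq_mul]
        field_simp
        ring
      rw [hy]
      exact AffineMap.lineMap_mem _ (mem_affineSpan ℝ (mem_insert _ _))
        (affineSpan_mono ℝ (subset_insert _ _) hpS)
    have h1 := finrank_vectorSpan_insert_le_set ℝ F z
    have h2 : vectorSpan ℝ (insert z F) = ⊤ := by
      rw [← direction_affineSpan, hspan, AffineSubspace.direction_top]
    have h3 : vectorSpan ℝ Q = ⊤ := by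
      rw [← direction_affineSpan, htop, AffineSubspace.direction_top]
    have h4 : pdim F < pdim Q := pdim_lt_of_isFaceOf hface Subset.rfl (subset_of_isFaceOf hface) (by
      intro e
      have hy : y ∈ F := e.symm ▸ interior_subset hyQ
      exact (hlt y hyQ).ne hy.2)
    rw [pdim_of_nonempty ⟨x, hxF⟩, pdim_of_nonempty ⟨x, hx⟩, h3] at h4 ⊢
    rw [h2] at h1
    have := Nat.cast_le (α := ℤ).2 h1
    push_cast at this
    linarith
  · rw [hz, dotProduct_add, hxF.2, dotProduct_smul, smul_eq_mul] at hcz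
    exact pos_of_mul_pos_right (by linarith) hε.le

section Facets

variable {P Q F G : Set (Fin N → ℝ)}

lemma exists_isFacetOf_ne (hQ : IsPolytope Q) (htop : affineSpan ℝ Q = ⊤) (hF : IsFacetOf F Q)
    (hne : F.Nonempty) : ∃ H, IsFacetOf H Q ∧ H ≠ F := by
  obtain ⟨y, hy⟩ := hne
  obtain ⟨c, b, hb, rfl⟩ := isFaceOf_iff.1 hF.1
  obtain ⟨x, hx, hmin⟩ := (isCompact_of_isPolytope hQ).exists_isMinOn ⟨y, hy.1⟩
    (f := fun x => c ⬝ᵥ x) (by fun_prop)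
  have hxF : c ⬝ᵥ x < b := by
    refine lt_of_le_of_ne (hb x hx) fun hxb => ne_of_isFacetOf hF ?_
    exact Subset.antisymm (fun z hz => hz.1) fun z hz =>
      ⟨hz, le_antisymm (hb z hz) (hxb ▸ hmin hz)⟩
  obtain ⟨H, -, -, hH, -, -, hxH, -⟩ := exists_isFacetOf_of_ray hQ htop (u := x - y) hx
    fun ε hε hmem => by
      have h1 : c ⬝ᵥ x ≤ c ⬝ᵥ (x + ε • (x - y)) := hmin hmem
      rw [dotProduct_add, dotProduct_smul, dotProduct_sub, hy.2, smul_eq_mul] at h1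
      nlinarith
  refine ⟨H, hH, ?_⟩
  rintro rfl
  exact hxF.ne hxH.2

lemma exists_isFacetOf_inter_eq (hQ : IsPolytope Q) (htop : affineSpan ℝ Q = ⊤)
    (hF : IsFacetOf F Q) (hG : IsFacetOf G F) : ∃ H, IsFacetOf H Q ∧ H ≠ F ∧ F ∩ H = G := by
  have hFQ := subset_of_isFaceOf hF.1
  suffices ∃ H, IsFacetOf H Q ∧ H ≠ F ∧ G ⊆ H by
    obtain ⟨H, hH, hne, hGH⟩ := this
    obtain ⟨c, b, hb, hHeq⟩ := isFaceOf_iff.1 hH.1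
    have hface : IsFaceOf (F ∩ H) F := by
      refine isFaceOf_iff.2 ⟨c, b, fun x hx => hb x (hFQ hx), ?_⟩
      ext x
      rw [hHeq]
      exact ⟨fun hx => ⟨hx.1, hx.2.2⟩, fun hx => ⟨hx.1, hFQ hx.1, hx.2⟩⟩
    refine ⟨H, hH, hne,
      (eq_or_eq_of_isFacetOf_subset hG hface
        (subset_inter (subset_of_isFaceOf hG.1) hGH)).resolve_right
        fun h => ?_⟩
    exact (eq_or_eq_of_isFacetOf_subset hF hH.1 (inter_eq_left.1 h)).elim hne (ne_of_isFacetOf hH)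
  rcases G.eq_empty_or_nonempty with rfl | hGne
  · have hFne : F.Nonempty := nonempty_iff_ne_empty.2 (ne_of_isFacetOf hG).symm
    obtain ⟨H, hH, hne⟩ := exists_isFacetOf_ne hQ htop hF hFne
    exact ⟨H, hH, hne, empty_subset H⟩
  obtain ⟨y, hyF, hyG⟩ := exists_of_ssubset
    ((subset_of_isFaceOf hG.1).ssubset_of_ne (ne_of_isFacetOf hG))
  have hGpoly := isPolytope_of_isFaceOf (isPolytope_of_isFaceOf hQ hF.1) hG.1
  obtain ⟨x, hxG, hx⟩ := exists_mem_forall_dotProduct_eq hGpoly hGne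
  have hGF := subset_of_isFaceOf hG.1
  obtain ⟨c, b, hb, hFeq⟩ := isFaceOf_iff.1 hF.1
  obtain ⟨c', b', hb', hGeq⟩ := isFaceOf_iff.1 hG.1
  have hcF : ∀ z ∈ F, c ⬝ᵥ z = b := fun z hz => by
    rw [hFeq] at hz
    exact hz.2
  have hxb' : c' ⬝ᵥ x = b' := by
    rw [hGeq] at hxG
    exact hxG.2
  have hyb' : c' ⬝ᵥ y < b' := lt_of_le_of_ne (hb' y hyF) fun h => hyG (by
    rw [hGeq]
    exact ⟨hyF, h⟩)
  obtain ⟨H, a, e, hH, ha, hHeq, hxH, hau⟩ := exists_isFacetOf_of_ray hQ htop (u := x - y)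
    (hFQ (hGF hxG)) fun ε hε hmem => by
      have hmemF : x + ε • (x - y) ∈ F := by
        rw [hFeq]
        refine ⟨hmem, ?_⟩
        rw [dotProduct_add, dotProduct_smul, dotProduct_sub, hcF y hyF, hcF x (hGF hxG)]
        simp
      have h1 := hb' _ hmemF
      rw [dotProduct_add, dotProduct_smul, dotProduct_sub, hxb', smul_eq_mul] at h1
      nlinarith
  rw [hHeq] at hxH
  rw [dotProduct_sub, hxH.2, sub_pos] at hau
  refine ⟨H, hH, ?_, fun z hz => ?_⟩
  · rintro rfl
    rw [hHeq] at hyF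
    exact hau.ne hyF.2
  · rw [hHeq]
    exact ⟨hFQ (hGF hz), hx a e (fun w hw => ha w (hFQ (hGF hw))) hxH.2 z hz⟩

lemma facetCount_lt_of_isFacetOf (hQ : IsPolytope Q) (htop : affineSpan ℝ Q = ⊤)
    (hF : IsFacetOf F Q) : facetCount F < facetCount Q := by
  have hfin := finite_setOf_isFacetOf hQ
  have hsub : {G | IsFacetOf G F} ⊆ (fun H => F ∩ H) '' ({H | IsFacetOf H Q} \ {F}) :=
    fun G hG => by
      obtain ⟨H, hH, hne, rfl⟩ := exists_isFacetOf_inter_eq hQ htop hF hG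
      exact ⟨H, ⟨hH, hne⟩, rfl⟩
  calc facetCount F ≤ ((fun H => F ∩ H) '' ({H | IsFacetOf H Q} \ {F})).ncard :=
        ncard_le_ncard hsub (hfin.sdiff.image _)
    _ ≤ ({H | IsFacetOf H Q} \ {F}).ncard := ncard_image_le hfin.sdiff
    _ < facetCount Q := ncard_sdiff_singleton_lt_of_mem hF hfin

lemma exists_isFacetOf_mem_notMem (hQ : IsPolytope Q) (htop : affineSpan ℝ Q = ⊤)
    {v x : Fin N → ℝ} (hv : IsVertexOf v Q) (hx : x ∈ Q) (hxv : x ≠ v) :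
    ∃ H, IsFacetOf H Q ∧ v ∈ H ∧ x ∉ H := by
  obtain ⟨c, b, hb, hvb⟩ := isFaceOf_iff.1 hv
  have hvb' : v ∈ Q ∧ c ⬝ᵥ v = b := hvb.subset rfl
  have hxb : c ⬝ᵥ x < b := lt_of_le_of_ne (hb x hx) fun h => hxv (hvb.symm.subset ⟨hx, h⟩)
  obtain ⟨H, a, e, hH, ha, rfl, hvH, hau⟩ := exists_isFacetOf_of_ray hQ htop (u := v - x) hvb'.1
    fun ε hε hmem => by
      have h1 := hb _ hmem
      rw [dotProduct_add, dotProduct_smul, dotProduct_sub, hvb'.2, smul_eq_mul] at h1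
      nlinarith
  refine ⟨_, hH, hvH, fun hxH => ?_⟩
  rw [dotProduct_sub, hvH.2, hxH.2, sub_self] at hau
  exact lt_irrefl _ hau

lemma sInter_isFacetOf_eq_singleton (hQ : IsPolytope Q) (htop : affineSpan ℝ Q = ⊤)
    {v w : Fin N → ℝ} (hv : IsVertexOf v Q) (hw : w ∈ Q) (hwv : w ≠ v) :
    ⋂₀ {H | IsFacetOf H Q ∧ v ∈ H} = {v} := by
  refine Subset.antisymm (fun x hx => ?_) (singleton_subset_iff.2 fun H hH => hH.2)
  by_contra hxv
  obtain ⟨H₀, hH₀, hv₀, -⟩ := exists_isFacetOf_mem_notMem hQ htop hv hw hwv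
  obtain ⟨H, hH, hvH, hxH⟩ := exists_isFacetOf_mem_notMem hQ htop hv
    (subset_of_isFaceOf hH₀.1 (hx H₀ ⟨hH₀, hv₀⟩)) hxv
  exact hxH (hx H ⟨hH, hvH⟩)

end Facets

section Projection

variable {d : ℕ} {Q : Set (Fin (d + 1) → ℝ)}

/-- `projFun` as a linear map. -/
def projLin (d : ℕ) : (Fin (d + 1) → ℝ) →ₗ[ℝ] (Fin d → ℝ) where
  toFun := projFun d
  map_add' _ _ := rfl
  map_smul' _ _ := rfl

lemma coe_projLin (d : ℕ) : ⇑(projLin d) = projFun d := rfl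

lemma projFun_add_smul_single (x : Fin (d + 1) → ℝ) (t : ℝ) :
    projFun d (x + t • Pi.single (Fin.last d) 1) = projFun d x := by
  ext i
  simp [projFun, (Fin.castSucc_lt_last i).ne]

lemma eq_add_smul_single_of_projFun_eq {x y : Fin (d + 1) → ℝ} (h : projFun d x = projFun d y) :
    x = y + (x (Fin.last d) - y (Fin.last d)) • Pi.single (Fin.last d) 1 := by
  ext i
  refine Fin.lastCases ?_ (fun j => ?_) i
  · simp
  · have hj : x j.castSucc = y j.castSucc := congrFun h j
    simp [(Fin.castSucc_lt_last j).ne, hj]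

lemma strictlyPreservedFace_singleton_iff (v : Fin (d + 1) → ℝ) :
    StrictlyPreservedFace Q {v} ↔ PreservedFace Q {v} := by
  rw [StrictlyPreservedFace, image_singleton, pdim_singleton, pdim_singleton]
  simp

lemma preservedFace_of_isVertexOf (hQ : IsPolytope Q) {v : Fin (d + 1) → ℝ} (hv : IsVertexOf v Q)
    (hfib : ∀ w ∈ Q, projFun d w = projFun d v → w = v) : PreservedFace Q {v} := by
  rw [PreservedFace, image_singleton]
  refine ⟨?_, Subset.antisymm (fun w hw => hfib w hw.2 hw.1)
    (singleton_subset_iff.2 ⟨rfl, mem_of_isVertexOf hv⟩)⟩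
  obtain ⟨S, rfl⟩ := hQ
  have hvS := mem_of_isVertexOf_convexHull hv
  have hnot : projFun d v ∉ convexHull ℝ (projFun d '' ((S : Set (Fin (d + 1) → ℝ)) \ {v})) := by
    rw [← coe_projLin, ← (projLin d).image_convexHull]
    rintro ⟨w, hw, hwv⟩
    obtain rfl := hfib w (convexHull_mono sdiff_subset hw) hwv
    obtain ⟨c, b, hb, hvb⟩ := isFaceOf_iff.1 hv
    have hmem := mem_convexHull_of_dotProduct_eq
      (fun g hg => hb g (subset_convexHull ℝ _ hg.1)) hw (hvb.subset rfl).2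
    have hempty : {g ∈ (S : Set (Fin (d + 1) → ℝ)) \ {w} | c ⬝ᵥ g = b} = ∅ :=
      eq_empty_of_forall_notMem fun g hg =>
        hg.1.2 (hvb.symm.subset ⟨subset_convexHull ℝ _ hg.1.1, hg.2⟩)
    rw [hempty, convexHull_empty] at hmem
    exact hmem
  obtain ⟨f, u, hf, hu⟩ := geometric_hahn_banach_closed_point (convex_convexHull ℝ _)
    (((S.finite_toSet.sdiff).image _).isClosed_convexHull ℝ) hnot
  obtain ⟨c, hc⟩ := exists_dotProduct_eq (f : (Fin d → ℝ) →ₗ[ℝ] ℝ)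
  rw [← coe_projLin, (projLin d).image_convexHull, coe_projLin]
  refine isVertexOf_of_dotProduct_lt (mem_image_of_mem _ hvS) c ?_
  rintro _ ⟨w, hw, rfl⟩ hwv
  rw [← hc, ← hc]
  exact (hf _ (subset_convexHull ℝ _ ⟨w, ⟨hw, fun h => hwv (by rw [h])⟩, rfl⟩)).trans hu

lemma affineSpan_eq_top_of_projFun_eq (hdP : pdim (projFun d '' Q) = d) {v w : Fin (d + 1) → ℝ}
    (hv : v ∈ Q) (hw : w ∈ Q) (hwv : projFun d w = projFun d v) (hne : w ≠ v) :
    affineSpan ℝ Q = ⊤ := by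
  rw [pdim_of_nonempty ⟨_, mem_image_of_mem _ hv⟩, ← coe_projLin, Nat.cast_inj] at hdP
  have hmap : (vectorSpan ℝ Q).map (projLin d) = vectorSpan ℝ (projLin d '' Q) := by
    simpa using (projLin d).toAffineMap.map_vectorSpan (s := Q)
  have htop : (vectorSpan ℝ Q).map (projLin d) = ⊤ := by
    rw [hmap]
    exact Submodule.eq_top_of_finrank_eq (by simpa using hdP)
  have he : (Pi.single (Fin.last d) 1 : Fin (d + 1) → ℝ) ∈ vectorSpan ℝ Q := by
    have h1 := eq_add_smul_single_of_projFun_eq hwv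
    have h2 : w (Fin.last d) - v (Fin.last d) ≠ 0 := fun h => hne (by rw [h1, h]; simp)
    have h3 := vsub_mem_vectorSpan ℝ hw hv
    rw [vsub_eq_sub, sub_eq_of_eq_add' h1] at h3
    exact (Submodule.smul_mem_iff _ h2).1 h3
  rw [← AffineSubspace.direction_eq_top_iff_of_nonempty ((affineSpan_nonempty ℝ).2 ⟨v, hv⟩),
    direction_affineSpan, eq_top_iff]
  intro x _
  obtain ⟨y, hy, hyx⟩ : projLin d x ∈ (vectorSpan ℝ Q).map (projLin d) :=
    htop ▸ Submodule.mem_top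
  rw [eq_add_smul_single_of_projFun_eq (x := x) (y := y) hyx.symm]
  exact add_mem hy (Submodule.smul_mem _ _ he)

/-- The facets whose outer normal has a last coordinate of the sign of `s`. -/
def IsSideFacet (s : ℝ) (F Q : Set (Fin (d + 1) → ℝ)) : Prop :=
  IsFacetOf F Q ∧ ∃ c, IsOuterNormal Q F c ∧ 0 < s * c (Fin.last d)

lemma isSideFacet_one_iff (F : Set (Fin (d + 1) → ℝ)) : IsSideFacet 1 F Q ↔ IsUpperFacet F Q := by
  simp [IsSideFacet, IsUpperFacet]

lemma isSideFacet_neg_one_iff (F : Set (Fin (d + 1) → ℝ)) :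
    IsSideFacet (-1) F Q ↔ IsLowerFacet F Q := by
  simp [IsSideFacet, IsLowerFacet]

/-- The side facets for a fixed nonzero `s` project onto the whole image. -/
lemma exists_isSideFacet_projFun_eq (hQ : IsPolytope Q) (htop : affineSpan ℝ Q = ⊤) {s : ℝ}
    (hs : s ≠ 0) {x : Fin (d + 1) → ℝ} (hx : x ∈ Q) :
    ∃ F, IsSideFacet s F Q ∧ ∃ y ∈ F, projFun d y = projFun d x := by
  have hproj : Continuous (projFun d) := (projLin d).continuous_of_finiteDimensional
  have hcomp : IsCompact (Q ∩ projFun d ⁻¹' {projFun d x}) :=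
    (isCompact_of_isPolytope hQ).inter_right (isClosed_singleton.preimage hproj)
  obtain ⟨y, hy, hmax⟩ := hcomp.exists_isMaxOn ⟨x, hx, rfl⟩
    (f := fun y => s * y (Fin.last d)) (by fun_prop)
  obtain ⟨F, c, b, hF, hb, hFeq, hyF, hc⟩ := exists_isFacetOf_of_ray hQ htop hy.1
    (u := s • Pi.single (Fin.last d) 1) fun ε hε hmem => by
      rw [smul_smul] at hmem
      have h1 : s * (y + (ε * s) • Pi.single (Fin.last d) (1 : ℝ) : Fin (d + 1) → ℝ) (Fin.last d) ≤
          s * y (Fin.last d) :=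
        hmax ⟨hmem, (projFun_add_smul_single y _).trans hy.2⟩
      simp only [Pi.add_apply, Pi.smul_apply, Pi.single_eq_same, smul_eq_mul, mul_one] at h1
      have : 0 < ε * (s * s) := mul_pos hε (mul_self_pos.2 hs)
      linarith
  refine ⟨F, ⟨hF, c, ⟨b, hb, hFeq⟩, ?_⟩, y, hyF, hy.2⟩
  simpa using hc

/-- In a minimal extension there is no single side facet. -/
lemma exists_isSideFacet_ne (hQ : IsPolytope Q) (htop : affineSpan ℝ Q = ⊤)
    (hmin : facetCount Q = xc (projFun d '' Q)) {s : ℝ} (hs : s ≠ 0) {F : Set (Fin (d + 1) → ℝ)}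
    (hF : IsFacetOf F Q) : ∃ H, IsSideFacet s H Q ∧ H ≠ F := by
  by_contra! hcon
  have himage : projFun d '' F = projFun d '' Q := by
    refine Subset.antisymm (image_mono (subset_of_isFaceOf hF.1)) ?_
    rintro _ ⟨x, hx, rfl⟩
    obtain ⟨H, hH, y, hy, hyx⟩ := exists_isSideFacet_projFun_eq hQ htop hs hx
    exact ⟨y, hcon H hH ▸ hy, hyx⟩
  have hle : xc (projFun d '' Q) ≤ facetCount F :=
    Nat.sInf_le ⟨d + 1, F, (projLin d).toAffineMap, isPolytope_of_isFaceOf hQ hF.1, himage, rfl⟩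
  have := facetCount_lt_of_isFacetOf hQ htop hF
  omega

lemma notMem_of_isSideFacet {s t : ℝ} {v : Fin (d + 1) → ℝ}
    (hw : v + t • Pi.single (Fin.last d) 1 ∈ Q) (hst : 0 < s * t) {F : Set (Fin (d + 1) → ℝ)}
    (hF : IsSideFacet s F Q) : v ∉ F := by
  obtain ⟨-, c, ⟨b, hb, rfl⟩, hc⟩ := hF
  intro hv
  have h1 : c ⬝ᵥ (v + t • Pi.single (Fin.last d) 1) ≤ b := hb _ hw
  have h2 : c ⬝ᵥ v = b := hv.2
  rw [dotProduct_add, dotProduct_smul, dotProduct_single, h2, smul_eq_mul, mul_one] at h1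
  nlinarith [mul_pos hst hc, mul_self_nonneg s]

end Projection

section Model

variable {n m k : ℕ}

lemma dotProduct_append {p q : ℕ} (a c : Fin p → ℝ) (b e : Fin q → ℝ) :
    Fin.append a b ⬝ᵥ Fin.append c e = a ⬝ᵥ c + b ⬝ᵥ e := by
  simp [dotProduct, Fin.sum_univ_add]

/-- The vertices of `simplexF n`. -/
def simplexVertex (n : ℕ) : Option (Fin n) → (Fin n → ℝ)
  | none => fun _ => -1
  | some i => Pi.single i 1

/-- An outer normal vector of the facet of `simplexF n` opposite to a given vertex. -/
def simplexNormal (n : ℕ) : Option (Fin n) → (Fin n → ℝ)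
  | none => fun _ => 1
  | some i => (fun _ => 1) - ((n : ℝ) + 1) • Pi.single i 1

lemma simplexNormal_dotProduct_of_ne {i j : Option (Fin n)} (h : j ≠ i) :
    simplexNormal n i ⬝ᵥ simplexVertex n j = 1 := by
  match i, j with
  | none, none => exact absurd rfl h
  | none, some j => simp [simplexNormal, simplexVertex]
  | some i, none =>
    simp [simplexNormal, simplexVertex, dotProduct, Pi.single_apply]
  | some i, some j =>
    have hji : j ≠ i := fun e => h (by rw [e])
    simp [simplexNormal, simplexVertex, hji]

lemma simplexNormal_dotProduct_self (i : Option (Fin n)) :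
    simplexNormal n i ⬝ᵥ simplexVertex n i = -n := by
  match i with
  | none => simp [simplexNormal, simplexVertex, dotProduct]
  | some i => simp [simplexNormal, simplexVertex]

lemma simplexNormal_dotProduct_le (i j : Option (Fin n)) :
    simplexNormal n i ⬝ᵥ simplexVertex n j ≤ 1 := by
  rcases eq_or_ne j i with rfl | h
  · rw [simplexNormal_dotProduct_self]
    linarith [Nat.cast_nonneg (α := ℝ) n]
  · exact (simplexNormal_dotProduct_of_ne h).le

lemma simplexNormal_dotProduct_eq_one_iff (i j : Option (Fin n)) :
    simplexNormal n i ⬝ᵥ simplexVertex n j = 1 ↔ j ≠ i := by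
  refine ⟨?_, simplexNormal_dotProduct_of_ne⟩
  rintro h rfl
  rw [simplexNormal_dotProduct_self] at h
  linarith [Nat.cast_nonneg (α := ℝ) n]

lemma neg_le_simplexNormal_dotProduct (i j : Option (Fin n)) :
    -(n : ℝ) ≤ simplexNormal n i ⬝ᵥ simplexVertex n j := by
  rcases eq_or_ne j i with rfl | h
  · rw [simplexNormal_dotProduct_self]
  · rw [simplexNormal_dotProduct_of_ne h]
    linarith [Nat.cast_nonneg (α := ℝ) n]

lemma simplexF_eq (n : ℕ) : simplexF n = convexHull ℝ (range (simplexVertex n)) := by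
  rw [simplexF]
  congr 1
  ext x
  simp [simplexVertex, Option.exists, eq_comm]

/-- The vertices of `pyrK k (prodP n m)`. -/
def modelVertex (n m k : ℕ) :
    (Option (Fin n) × Option (Fin m)) ⊕ Fin k → (Fin (n + m + k) → ℝ)
  | .inl p => Fin.append (Fin.append (simplexVertex n p.1) (simplexVertex m p.2)) 0
  | .inr l => Fin.append 0 (Pi.single l 1)

lemma append_append_dotProduct_inl (a : Fin n → ℝ) (b : Fin m → ℝ) (c : Fin k → ℝ)
    (p : Option (Fin n) × Option (Fin m)) :
    Fin.append (Fin.append a b) c ⬝ᵥ modelVertex n m k (.inl p) =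
      a ⬝ᵥ simplexVertex n p.1 + b ⬝ᵥ simplexVertex m p.2 := by
  simp [modelVertex, dotProduct_append]

lemma append_dotProduct_inr (a : Fin (n + m) → ℝ) (c : Fin k → ℝ) (l : Fin k) :
    Fin.append a c ⬝ᵥ modelVertex n m k (.inr l) = c l := by
  simp [modelVertex, dotProduct_append]

lemma modelVertex_add (i i' : Option (Fin n)) (j j' : Option (Fin m)) :
    modelVertex n m k (.inl (i, j)) + modelVertex n m k (.inl (i', j')) =
      modelVertex n m k (.inl (i, j')) + modelVertex n m k (.inl (i', j)) := by
  ext x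
  refine Fin.addCases (fun y => Fin.addCases (fun z => ?_) (fun z => ?_) y) (fun y => ?_) x <;>
    simp [modelVertex, add_comm]

lemma pyrK_prodP_eq (n m k : ℕ) :
    pyrK k (prodP n m) = convexHull ℝ (range (modelVertex n m k)) := by
  refine Subset.antisymm (convexHull_min (union_subset ?_ ?_) (convex_convexHull ℝ _))
    (convexHull_mono ?_)
  · rintro _ ⟨_, ⟨a, ha, b, hb, rfl⟩, rfl⟩
    rw [simplexF_eq] at ha hb
    let f : (Fin n → ℝ) →ₗ[ℝ] (Fin (n + m + k) → ℝ) :=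
      { toFun := fun a => Fin.append (Fin.append a 0) 0
        map_add' := fun x y => by
          ext z
          refine Fin.addCases (fun z => Fin.addCases (fun z => ?_) (fun z => ?_) z) (fun z => ?_) z
            <;> simp
        map_smul' := fun r x => by
          ext z
          refine Fin.addCases (fun z => Fin.addCases (fun z => ?_) (fun z => ?_) z) (fun z => ?_) z
            <;> simp }
    let g : (Fin m → ℝ) →ₗ[ℝ] (Fin (n + m + k) → ℝ) :=
      { toFun := fun b => Fin.append (Fin.append 0 b) 0
        map_add' := fun x y => by
          ext z
          refine Fin.addCases (fun z => Fin.addCases (fun z => ?_) (fun z => ?_) z) (fun z => ?_) z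
            <;> simp
        map_smul' := fun r x => by
          ext z
          refine Fin.addCases (fun z => Fin.addCases (fun z => ?_) (fun z => ?_) z) (fun z => ?_) z
            <;> simp }
    have hfg : ∀ a b, Fin.append (Fin.append a b) (0 : Fin k → ℝ) = f a + g b := fun a b => by
      ext z
      refine Fin.addCases (fun z => Fin.addCases (fun z => ?_) (fun z => ?_) z) (fun z => ?_) z
        <;> simp [f, g]
    have h1 : f a ∈ convexHull ℝ (f '' range (simplexVertex n)) := by
      rw [← f.image_convexHull]
      exact mem_image_of_mem f ha
    have h2 : g b ∈ convexHull ℝ (g '' range (simplexVertex m)) := by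
      rw [← g.image_convexHull]
      exact mem_image_of_mem g hb
    have h3 := Set.add_mem_add h1 h2
    rw [← convexHull_add] at h3
    change Fin.append (Fin.append a b) 0 ∈ _
    rw [hfg]
    refine convexHull_mono ?_ h3
    rintro _ ⟨_, ⟨_, ⟨i, rfl⟩, rfl⟩, _, ⟨_, ⟨j, rfl⟩, rfl⟩, rfl⟩
    exact ⟨.inl (i, j), hfg _ _⟩
  · rintro _ ⟨l, rfl⟩
    exact subset_convexHull ℝ _ ⟨.inr l, rfl⟩
  · rintro _ ⟨⟨i, j⟩ | l, rfl⟩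
    · refine Or.inl ⟨_, ⟨_, ?_, _, ?_, rfl⟩, rfl⟩ <;>
        exact simplexF_eq _ ▸ subset_convexHull ℝ _ (mem_range_self _)
    · exact Or.inr ⟨l, rfl⟩

lemma isPolytope_pyrK_prodP (n m k : ℕ) : IsPolytope (pyrK k (prodP n m)) := by
  rw [pyrK_prodP_eq]
  exact isPolytope_of_finite (finite_range _)

lemma exists_dotProduct_modelVertex_lt (g : (Option (Fin n) × Option (Fin m)) ⊕ Fin k) :
    ∃ c : Fin (n + m + k) → ℝ, ∀ g' ≠ g, c ⬝ᵥ modelVertex n m k g' < c ⬝ᵥ modelVertex n m k g := by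
  have hn : (0 : ℝ) ≤ n := Nat.cast_nonneg n
  have hm : (0 : ℝ) ≤ m := Nat.cast_nonneg m
  rcases g with ⟨i, j⟩ | l
  · refine ⟨Fin.append (Fin.append (-simplexNormal n i) (-simplexNormal m j)) (fun _ => -1), ?_⟩
    rintro (⟨i', j'⟩ | l) hne
    · simp only [append_append_dotProduct_inl, neg_dotProduct, simplexNormal_dotProduct_self]
      have hi := neg_le_simplexNormal_dotProduct i i'
      have hj := neg_le_simplexNormal_dotProduct j j'
      rcases eq_or_ne i' i with rfl | h
      · have h' : j' ≠ j := fun e => hne (by rw [e])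
        rw [simplexNormal_dotProduct_of_ne h']
        linarith
      · rw [simplexNormal_dotProduct_of_ne h]
        linarith
    · simp only [append_append_dotProduct_inl, append_dotProduct_inr, neg_dotProduct,
        simplexNormal_dotProduct_self]
      linarith
  · refine ⟨Fin.append (Fin.append 0 0) (Pi.single l 1), ?_⟩
    rintro (p | l') hne
    · simp [append_append_dotProduct_inl, append_dotProduct_inr]
    · have h : l' ≠ l := fun e => hne (by rw [e])
      simp [append_dotProduct_inr, h]

lemma modelVertex_injective (n m k : ℕ) : Function.Injective (modelVertex n m k) := by
  intro g g' h
  by_contra hne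
  obtain ⟨c, hc⟩ := exists_dotProduct_modelVertex_lt g'
  exact (hc g hne).ne (by rw [h])

lemma isVertexOf_modelVertex (g : (Option (Fin n) × Option (Fin m)) ⊕ Fin k) :
    IsVertexOf (modelVertex n m k g) (pyrK k (prodP n m)) := by
  obtain ⟨c, hc⟩ := exists_dotProduct_modelVertex_lt g
  rw [pyrK_prodP_eq]
  refine isVertexOf_of_dotProduct_lt (mem_range_self g) c ?_
  rintro _ ⟨g', rfl⟩ hne
  exact hc g' fun e => hne (by rw [e])

lemma subset_of_forall_modelVertex_mem {F G : Set (Fin (n + m + k) → ℝ)}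
    (hF : IsFaceOf F (pyrK k (prodP n m))) (hG : IsFaceOf G (pyrK k (prodP n m)))
    (h : ∀ g, modelVertex n m k g ∈ F → modelVertex n m k g ∈ G) : F ⊆ G := by
  rw [pyrK_prodP_eq] at hF hG
  rw [eq_convexHull_of_isFaceOf hF, eq_convexHull_of_isFaceOf hG]
  refine convexHull_mono ?_
  rintro _ ⟨⟨g, rfl⟩, hg⟩
  exact ⟨⟨g, rfl⟩, h g hg⟩

lemma exists_isFaceOf_modelVertex_mem_iff (c : Fin (n + m + k) → ℝ) (b : ℝ)
    (h : ∀ g, c ⬝ᵥ modelVertex n m k g ≤ b) :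
    ∃ F, IsFaceOf F (pyrK k (prodP n m)) ∧
      ∀ g, modelVertex n m k g ∈ F ↔ c ⬝ᵥ modelVertex n m k g = b := by
  rw [pyrK_prodP_eq]
  refine ⟨_, isFaceOf_iff.2 ⟨c, b, dotProduct_le_of_mem_convexHull ?_, rfl⟩, fun g => ?_⟩
  · rintro _ ⟨g, rfl⟩
    exact h g
  · exact ⟨fun hg => hg.2, fun hg => ⟨subset_convexHull ℝ _ (mem_range_self g), hg⟩⟩

lemma exists_isFaceOf_opposite_left (m k : ℕ) (i : Option (Fin n)) :
    ∃ F, IsFaceOf F (pyrK k (prodP n m)) ∧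
      ∀ g, modelVertex n m k g ∈ F ↔ ∀ j, g ≠ .inl (i, j) := by
  obtain ⟨F, hF, hmem⟩ := exists_isFaceOf_modelVertex_mem_iff
    (Fin.append (Fin.append (simplexNormal n i) (0 : Fin m → ℝ)) (fun _ : Fin k => 1)) 1 (by
      rintro (p | l)
      · simpa [append_append_dotProduct_inl] using simplexNormal_dotProduct_le i p.1
      · simp [append_dotProduct_inr])
  refine ⟨F, hF, fun g => (hmem g).trans ?_⟩
  rcases g with ⟨i', j'⟩ | l
  · simp [append_append_dotProduct_inl, simplexNormal_dotProduct_eq_one_iff]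
  · simp [append_dotProduct_inr]

lemma exists_isFaceOf_opposite_right (n k : ℕ) (j : Option (Fin m)) :
    ∃ F, IsFaceOf F (pyrK k (prodP n m)) ∧
      ∀ g, modelVertex n m k g ∈ F ↔ ∀ i, g ≠ .inl (i, j) := by
  obtain ⟨F, hF, hmem⟩ := exists_isFaceOf_modelVertex_mem_iff
    (Fin.append (Fin.append (0 : Fin n → ℝ) (simplexNormal m j)) (fun _ : Fin k => 1)) 1 (by
      rintro (p | l)
      · simpa [append_append_dotProduct_inl] using simplexNormal_dotProduct_le j p.2
      · simp [append_dotProduct_inr])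
  refine ⟨F, hF, fun g => (hmem g).trans ?_⟩
  rcases g with ⟨i', j'⟩ | l
  · simp [append_append_dotProduct_inl, simplexNormal_dotProduct_eq_one_iff]
  · simp [append_dotProduct_inr]

lemma exists_isFaceOf_opposite_apex (n m : ℕ) (l : Fin k) :
    ∃ F, IsFaceOf F (pyrK k (prodP n m)) ∧
      ∀ g, modelVertex n m k g ∈ F ↔ g ≠ .inr l := by
  obtain ⟨F, hF, hmem⟩ := exists_isFaceOf_modelVertex_mem_iff
    (Fin.append (Fin.append (0 : Fin n → ℝ) (0 : Fin m → ℝ)) (-Pi.single l 1)) 0 (by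
      rintro (p | l')
      · simp [append_append_dotProduct_inl]
      · rcases eq_or_ne l' l with rfl | h
        · simp [append_dotProduct_inr]
        · simp [append_dotProduct_inr, h])
  refine ⟨F, hF, fun g => (hmem g).trans ?_⟩
  rcases g with p | l'
  · simp [append_append_dotProduct_inl]
  · simp [append_dotProduct_inr, Pi.single_apply]

/-- The faces of `P` avoiding the vertex `v` are covered by two of them, and if two are needed then
each of these misses at least two vertices. -/
def AvoidingFacesCovered {N : ℕ} (P : Set (Fin N → ℝ)) (v : Fin N → ℝ) : Prop :=
  ∃ D₁ D₂, IsFaceOf D₁ P ∧ IsFaceOf D₂ P ∧ v ∉ D₁ ∧ v ∉ D₂ ∧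
    (∀ G, IsFaceOf G P → v ∉ G → G ⊆ D₁ ∨ G ⊆ D₂) ∧
    (D₁ = D₂ ∨ ∀ D, D = D₁ ∨ D = D₂ →
      ∃ w₁ w₂, IsVertexOf w₁ P ∧ IsVertexOf w₂ P ∧ w₁ ≠ w₂ ∧ w₁ ∉ D ∧ w₂ ∉ D)

lemma avoidingFacesCovered_pyrK_prodP {v : Fin (n + m + k) → ℝ}
    (hv : IsVertexOf v (pyrK k (prodP n m))) : AvoidingFacesCovered (pyrK k (prodP n m)) v := by
  obtain ⟨g, rfl⟩ : v ∈ range (modelVertex n m k) := by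
    rw [pyrK_prodP_eq] at hv
    exact mem_of_isVertexOf_convexHull hv
  rcases g with ⟨i, j⟩ | l
  · obtain ⟨A, hA, hAmem⟩ := exists_isFaceOf_opposite_left m k i
    obtain ⟨B, hB, hBmem⟩ := exists_isFaceOf_opposite_right n k j
    have hvA : modelVertex n m k (.inl (i, j)) ∉ A := fun h => (hAmem _).1 h j rfl
    have hvB : modelVertex n m k (.inl (i, j)) ∉ B := fun h => (hBmem _).1 h i rfl
    have hnotA : ∀ G, IsFaceOf G (pyrK k (prodP n m)) → ¬ G ⊆ A →
        ∃ j', modelVertex n m k (.inl (i, j')) ∈ G := fun G hG h => by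
      by_contra! hcon
      refine h (subset_of_forall_modelVertex_mem hG hA fun g hg => (hAmem g).2 ?_)
      rintro j' rfl
      exact hcon j' hg
    have hnotB : ∀ G, IsFaceOf G (pyrK k (prodP n m)) → ¬ G ⊆ B →
        ∃ i', modelVertex n m k (.inl (i', j)) ∈ G := fun G hG h => by
      by_contra! hcon
      refine h (subset_of_forall_modelVertex_mem hG hB fun g hg => (hBmem g).2 ?_)
      rintro i' rfl
      exact hcon i' hg
    rcases m.eq_zero_or_pos with rfl | hm
    · refine ⟨A, A, hA, hA, hvA, hvA, fun G hG hvG => Or.inl ?_, Or.inl rfl⟩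
      by_contra h
      obtain ⟨j', hj'⟩ := hnotA G hG h
      exact hvG (Subsingleton.elim j' j ▸ hj')
    rcases n.eq_zero_or_pos with rfl | hn
    · refine ⟨B, B, hB, hB, hvB, hvB, fun G hG hvG => Or.inl ?_, Or.inl rfl⟩
      by_contra h
      obtain ⟨i', hi'⟩ := hnotB G hG h
      exact hvG (Subsingleton.elim i' i ▸ hi')
    refine ⟨A, B, hA, hB, hvA, hvB, fun G hG hvG => ?_, Or.inr ?_⟩
    · by_contra! h
      obtain ⟨j', hj'⟩ := hnotA G hG h.1
      obtain ⟨i', hi'⟩ := hnotB G hG h.2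
      obtain ⟨c, b, hb, rfl⟩ := isFaceOf_iff.1 hG
      have hsum := congrArg (c ⬝ᵥ ·) (modelVertex_add (k := k) i i' j j')
      simp only [dotProduct_add] at hsum
      rw [hj'.2, hi'.2] at hsum
      have h1 := mem_of_isVertexOf (isVertexOf_modelVertex (k := k) (.inl (i, j)))
      have h2 := mem_of_isVertexOf (isVertexOf_modelVertex (k := k) (.inl (i', j')))
      exact hvG ⟨h1, by linarith [hb _ h1, hb _ h2]⟩
    · have : Nonempty (Fin m) := ⟨⟨0, hm⟩⟩
      have : Nonempty (Fin n) := ⟨⟨0, hn⟩⟩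
      obtain ⟨j', hj'⟩ := exists_ne j
      obtain ⟨i', hi'⟩ := exists_ne i
      rintro D (rfl | rfl)
      · exact ⟨_, _, isVertexOf_modelVertex (.inl (i, j)), isVertexOf_modelVertex (.inl (i, j')),
          (modelVertex_injective n m k).ne (by simpa using hj'.symm), hvA,
          fun h => (hAmem _).1 h j' rfl⟩
      · exact ⟨_, _, isVertexOf_modelVertex (.inl (i, j)), isVertexOf_modelVertex (.inl (i', j)),
          (modelVertex_injective n m k).ne (by simpa using hi'.symm), hvB,
          fun h => (hBmem _).1 h i' rfl⟩
  · obtain ⟨A, hA, hAmem⟩ := exists_isFaceOf_opposite_apex n m l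
    have hvA : modelVertex n m k (.inr l) ∉ A := fun h => (hAmem _).1 h rfl
    refine ⟨A, A, hA, hA, hvA, hvA, fun G hG hvG => Or.inl ?_, Or.inl rfl⟩
    refine subset_of_forall_modelVertex_mem hG hA fun g hg => (hAmem g).2 ?_
    rintro rfl
    exact hvG hg

end Model

section Transport

variable {M N : ℕ} {P : Set (Fin M → ℝ)} {Q : Set (Fin N → ℝ)}

/-- An isomorphism of face lattices maps vertices to vertices. -/
lemma exists_isVertexOf_eq_singleton (hQ : IsPolytope Q)
    (φ : {F : Set (Fin M → ℝ) // IsFaceOf F P} ≃ {G : Set (Fin N → ℝ) // IsFaceOf G Q})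
    (hφ : ∀ F₁ F₂, F₁.1 ⊆ F₂.1 ↔ (φ F₁).1 ⊆ (φ F₂).1) {v : Fin M → ℝ} (hv : IsVertexOf v P) :
    ∃ w, IsVertexOf w Q ∧ (φ ⟨{v}, hv⟩).1 = {w} := by
  have hne : (φ ⟨{v}, hv⟩).1.Nonempty := by
    by_contra h
    have h1 : (φ ⟨{v}, hv⟩).1 ⊆ (φ ⟨∅, isFaceOf_empty P⟩).1 := by
      rw [not_nonempty_iff_eq_empty.1 h]
      exact empty_subset _
    exact singleton_ne_empty v (subset_empty_iff.1 ((hφ _ _).2 h1))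
  obtain ⟨w, hwmem, hw⟩ := exists_isVertexOf_mem hQ (φ ⟨{v}, hv⟩).2 hne
  refine ⟨w, hw, ?_⟩
  have hsub : (φ.symm ⟨{w}, hw⟩).1 ⊆ {v} := by
    refine (hφ (φ.symm ⟨{w}, hw⟩) ⟨{v}, hv⟩).2 ?_
    rw [φ.apply_symm_apply]
    exact singleton_subset_iff.2 hwmem
  rcases subset_singleton_iff_eq.1 hsub with h | h
  · have h1 : (φ.symm ⟨{w}, hw⟩).1 ⊆ (φ.symm ⟨∅, isFaceOf_empty Q⟩).1 := by
      rw [h]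
      exact empty_subset _
    rw [hφ, φ.apply_symm_apply, φ.apply_symm_apply] at h1
    exact absurd (subset_empty_iff.1 h1) (singleton_ne_empty w)
  · have h1 : φ.symm ⟨{w}, hw⟩ = ⟨{v}, hv⟩ := Subtype.ext h
    rw [← h1, φ.apply_symm_apply]

lemma avoidingFacesCovered_of_combEquiv (hP : IsPolytope P) (hQ : IsPolytope Q)
    (h : CombEquiv P Q) (hcov : ∀ w, IsVertexOf w Q → AvoidingFacesCovered Q w)
    {v : Fin M → ℝ} (hv : IsVertexOf v P) : AvoidingFacesCovered P v := by
  obtain ⟨φ, hφ⟩ := h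
  have hφ' : ∀ G₁ G₂, G₁.1 ⊆ G₂.1 ↔ (φ.symm G₁).1 ⊆ (φ.symm G₂).1 := fun G₁ G₂ => by
    rw [hφ, φ.apply_symm_apply, φ.apply_symm_apply]
  obtain ⟨w, hw, hvw⟩ := exists_isVertexOf_eq_singleton hQ φ hφ hv
  have hmem : ∀ F, v ∈ F.1 ↔ w ∈ (φ F).1 := fun F => by
    rw [← singleton_subset_iff, ← singleton_subset_iff (a := w), ← hvw, ← hφ]
  obtain ⟨D₁, D₂, hD₁, hD₂, hw₁, hw₂, hG, hD⟩ := hcov w hw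
  refine ⟨(φ.symm ⟨D₁, hD₁⟩).1, (φ.symm ⟨D₂, hD₂⟩).1, (φ.symm ⟨D₁, hD₁⟩).2, (φ.symm ⟨D₂, hD₂⟩).2,
    ?_, ?_, fun F hF hvF => ?_, ?_⟩
  · rwa [hmem, φ.apply_symm_apply]
  · rwa [hmem, φ.apply_symm_apply]
  · rw [hmem ⟨F, hF⟩] at hvF
    refine (hG _ (φ ⟨F, hF⟩).2 hvF).imp (fun hsub => ?_) fun hsub => ?_
    · exact (hφ ⟨F, hF⟩ _).2 (by rwa [φ.apply_symm_apply])
    · exact (hφ ⟨F, hF⟩ _).2 (by rwa [φ.apply_symm_apply])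
  · have htransport : ∀ D (hD : IsFaceOf D Q),
        (∃ w₁ w₂, IsVertexOf w₁ Q ∧ IsVertexOf w₂ Q ∧ w₁ ≠ w₂ ∧ w₁ ∉ D ∧ w₂ ∉ D) →
        ∃ v₁ v₂, IsVertexOf v₁ P ∧ IsVertexOf v₂ P ∧ v₁ ≠ v₂ ∧
          v₁ ∉ (φ.symm ⟨D, hD⟩).1 ∧ v₂ ∉ (φ.symm ⟨D, hD⟩).1 := by
      rintro D hD ⟨w₁, w₂, hw₁, hw₂, hne, hwD₁, hwD₂⟩
      obtain ⟨v₁, hv₁, hvw₁⟩ := exists_isVertexOf_eq_singleton hP φ.symm hφ' hw₁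
      obtain ⟨v₂, hv₂, hvw₂⟩ := exists_isVertexOf_eq_singleton hP φ.symm hφ' hw₂
      refine ⟨v₁, v₂, hv₁, hv₂, ?_, ?_, ?_⟩
      · rintro rfl
        have := φ.symm.injective (Subtype.ext (hvw₁.trans hvw₂.symm))
        exact hne (singleton_injective (congrArg Subtype.val this))
      · rwa [← singleton_subset_iff, ← hvw₁, ← hφ', singleton_subset_iff]
      · rwa [← singleton_subset_iff, ← hvw₂, ← hφ', singleton_subset_iff]
    refine hD.imp (fun e => by subst e; rfl) fun hD => ?_
    rintro D (rfl | rfl)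
    · exact htransport D₁ hD₁ (hD D₁ (Or.inl rfl))
    · exact htransport D₂ hD₂ (hD D₂ (Or.inr rfl))

end Transport

/-- A vertex that is not strictly preserved is cut out by all facets except two, which are the only
upper or the only lower facets, according to the sign of `s`. -/
lemma exists_isSideFacet_of_not_strictlyPreservedFace {d : ℕ} {Q : Set (Fin (d + 1) → ℝ)}
    (hQ : IsPolytope Q) (hcov : ∀ v, IsVertexOf v Q → AvoidingFacesCovered Q v)
    (hdP : pdim (projFun d '' Q) = d) (hmin : facetCount Q = xc (projFun d '' Q))
    {v : Fin (d + 1) → ℝ} (hv : IsVertexOf v Q) (hnot : ¬ StrictlyPreservedFace Q {v}) :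
    ∃ s : ℝ, (s = 1 ∨ s = -1) ∧ ∃ F₁ F₂ : Set (Fin (d + 1) → ℝ), F₁ ≠ F₂ ∧
      ({v} : Set (Fin (d + 1) → ℝ)) = ⋂₀ {H | IsFacetOf H Q ∧ H ≠ F₁ ∧ H ≠ F₂} ∧
      ¬ IsPyramidalFacet F₁ Q ∧ ¬ IsPyramidalFacet F₂ Q ∧
      ∀ H, IsSideFacet s H Q ↔ H = F₁ ∨ H = F₂ := by
  rw [strictlyPreservedFace_singleton_iff] at hnot
  obtain ⟨w, hw, hwv, hne⟩ : ∃ w ∈ Q, projFun d w = projFun d v ∧ w ≠ v := by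
    by_contra! hcon
    exact hnot (preservedFace_of_isVertexOf hQ hv hcon)
  have htop := affineSpan_eq_top_of_projFun_eq hdP (mem_of_isVertexOf hv) hw hwv hne
  obtain ⟨t, rfl⟩ : ∃ t : ℝ, w = v + t • Pi.single (Fin.last d) 1 :=
    ⟨_, eq_add_smul_single_of_projFun_eq hwv⟩
  have ht : t ≠ 0 := by
    rintro rfl
    simp at hne
  obtain ⟨s, hs, hst⟩ : ∃ s : ℝ, (s = 1 ∨ s = -1) ∧ 0 < s * t := by
    rcases ht.lt_or_gt with h | h
    · exact ⟨-1, Or.inr rfl, by linarith⟩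
    · exact ⟨1, Or.inl rfl, by linarith⟩
  have hs0 : s ≠ 0 := by
    rintro rfl
    simp at hst
  obtain ⟨F₁, hF₁, -⟩ := exists_isSideFacet_projFun_eq hQ htop hs0 hw
  obtain ⟨F₂, hF₂, hF⟩ := exists_isSideFacet_ne hQ htop hmin hs0 hF₁.1
  obtain ⟨D₁, D₂, hD₁, hD₂, hv₁, hv₂, hD, hpyr⟩ := hcov v hv
  have hfacet : ∀ H, IsFacetOf H Q → v ∉ H → H = D₁ ∨ H = D₂ := fun H hH hvH => by
    refine (hD H hH.1 hvH).imp (fun h => ?_) fun h => ?_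
    · exact ((eq_or_eq_of_isFacetOf_subset hH hD₁ h).resolve_right fun e =>
        hv₁ (e ▸ mem_of_isVertexOf hv)).symm
    · exact ((eq_or_eq_of_isFacetOf_subset hH hD₂ h).resolve_right fun e =>
        hv₂ (e ▸ mem_of_isVertexOf hv)).symm
  have hvF₁ := notMem_of_isSideFacet hw hst hF₁
  have hvF₂ := notMem_of_isSideFacet hw hst hF₂
  have h₁ := hfacet F₁ hF₁.1 hvF₁
  have h₂ := hfacet F₂ hF₂.1 hvF₂
  have hfacet' : ∀ H, IsFacetOf H Q → v ∉ H → H = F₁ ∨ H = F₂ := fun H hH hvH => by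
    have := hfacet H hH hvH
    grind
  have hpyr' : ∀ F, F = D₁ ∨ F = D₂ → ¬ IsPyramidalFacet F Q := by
    rintro F hFD ⟨-, u, -, -, hu⟩
    have hDne : D₁ ≠ D₂ := by grind
    obtain ⟨w₁, w₂, hw₁, hw₂, hww, hwF₁, hwF₂⟩ := hpyr.resolve_left hDne F hFD
    refine hww ?_
    rw [not_imp_comm.1 (hu w₁ hw₁) hwF₁, not_imp_comm.1 (hu w₂ hw₂) hwF₂]
  refine ⟨s, hs, F₁, F₂, hF.symm, ?_, hpyr' F₁ h₁, hpyr' F₂ h₂, fun H => ⟨fun hH =>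
    hfacet' H hH.1 (notMem_of_isSideFacet hw hst hH), ?_⟩⟩
  · rw [← sInter_isFacetOf_eq_singleton hQ htop hv hw hne]
    congr 1
    ext H
    refine and_congr_right fun hH => ⟨fun hvH => ?_, fun h => ?_⟩
    · exact ⟨fun e => hvF₁ (e ▸ hvH), fun e => hvF₂ (e ▸ hvH)⟩
    · by_contra hvH
      exact (hfacet' H hH hvH).elim h.1 h.2
  · rintro (rfl | rfl)
    · exact hF₁
    · exact hF₂

end PolytopeProjection

open PolytopeProjection

theorem all_but_two_vertices_strictly_preserved (d k n m : ℕ) (hknm : k + n + m = d + 1)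
    (Q : Set (Fin (d + 1) → ℝ)) (hQ : IsPolytope Q)
    (hcomb : CombEquiv Q (pyrK k (prodP n m)))
    (hdP : pdim (projFun d '' Q) = d)
    (hmin : facetCount Q = xc (projFun d '' Q)) :
    ({v : Fin (d + 1) → ℝ | IsVertexOf v Q ∧ ¬ StrictlyPreservedFace Q {v}}).ncard ≤ 2 ∧
    (∀ v : Fin (d + 1) → ℝ, IsVertexOf v Q →
      PreservedFace Q {v} → StrictlyPreservedFace Q {v}) ∧
    (∀ v : Fin (d + 1) → ℝ, IsVertexOf v Q → ¬ StrictlyPreservedFace Q {v} →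
      ∃ F₁ F₂ : Set (Fin (d + 1) → ℝ),
        IsFacetOf F₁ Q ∧ IsFacetOf F₂ Q ∧ F₁ ≠ F₂ ∧
        ({v} : Set (Fin (d + 1) → ℝ)) = ⋂₀ {H | IsFacetOf H Q ∧ H ≠ F₁ ∧ H ≠ F₂} ∧
        ¬ IsPyramidalFacet F₁ Q ∧ ¬ IsPyramidalFacet F₂ Q ∧
        ((IsUpperFacet F₁ Q ∧ IsUpperFacet F₂ Q ∧
            ∀ H, IsUpperFacet H Q → H = F₁ ∨ H = F₂) ∨
         (IsLowerFacet F₁ Q ∧ IsLowerFacet F₂ Q ∧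
            ∀ H, IsLowerFacet H Q → H = F₁ ∨ H = F₂))) := by
  have hcov : ∀ v, IsVertexOf v Q → AvoidingFacesCovered Q v := fun v =>
    avoidingFacesCovered_of_combEquiv hQ (isPolytope_pyrK_prodP n m k) hcomb
      fun w => avoidingFacesCovered_pyrK_prodP
  have key := fun v => exists_isSideFacet_of_not_strictlyPreservedFace (v := v) hQ hcov hdP hmin
  refine ⟨?_, fun v _ => (strictlyPreservedFace_singleton_iff v).2, fun v hv hnot => ?_⟩
  · let B : ℝ → Set (Fin (d + 1) → ℝ) := fun s =>
      {v | {v} = ⋂₀ {H | IsFacetOf H Q ∧ ¬ IsSideFacet s H Q}}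
    have hB : ∀ s, (B s).Subsingleton := fun s v hv w hw => singleton_injective (hv.trans hw.symm)
    have hsub : {v | IsVertexOf v Q ∧ ¬ StrictlyPreservedFace Q {v}} ⊆ B 1 ∪ B (-1) := by
      rintro v ⟨hv, hnot⟩
      obtain ⟨s, hs, F₁, F₂, -, hv', -, -, hside⟩ := key v hv hnot
      have hvB : v ∈ B s := by
        simpa only [B, mem_ofPred_eq, hside, not_or] using hv'
      rcases hs with rfl | rfl
      · exact Or.inl hvB
      · exact Or.inr hvB
    calc _ ≤ (B 1 ∪ B (-1)).ncard :=
          ncard_le_ncard hsub ((hB 1).finite.union (hB (-1)).finite)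
      _ ≤ (B 1).ncard + (B (-1)).ncard := ncard_union_le _ _
      _ ≤ 2 := by
        have h₁ := (ncard_le_one (hB 1).finite).2 fun a ha b hb => hB 1 ha hb
        have h₂ := (ncard_le_one (hB (-1)).finite).2 fun a ha b hb => hB (-1) ha hb
        omega
  · obtain ⟨s, hs, F₁, F₂, hne, hv', hpyr₁, hpyr₂, hside⟩ := key v hv hnot
    have hF₁ := (hside F₁).2 (Or.inl rfl)
    have hF₂ := (hside F₂).2 (Or.inr rfl)
    refine ⟨F₁, F₂, hF₁.1, hF₂.1, hne, hv', hpyr₁, hpyr₂, ?_⟩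
    rcases hs with rfl | rfl
    · simp only [isSideFacet_one_iff] at hF₁ hF₂ hside
      exact Or.inl ⟨hF₁, hF₂, fun H => (hside H).1⟩
    · simp only [isSideFacet_neg_one_iff] at hF₁ hF₂ hside
      exact Or.inr ⟨hF₁, hF₂, fun H => (hside H).1⟩

end
end

section
/- Let P be a d-dimensional polytope with exactly d+4 vertices, at least d+4 facets, and extension complexity xc(P) = d+3. Then there exists a (d+1)-dimensional polytope Q ⊂ ℝ^{d+1}, combinatorially equivalent to the (d−2)-fold pyramid over the triangular prism Δ_1 × Δ_2, such that P = π_d(Q) and every vertex of Q is strictly preserved under π_d. -/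
open Set

noncomputable section

/-- The homogenization `(x, 1)` of a point `x`. -/
def hat {N : ℕ} (x : Fin N → ℝ) : (Fin N → ℝ) × ℝ := (x, 1)

/-- The affine function `x ↦ b - ⟨c, x⟩` as a linear functional on the homogenization. -/
def slackForm {N : ℕ} (c : Fin N → ℝ) (b : ℝ) : ((Fin N → ℝ) × ℝ) →ₗ[ℝ] ℝ :=
  b • LinearMap.snd ℝ _ _ - (∑ i, c i • LinearMap.proj i) ∘ₗ LinearMap.fst ℝ _ _

lemma slackForm_hat {N : ℕ} (c : Fin N → ℝ) (b : ℝ) (x : Fin N → ℝ) :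
    slackForm c b (hat x) = b - ∑ i, c i * x i := by
  simp [slackForm, hat]

lemma exists_slackForm_eq {N : ℕ} (f : ((Fin N → ℝ) × ℝ) →ₗ[ℝ] ℝ) :
    ∃ c b, f = slackForm c b := by
  refine ⟨fun i => - f (Pi.single i 1, 0), f (0, 1), ?_⟩
  apply LinearMap.prod_ext
  · apply LinearMap.pi_ext'
    intro i
    ext
    simp [slackForm, Pi.single_apply]
  · ext
    simp [slackForm]

lemma isFaceOf_iff {N : ℕ} {F P : Set (Fin N → ℝ)} :
    IsFaceOf F P ↔ ∃ f : ((Fin N → ℝ) × ℝ) →ₗ[ℝ] ℝ,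
      (∀ x ∈ P, 0 ≤ f (hat x)) ∧ F = {x ∈ P | f (hat x) = 0} := by
  constructor
  · rintro ⟨c, b, h, rfl⟩
    refine ⟨slackForm c b, fun x hx => ?_, ?_⟩
    · rw [slackForm_hat]; linarith [h x hx]
    · ext x
      simp only [slackForm_hat, mem_ofPred_eq]
      refine and_congr_right fun _ => ⟨fun h => ?_, fun h => ?_⟩ <;> linarith
  · rintro ⟨f, h, rfl⟩
    obtain ⟨c, b, rfl⟩ := exists_slackForm_eq f
    refine ⟨c, b, fun x hx => ?_, ?_⟩
    · have := h x hx
      rw [slackForm_hat] at this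
      linarith
    · ext x
      simp only [slackForm_hat, mem_ofPred_eq]
      refine and_congr_right fun _ => ⟨fun h => ?_, fun h => ?_⟩ <;> linarith

lemma hat_injective {N : ℕ} : Function.Injective (hat (N := N)) := fun _ _ h =>
  congrArg Prod.fst h

lemma mem_convexHull_range_iff {N : ℕ} {J : Type*} [Fintype J] (q : J → Fin N → ℝ)
    (x : Fin N → ℝ) :
    x ∈ convexHull ℝ (range q) ↔ ∃ w : J → ℝ, (∀ j, 0 ≤ w j) ∧ hat x = ∑ j, w j • hat (q j) := by
  classical
  have key : ∀ w : J → ℝ, hat x = ∑ j, w j • hat (q j) ↔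
      (∑ j, w j = 1 ∧ ∑ j, w j • q j = x) := by
    intro w
    rw [Prod.ext_iff]
    simp only [hat, Prod.fst_sum, Prod.snd_sum, Prod.smul_fst, Prod.smul_snd, smul_eq_mul, mul_one]
    constructor
    · rintro ⟨h1, h2⟩; exact ⟨h2.symm, h1.symm⟩
    · rintro ⟨h1, h2⟩; exact ⟨h2.symm, h1.symm⟩
  simp only [key]
  constructor
  · intro hx
    obtain ⟨ι, _, w, z, hw, h1, hz, rfl⟩ := mem_convexHull_iff_exists_fintype.1 hx
    choose g hg using hz
    refine ⟨fun j => ∑ i with g i = j, w i, fun j => Finset.sum_nonneg fun i _ => hw i, ?_, ?_⟩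
    · exact (Finset.sum_fiberwise _ _ _).trans h1
    · rw [← Finset.sum_fiberwise Finset.univ g]
      refine Finset.sum_congr rfl fun j _ => ?_
      rw [Finset.sum_smul]
      refine Finset.sum_congr rfl fun i hi => ?_
      rw [← (Finset.mem_filter.1 hi).2, hg]
  · rintro ⟨w, hw, h1, h2⟩
    exact mem_convexHull_of_exists_fintype w q hw h1 (fun i => mem_range_self i) h2

lemma isPolytope_convexHull_range {N : ℕ} {J : Type*} [Finite J] (q : J → Fin N → ℝ) :
    IsPolytope (convexHull ℝ (range q)) :=
  ⟨(finite_range q).toFinset, by simp⟩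

lemma IsPolytope.exists_range {N : ℕ} {P : Set (Fin N → ℝ)} (hP : IsPolytope P) :
    ∃ S : Finset (Fin N → ℝ), P = convexHull ℝ (range (Subtype.val : S → Fin N → ℝ)) := by
  obtain ⟨S, rfl⟩ := hP
  exact ⟨S, by simp⟩

lemma pdim_eq {N : ℕ} (P : Set (Fin N → ℝ)) :
    pdim P = (Module.finrank ℝ (Submodule.span ℝ (hat '' P)) : ℤ) - 1 := by
  unfold pdim
  split_ifs with h
  · obtain ⟨p, hp⟩ := h
    have e : Submodule.span ℝ (hat '' P) =
        ((affineSpan ℝ P).direction.map (LinearMap.inl ℝ (Fin N → ℝ) ℝ)) ⊔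
          Submodule.span ℝ {hat p} := by
      rw [direction_affineSpan, vectorSpan_eq_span_vsub_set_right ℝ hp, Submodule.map_span,
        ← Submodule.span_union]
      apply le_antisymm
      · rw [Submodule.span_le]
        rintro _ ⟨x, hx, rfl⟩
        have : hat x = LinearMap.inl ℝ (Fin N → ℝ) ℝ (x -ᵥ p) + hat p := by
          simp [hat]
        rw [this]
        refine Submodule.add_mem _ (Submodule.subset_span (Or.inl ?_))
          (Submodule.subset_span (Or.inr rfl))
        exact ⟨_, ⟨x, hx, rfl⟩, rfl⟩
      · rw [Submodule.span_le]
        rintro _ (⟨_, ⟨x, hx, rfl⟩, rfl⟩ | rfl)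
        · have : LinearMap.inl ℝ (Fin N → ℝ) ℝ (x -ᵥ p) = hat x - hat p := by
            simp [hat]
          simp only [this]
          exact Submodule.sub_mem _ (Submodule.subset_span ⟨x, hx, rfl⟩)
            (Submodule.subset_span ⟨p, hp, rfl⟩)
        · exact Submodule.subset_span ⟨p, hp, rfl⟩
    have hd : Disjoint ((affineSpan ℝ P).direction.map (LinearMap.inl ℝ (Fin N → ℝ) ℝ))
        (Submodule.span ℝ {hat p}) := by
      rw [Submodule.disjoint_def]
      rintro _ ⟨x, -, rfl⟩ h2
      obtain ⟨a, ha⟩ := Submodule.mem_span_singleton.1 h2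
      have := congrArg Prod.snd ha
      simp only [hat, Prod.smul_snd, smul_eq_mul, mul_one, LinearMap.inl_apply] at this
      rw [← ha, this, zero_smul]
    have h1 := Submodule.finrank_sup_add_finrank_inf_eq
      ((affineSpan ℝ P).direction.map (LinearMap.inl ℝ (Fin N → ℝ) ℝ)) (Submodule.span ℝ {hat p})
    rw [hd.eq_bot, finrank_bot, finrank_span_singleton (by simp [hat]), ← e,
      ← LinearEquiv.finrank_eq (Submodule.equivMapOfInjective _ LinearMap.inl_injective _)] at h1
    omega
  · rw [not_nonempty_iff_eq_empty] at h
    rw [h, image_empty, Submodule.span_empty, finrank_bot]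
    norm_num

lemma map_hat_nonneg_of_mem_convexHull {N : ℕ} {J : Type*} [Fintype J] {q : J → Fin N → ℝ}
    {f : ((Fin N → ℝ) × ℝ) →ₗ[ℝ] ℝ} (hf : ∀ j, 0 ≤ f (hat (q j))) {x : Fin N → ℝ}
    (hx : x ∈ convexHull ℝ (range q)) : 0 ≤ f (hat x) := by
  obtain ⟨w, hw, e⟩ := (mem_convexHull_range_iff q x).1 hx
  rw [e, map_sum]
  refine Finset.sum_nonneg fun j _ => ?_
  rw [map_smul]
  exact mul_nonneg (hw j) (hf j)

lemma zeroSet_eq_convexHull {N : ℕ} {J : Type*} [Fintype J] {q : J → Fin N → ℝ}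
    {f : ((Fin N → ℝ) × ℝ) →ₗ[ℝ] ℝ} (hf : ∀ j, 0 ≤ f (hat (q j))) :
    {x ∈ convexHull ℝ (range q) | f (hat x) = 0} =
      convexHull ℝ (q '' {j | f (hat (q j)) = 0}) := by
  classical
  have er : q '' {j | f (hat (q j)) = 0} =
      range (fun j : {j // f (hat (q j)) = 0} => q j) := by
    ext x; simp
  apply Subset.antisymm
  · rintro x ⟨hx, h0⟩
    obtain ⟨w, hw, e⟩ := (mem_convexHull_range_iff q x).1 hx
    rw [e, map_sum] at h0
    have h1 := (Finset.sum_eq_zero_iff_of_nonneg (fun j _ => by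
      rw [map_smul]; exact mul_nonneg (hw j) (hf j))).1 h0
    rw [er, mem_convexHull_range_iff]
    refine ⟨fun j => w j, fun j => hw j, ?_⟩
    have e3 : ∑ j, w j • hat (q j) = ∑ j with f (hat (q j)) = 0, w j • hat (q j) := by
      refine (Finset.sum_filter_of_ne fun j _ hj => ?_).symm
      have := h1 j (Finset.mem_univ j)
      rw [map_smul, smul_eq_mul, mul_eq_zero] at this
      exact this.resolve_left fun h => hj (by rw [h, zero_smul])
    rw [e, e3]
    exact Finset.sum_subtype _ (by simp) _
  · intro x hx
    refine ⟨convexHull_mono (image_subset_range _ _) hx, ?_⟩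
    rw [er] at hx
    obtain ⟨w, hw, e⟩ := (mem_convexHull_range_iff _ x).1 hx
    rw [e, map_sum]
    refine Finset.sum_eq_zero fun j _ => ?_
    rw [map_smul, j.2, smul_zero]

lemma IsFaceOf.subset {N : ℕ} {F P : Set (Fin N → ℝ)} (h : IsFaceOf F P) : F ⊆ P := by
  obtain ⟨c, b, -, rfl⟩ := h
  exact fun x hx => hx.1

lemma IsFaceOf.eq_convexHull {N : ℕ} {J : Type*} [Fintype J] {q : J → Fin N → ℝ}
    {F : Set (Fin N → ℝ)} (h : IsFaceOf F (convexHull ℝ (range q))) :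
    F = convexHull ℝ (q '' {j | q j ∈ F}) := by
  obtain ⟨f, hf, rfl⟩ := isFaceOf_iff.1 h
  have hq : ∀ j, q j ∈ convexHull ℝ (range q) := fun j => subset_convexHull _ _ (mem_range_self j)
  have := zeroSet_eq_convexHull (fun j => hf _ (hq j))
  rw [this]
  congr 2
  ext j
  rw [← this]
  simp [hq]

lemma IsVertexOf.exists_eq {N : ℕ} {J : Type*} [Fintype J] {q : J → Fin N → ℝ}
    {v : Fin N → ℝ} (h : IsVertexOf v (convexHull ℝ (range q))) : ∃ j, q j = v := by
  by_contra! hne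
  have := IsFaceOf.eq_convexHull h
  have e : {j | q j ∈ ({v} : Set (Fin N → ℝ))} = ∅ := by
    ext j; simp [hne]
  rw [e] at this
  simp at this

/-- The family of index sets of faces of `conv q`. -/
def faceSupports {N : ℕ} {J : Type*} (q : J → Fin N → ℝ) : Set (Set J) :=
  {I | ∃ f : ((Fin N → ℝ) × ℝ) →ₗ[ℝ] ℝ, (∀ j, 0 ≤ f (hat (q j))) ∧ I = {j | f (hat (q j)) = 0}}

lemma IsFaceOf.support_mem {N : ℕ} {J : Type*} {q : J → Fin N → ℝ}
    {F : Set (Fin N → ℝ)} (h : IsFaceOf F (convexHull ℝ (range q))) :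
    {j | q j ∈ F} ∈ faceSupports q := by
  obtain ⟨f, hf, rfl⟩ := isFaceOf_iff.1 h
  have hq : ∀ j, q j ∈ convexHull ℝ (range q) := fun j => subset_convexHull _ _ (mem_range_self j)
  refine ⟨f, fun j => hf _ (hq j), ?_⟩
  ext j
  simp [hq]

lemma isFaceOf_convexHull_image {N : ℕ} {J : Type*} [Fintype J] {q : J → Fin N → ℝ}
    {I : Set J} (hI : I ∈ faceSupports q) :
    IsFaceOf (convexHull ℝ (q '' I)) (convexHull ℝ (range q)) ∧
      {j | q j ∈ convexHull ℝ (q '' I)} = I := by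
  obtain ⟨f, hf, rfl⟩ := hI
  have hq : ∀ j, q j ∈ convexHull ℝ (range q) := fun j => subset_convexHull _ _ (mem_range_self j)
  rw [← zeroSet_eq_convexHull hf]
  refine ⟨isFaceOf_iff.2 ⟨f, fun x hx => map_hat_nonneg_of_mem_convexHull hf hx, rfl⟩, ?_⟩
  ext j
  simp [hq]

/-- Faces of a polytope correspond to the index sets of their generators. -/
def faceEquiv {N : ℕ} {J : Type*} [Fintype J] (q : J → Fin N → ℝ) :
    {F : Set (Fin N → ℝ) // IsFaceOf F (convexHull ℝ (range q))} ≃ faceSupports q where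
  toFun F := ⟨{j | q j ∈ F.1}, F.2.support_mem⟩
  invFun I := ⟨convexHull ℝ (q '' I.1), (isFaceOf_convexHull_image I.2).1⟩
  left_inv F := Subtype.ext F.2.eq_convexHull.symm
  right_inv I := Subtype.ext (isFaceOf_convexHull_image I.2).2

lemma faceEquiv_subset_iff {N : ℕ} {J : Type*} [Fintype J] (q : J → Fin N → ℝ)
    (F G : {F : Set (Fin N → ℝ) // IsFaceOf F (convexHull ℝ (range q))}) :
    F.1 ⊆ G.1 ↔ (faceEquiv q F).1 ⊆ (faceEquiv q G).1 := by
  constructor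
  · intro h j hj
    exact h hj
  · intro h
    rw [F.2.eq_convexHull, G.2.eq_convexHull]
    exact convexHull_mono (image_mono h)

lemma faceSupports_subset {M N : ℕ} {J : Type*} {p : J → Fin M → ℝ} {q : J → Fin N → ℝ}
    {s : J → ℝ} (hs : ∀ j, 0 < s j)
    (h : ∀ f : ((Fin M → ℝ) × ℝ) →ₗ[ℝ] ℝ, ∃ g : ((Fin N → ℝ) × ℝ) →ₗ[ℝ] ℝ,
      ∀ j, s j * f (hat (p j)) = g (hat (q j))) :
    faceSupports p ⊆ faceSupports q := by
  rintro _ ⟨f, hf, rfl⟩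
  obtain ⟨g, hg⟩ := h f
  refine ⟨g, fun j => by rw [← hg]; exact mul_nonneg (hs j).le (hf j), ?_⟩
  ext j
  simp [← hg, (hs j).ne']

lemma combEquiv_of_proportional_slacks {M N : ℕ} {J : Type*} [Fintype J] {p : J → Fin M → ℝ}
    {q : J → Fin N → ℝ} {s : J → ℝ} (hs : ∀ j, 0 < s j)
    (h₁ : ∀ f : ((Fin M → ℝ) × ℝ) →ₗ[ℝ] ℝ, ∃ g : ((Fin N → ℝ) × ℝ) →ₗ[ℝ] ℝ,
      ∀ j, s j * f (hat (p j)) = g (hat (q j)))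
    (h₂ : ∀ g : ((Fin N → ℝ) × ℝ) →ₗ[ℝ] ℝ, ∃ f : ((Fin M → ℝ) × ℝ) →ₗ[ℝ] ℝ,
      ∀ j, s j * f (hat (p j)) = g (hat (q j))) :
    CombEquiv (convexHull ℝ (range p)) (convexHull ℝ (range q)) := by
  have e : faceSupports p = faceSupports q := by
    refine Subset.antisymm (faceSupports_subset hs h₁)
      (faceSupports_subset (s := fun j => (s j)⁻¹) (fun j => inv_pos.2 (hs j)) fun g => ?_)
    obtain ⟨f, hf⟩ := h₂ g
    refine ⟨f, fun j => ?_⟩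
    rw [← hf, inv_mul_cancel_left₀ (hs j).ne']
  refine ⟨(faceEquiv p).trans ((Equiv.setCongr e).trans (faceEquiv q).symm), fun F G => ?_⟩
  rw [faceEquiv_subset_iff p, faceEquiv_subset_iff q]
  simp

lemma isVertexOf_of_notMem_convexHull {N : ℕ} (S : Finset (Fin N → ℝ)) {s : Fin N → ℝ}
    (hs : s ∈ S) (h : s ∉ convexHull ℝ (S \ {s} : Set (Fin N → ℝ))) :
    IsVertexOf s (convexHull ℝ (S : Set (Fin N → ℝ))) := by
  have hfin : ((S : Set (Fin N → ℝ)) \ {s}).Finite := S.finite_toSet.sdiff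
  obtain ⟨f, u, h1, h2⟩ := geometric_hahn_banach_closed_point (convex_convexHull ℝ _)
    (hfin.isClosed_convexHull ℝ) h
  let g : ((Fin N → ℝ) × ℝ) →ₗ[ℝ] ℝ :=
    f s • LinearMap.snd ℝ _ _ - f.toLinearMap ∘ₗ LinearMap.fst ℝ _ _
  have hg : ∀ x, g (hat x) = f s - f x := fun x => by simp [g, hat]
  have hpos : ∀ x : S, x.1 ≠ s → 0 < g (hat x.1) := fun x hx => by
    rw [hg, sub_pos]
    exact (h1 _ (subset_convexHull _ _ ⟨x.2, hx⟩)).trans h2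
  have hnn : ∀ x : S, 0 ≤ g (hat x.1) := fun x => by
    by_cases hx : x.1 = s
    · rw [hx, hg, sub_self]
    · exact (hpos x hx).le
  have e : (S : Set (Fin N → ℝ)) = range (Subtype.val : S → Fin N → ℝ) := by simp
  rw [IsVertexOf, isFaceOf_iff, e]
  refine ⟨g, fun x hx => map_hat_nonneg_of_mem_convexHull hnn hx, ?_⟩
  rw [zeroSet_eq_convexHull hnn]
  have e2 : (Subtype.val : S → Fin N → ℝ) '' {j | g (hat j.1) = 0} = {s} := by
    ext x
    constructor
    · rintro ⟨y, hy, rfl⟩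
      by_contra hne
      exact (hpos y hne).ne' hy
    · rintro rfl
      exact ⟨⟨x, hs⟩, by simp [hg], rfl⟩
  rw [e2, convexHull_singleton]

lemma IsPolytope.exists_vertexSet_eq {N : ℕ} {P : Set (Fin N → ℝ)} (hP : IsPolytope P) :
    (vertexSet P).Finite ∧ P = convexHull ℝ (vertexSet P) := by
  classical
  have hex : ∃ n, ∃ S : Finset (Fin N → ℝ), S.card = n ∧ P = convexHull ℝ (S : Set (Fin N → ℝ)) := by
    obtain ⟨S, hS⟩ := hP
    exact ⟨_, S, rfl, hS⟩
  obtain ⟨S, hc, hS⟩ := Nat.find_spec hex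
  have hV : (S : Set (Fin N → ℝ)) = vertexSet P := by
    apply Subset.antisymm
    · intro s hs
      rw [vertexSet, mem_ofPred_eq, hS]
      refine isVertexOf_of_notMem_convexHull S hs fun hmem => ?_
      have hlt : (S.erase s).card < Nat.find hex := hc ▸ Finset.card_erase_lt_of_mem hs
      refine Nat.find_min hex hlt ⟨_, rfl, ?_⟩
      rw [hS, Finset.coe_erase]
      refine Subset.antisymm (convexHull_min ?_ (convex_convexHull ℝ _))
        (convexHull_mono sdiff_subset)
      intro x hx
      by_cases hxs : x = s
      · rw [hxs]; exact hmem
      · exact subset_convexHull _ _ ⟨hx, hxs⟩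
    · intro v hv
      have e : P = convexHull ℝ (range (Subtype.val : S → Fin N → ℝ)) := by simpa using hS
      rw [vertexSet, mem_ofPred_eq, e] at hv
      obtain ⟨j, rfl⟩ := hv.exists_eq
      exact j.2
  exact ⟨hV ▸ S.finite_toSet, hV ▸ hS⟩

lemma exists_corank_one_separating {V J : Type*} [AddCommGroup V] [Module ℝ V]
    [FiniteDimensional ℝ V] [Fintype J] (u : J → V) {x : V}
    (hx : x ∈ Submodule.span ℝ (range u)) (f : V →ₗ[ℝ] ℝ) (hf : ∀ j, 0 ≤ f (u j))
    (hfx : f x < 0) :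
    ∃ g : V →ₗ[ℝ] ℝ, (∀ j, 0 ≤ g (u j)) ∧ g x < 0 ∧
      Module.finrank ℝ (Submodule.span ℝ (u '' {j | g (u j) = 0})) + 1 =
        Module.finrank ℝ (Submodule.span ℝ (range u)) := by
  classical
  obtain ⟨n, hn⟩ : ∃ n, Module.finrank ℝ (Submodule.span ℝ (range u)) -
    Module.finrank ℝ (Submodule.span ℝ (u '' {j | f (u j) = 0})) = n := ⟨_, rfl⟩
  induction n using Nat.strong_induction_on generalizing f with
  | _ n ih =>
  set T := Submodule.span ℝ (u '' {j | f (u j) = 0}) with hT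
  have hTker : T ≤ LinearMap.ker f := by
    rw [hT, Submodule.span_le]
    rintro _ ⟨j, hj, rfl⟩
    exact hj
  have hxT : x ∉ T := fun h => hfx.ne (hTker h)
  have hTW : T ≤ Submodule.span ℝ (range u) := Submodule.span_mono (image_subset_range _ _)
  have hlt : Module.finrank ℝ T < Module.finrank ℝ (Submodule.span ℝ (range u)) :=
    Submodule.finrank_lt_finrank_of_lt (lt_of_le_of_ne hTW fun h => hxT (h ▸ hx))
  by_cases hc : Module.finrank ℝ T + 1 = Module.finrank ℝ (Submodule.span ℝ (range u))
  · exact ⟨f, hf, hfx, hc⟩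
  set T' := T ⊔ Submodule.span ℝ {x} with hT'
  have hT'fin : Module.finrank ℝ T' < Module.finrank ℝ (Submodule.span ℝ (range u)) := by
    have h1 := Submodule.finrank_add_le_finrank_add_finrank T (Submodule.span ℝ {x})
    rw [← hT'] at h1
    have h2 : Module.finrank ℝ (Submodule.span ℝ {x}) ≤ 1 := by
      simpa using finrank_span_le_card (R := ℝ) ({x} : Set V)
    omega
  obtain ⟨j₀, hj₀⟩ : ∃ j, u j ∉ T' := by
    by_contra! h
    have : Submodule.span ℝ (range u) ≤ T' := by
      rw [Submodule.span_le]
      rintro _ ⟨j, rfl⟩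
      exact h j
    exact absurd (Submodule.finrank_mono this) (by omega)
  obtain ⟨g, hg0, hgT⟩ : ∃ g : V →ₗ[ℝ] ℝ, 0 < g (u j₀) ∧ T' ≤ LinearMap.ker g := by
    obtain ⟨g, hg, hgT⟩ := Submodule.exists_le_ker_of_notMem hj₀
    rcases lt_or_gt_of_ne hg with h | h
    · refine ⟨-g, by simpa using h, fun y hy => ?_⟩
      have : g y = 0 := hgT hy
      simp [this]
    · exact ⟨g, h, hgT⟩
  have hgx : g x = 0 := hgT (Submodule.mem_sup_right (Submodule.mem_span_singleton_self x))
  obtain ⟨j₁, hj₁, hmin⟩ := Finset.exists_min_image (Finset.univ.filter fun j => 0 < g (u j))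
    (fun j => f (u j) / g (u j)) ⟨j₀, by simpa using hg0⟩
  simp only [Finset.mem_filter, Finset.mem_univ, true_and] at hj₁ hmin
  set c := f (u j₁) / g (u j₁) with hc'
  have hc0 : 0 ≤ c := div_nonneg (hf j₁) hj₁.le
  have hf' : ∀ j, 0 ≤ (f - c • g) (u j) := by
    intro j
    simp only [LinearMap.sub_apply, LinearMap.smul_apply, smul_eq_mul, sub_nonneg]
    by_cases h : 0 < g (u j)
    · exact (le_div_iff₀ h).1 (hmin j h)
    · exact (mul_nonpos_of_nonneg_of_nonpos hc0 (not_lt.1 h)).trans (hf j)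
  have hx' : (f - c • g) x < 0 := by
    simp [hgx, hfx]
  have hj₁T : u j₁ ∉ T := fun h => hj₁.ne' (hgT (Submodule.mem_sup_left h))
  have hTT : T < Submodule.span ℝ (u '' {j | (f - c • g) (u j) = 0}) := by
    refine lt_of_le_of_ne (Submodule.span_mono ?_) fun h => hj₁T ?_
    · rintro _ ⟨j, hj, rfl⟩
      refine ⟨j, ?_, rfl⟩
      have h1 : f (u j) = 0 := hj
      have h2 : g (u j) = 0 :=
        hgT (Submodule.mem_sup_left (Submodule.subset_span ⟨j, hj, rfl⟩))
      simp [h1, h2]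
    · rw [h]
      refine Submodule.subset_span ⟨j₁, ?_, rfl⟩
      simp [hc', hj₁.ne']
  have hrank := Submodule.finrank_lt_finrank_of_lt hTT
  exact ih _ (by omega) (f - c • g) hf' hx' rfl

/-- The cone over the homogenization of a set. -/
def homCone {N : ℕ} (P : Set (Fin N → ℝ)) : Set ((Fin N → ℝ) × ℝ) :=
  {x | ∃ a : ℝ, 0 ≤ a ∧ ∃ y ∈ P, x = a • hat y}

lemma span_hat_convexHull {N : ℕ} {J : Type*} [Fintype J] (q : J → Fin N → ℝ) (I : Set J) :
    Submodule.span ℝ (hat '' convexHull ℝ (q '' I)) =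
      Submodule.span ℝ ((fun j => hat (q j)) '' I) := by
  classical
  apply le_antisymm
  · rw [Submodule.span_le]
    rintro _ ⟨x, hx, rfl⟩
    rw [image_eq_range] at hx
    obtain ⟨w, -, e⟩ := (mem_convexHull_range_iff _ x).1 hx
    rw [e]
    exact Submodule.sum_mem _ fun j _ =>
      Submodule.smul_mem _ _ (Submodule.subset_span ⟨j, j.2, rfl⟩)
  · apply Submodule.span_mono
    rintro _ ⟨j, hj, rfl⟩
    exact ⟨q j, subset_convexHull _ _ ⟨j, hj, rfl⟩, rfl⟩

lemma exists_separating_form {N : ℕ} {P : Set (Fin N → ℝ)} (hP : IsPolytope P)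
    (hne : P.Nonempty) {x : (Fin N → ℝ) × ℝ} (hx : x ∉ homCone P) :
    ∃ f : ((Fin N → ℝ) × ℝ) →ₗ[ℝ] ℝ, (∀ y ∈ P, 0 ≤ f (hat y)) ∧ f x < 0 := by
  obtain ⟨S, rfl⟩ := hP
  have hconv := convex_convexHull ℝ (S : Set (Fin N → ℝ))
  have hcomp : IsCompact (convexHull ℝ (S : Set (Fin N → ℝ))) :=
    S.finite_toSet.isCompact_convexHull ℝ
  rcases lt_trichotomy x.2 0 with h | h | h
  · exact ⟨LinearMap.snd ℝ _ _, fun y _ => by simp [hat], h⟩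
  · have hx1 : x.1 ≠ 0 := by
      intro h1
      obtain ⟨y, hy⟩ := hne
      exact hx ⟨0, le_rfl, y, hy, by rw [zero_smul]; exact Prod.ext h1 h⟩
    obtain ⟨i, hi⟩ := Function.ne_iff.1 hx1
    have hcont : ContinuousOn (fun y : Fin N → ℝ => x.1 i * y i)
        (convexHull ℝ (S : Set (Fin N → ℝ))) := by fun_prop
    obtain ⟨M, hM⟩ := (hcomp.image_of_continuousOn hcont).bddAbove
    refine ⟨M • LinearMap.snd ℝ _ _ - x.1 i • (LinearMap.proj i ∘ₗ LinearMap.fst ℝ _ _),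
      fun y hy => ?_, ?_⟩
    · have := hM (mem_image_of_mem _ hy)
      simpa [hat] using this
    · have : 0 < x.1 i * x.1 i := mul_self_pos.2 hi
      simpa [h] using this
  · have hnot : x.2⁻¹ • x.1 ∉ convexHull ℝ (S : Set (Fin N → ℝ)) := by
      intro hmem
      refine hx ⟨x.2, h.le, _, hmem, Prod.ext ?_ ?_⟩
      · simp [hat, smul_smul, h.ne']
      · simp [hat]
    obtain ⟨f, u, h1, h2⟩ := geometric_hahn_banach_closed_point hconv hcomp.isClosed hnot
    refine ⟨u • LinearMap.snd ℝ _ _ - f.toLinearMap ∘ₗ LinearMap.fst ℝ _ _, fun y hy => ?_, ?_⟩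
    · have := h1 y hy
      simp [hat, this.le]
    · rw [map_smul, smul_eq_mul, ← div_eq_inv_mul, lt_div_iff₀ h] at h2
      simpa using h2

lemma exists_facet_separating {N : ℕ} {P : Set (Fin N → ℝ)} (hP : IsPolytope P)
    (hne : P.Nonempty) {x : (Fin N → ℝ) × ℝ} (hspan : x ∈ Submodule.span ℝ (hat '' P))
    (hx : x ∉ homCone P) :
    ∃ F, IsFacetOf F P ∧ ∀ f : ((Fin N → ℝ) × ℝ) →ₗ[ℝ] ℝ, (∀ y ∈ P, 0 ≤ f (hat y)) →
      F = {y ∈ P | f (hat y) = 0} → f x < 0 := by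
  obtain ⟨f₀, hf₀, hf₀x⟩ := exists_separating_form hP hne hx
  obtain ⟨S, hS⟩ := hP.exists_range
  set q : S → Fin N → ℝ := Subtype.val
  have hspanP : Submodule.span ℝ (hat '' P) = Submodule.span ℝ (range fun j => hat (q j)) := by
    rw [hS, ← image_univ (f := q), span_hat_convexHull, image_univ]
  have hq : ∀ j, q j ∈ P := fun j => hS ▸ subset_convexHull _ _ (mem_range_self j)
  obtain ⟨g, hg, hgx, hrank⟩ := exists_corank_one_separating (fun j => hat (q j))
    (hspanP ▸ hspan) f₀ (fun j => hf₀ _ (hq j)) hf₀x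
  have hgP : ∀ y ∈ P, 0 ≤ g (hat y) := fun y hy =>
    map_hat_nonneg_of_mem_convexHull hg (hS ▸ hy)
  have hF : {y ∈ P | g (hat y) = 0} = convexHull ℝ (q '' {j | g (hat (q j)) = 0}) := by
    rw [hS]; exact zeroSet_eq_convexHull hg
  have hFspan : Submodule.span ℝ (hat '' {y ∈ P | g (hat y) = 0}) =
      Submodule.span ℝ ((fun j => hat (q j)) '' {j | g (hat (q j)) = 0}) := by
    rw [hF, span_hat_convexHull]
  refine ⟨{y ∈ P | g (hat y) = 0}, ⟨isFaceOf_iff.2 ⟨g, hgP, rfl⟩, ?_⟩, fun f hf hFf => ?_⟩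
  · rw [pdim_eq, pdim_eq, hFspan, hspanP, ← hrank]
    push_cast
    ring
  · set T := Submodule.span ℝ (hat '' {y ∈ P | g (hat y) = 0}) with hT
    have hTg : T ≤ LinearMap.ker g := by
      rw [hT, Submodule.span_le]
      rintro _ ⟨y, hy, rfl⟩
      exact hy.2
    have hTf : T ≤ LinearMap.ker f := by
      rw [hT, Submodule.span_le]
      rintro _ ⟨y, hy, rfl⟩
      rw [hFf] at hy
      exact hy.2
    have hxT : x ∉ T := fun h => hgx.ne (hTg h)
    have hsup : T ⊔ Submodule.span ℝ {x} = Submodule.span ℝ (hat '' P) := by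
      refine Submodule.eq_of_le_of_finrank_le (sup_le (Submodule.span_mono
        (image_mono (sep_subset _ _))) ?_) ?_
      · rw [Submodule.span_singleton_le_iff_mem]; exact hspan
      · have : T < T ⊔ Submodule.span ℝ {x} := by
          refine lt_of_le_of_ne le_sup_left fun h => hxT ?_
          rw [h]
          exact Submodule.mem_sup_right (Submodule.mem_span_singleton_self x)
        have := Submodule.finrank_lt_finrank_of_lt this
        rw [hspanP, ← hrank, ← hFspan]
        omega
    obtain ⟨s, hs, hsg⟩ : ∃ s ∈ P, 0 < g (hat s) := by
      by_contra! h
      have : Submodule.span ℝ (hat '' P) ≤ LinearMap.ker g := by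
        rw [Submodule.span_le]
        rintro _ ⟨y, hy, rfl⟩
        exact le_antisymm (h y hy) (hgP y hy)
      exact hgx.ne (this hspan)
    have hs' : hat s ∈ T ⊔ Submodule.span ℝ {x} := hsup ▸ Submodule.subset_span ⟨s, hs, rfl⟩
    obtain ⟨y, hy, z, hz, hyz⟩ := Submodule.mem_sup.1 hs'
    obtain ⟨a, rfl⟩ := Submodule.mem_span_singleton.1 hz
    have e1 : g (hat s) = a * g x := by
      rw [← hyz, map_add, show g y = 0 from hTg hy, zero_add, map_smul, smul_eq_mul]
    have e2 : f (hat s) = a * f x := by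
      rw [← hyz, map_add, show f y = 0 from hTf hy, zero_add, map_smul, smul_eq_mul]
    have ha : a < 0 := by
      by_contra! h
      nlinarith
    by_contra! hfx
    have hs0 : f (hat s) = 0 := le_antisymm (by nlinarith) (hf s hs)
    have : s ∈ {y ∈ P | g (hat y) = 0} := by rw [hFf]; exact ⟨hs, hs0⟩
    exact hsg.ne' this.2

/-- The linear map between homogenizations induced by an affine map. -/
def homMap {M N : ℕ} (π : (Fin M → ℝ) →ᵃ[ℝ] (Fin N → ℝ)) :
    ((Fin M → ℝ) × ℝ) →ₗ[ℝ] ((Fin N → ℝ) × ℝ) :=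
  ((π.linear ∘ₗ LinearMap.fst ℝ _ _) + (LinearMap.snd ℝ _ _).smulRight (π 0)).prod
    (LinearMap.snd ℝ _ _)

lemma homMap_hat {M N : ℕ} (π : (Fin M → ℝ) →ᵃ[ℝ] (Fin N → ℝ)) (x : Fin M → ℝ) :
    homMap π (hat x) = hat (π x) := by
  have : π x = π.linear x + π 0 := by
    simpa using π.map_vadd 0 x
  simp [homMap, hat, this]

lemma facetCount_image_le {M N : ℕ} {Q : Set (Fin M → ℝ)}
    (π : (Fin M → ℝ) →ᵃ[ℝ] (Fin N → ℝ)) (hfin : {F | IsFacetOf F Q}.Finite)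
    (hinj : ∀ x ∈ Submodule.span ℝ (hat '' Q), homMap π x = 0 → x = 0) :
    facetCount (π '' Q) ≤ facetCount Q := by
  have hrank : ∀ F ⊆ Q, pdim (π '' F) = pdim F := by
    intro F hF
    have e : hat '' (π '' F) = homMap π '' (hat '' F) := by
      simp only [image_image, homMap_hat]
    rw [pdim_eq, pdim_eq, e, ← Submodule.map_span]
    have hle : Submodule.span ℝ (hat '' F) ≤ Submodule.span ℝ (hat '' Q) :=
      Submodule.span_mono (image_mono hF)
    have hi : Function.Injective ((homMap π).domRestrict (Submodule.span ℝ (hat '' F))) := by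
      rw [← LinearMap.ker_eq_bot, LinearMap.ker_eq_bot']
      intro x hx
      exact Subtype.ext (hinj x (hle x.2) hx)
    rw [← LinearMap.range_domRestrict, LinearMap.finrank_range_of_inj hi]
  unfold facetCount
  refine ncard_le_ncard_of_injOn (fun F => Q ∩ π ⁻¹' F) ?_ ?_ hfin
  · rintro F ⟨hF, hd⟩
    have himg : π '' (Q ∩ π ⁻¹' F) = F := by
      rw [image_inter_preimage, inter_eq_right]
      exact hF.subset
    refine ⟨?_, ?_⟩
    · obtain ⟨f, hf, rfl⟩ := isFaceOf_iff.1 hF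
      refine isFaceOf_iff.2 ⟨f ∘ₗ homMap π, fun x hx => ?_, ?_⟩
      · rw [LinearMap.comp_apply, homMap_hat]
        exact hf _ (mem_image_of_mem _ hx)
      · ext x
        simp only [mem_inter_iff, mem_preimage, mem_ofPred_eq, LinearMap.comp_apply, homMap_hat]
        constructor
        · rintro ⟨h1, -, h2⟩; exact ⟨h1, h2⟩
        · rintro ⟨h1, h2⟩; exact ⟨h1, mem_image_of_mem _ h1, h2⟩
    · rw [← hrank _ inter_subset_left, himg, hd, hrank Q subset_rfl]
  · intro F hF G hG h
    have := congrArg (image π) h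
    simpa only [image_inter_preimage, inter_eq_right.2 hF.1.subset,
      inter_eq_right.2 hG.1.subset] using this

/-- A polytope with an extension `Q` with `m > 0` facets is, after homogenization, a linear image
of a linear section of the nonnegative orthant in `ℝ^m`. -/
lemma exists_orthant_section {M N m : ℕ} {Q : Set (Fin M → ℝ)} (hQ : IsPolytope Q)
    (hne : Q.Nonempty) (hm : facetCount Q = m) (hpos : 0 < m)
    (π : (Fin M → ℝ) →ᵃ[ℝ] (Fin N → ℝ)) :
    ∃ (L : Submodule ℝ (Fin m → ℝ)) (Φ : (Fin m → ℝ) →ₗ[ℝ] ((Fin N → ℝ) × ℝ)),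
      (∀ x ∈ L, (∀ i, 0 ≤ x i) → Φ x ∈ homCone (π '' Q)) ∧
      (∀ y ∈ π '' Q, ∃ x ∈ L, (∀ i, 0 ≤ x i) ∧ Φ x = hat y) ∧
      ((∀ x ∈ L, Φ x = 0 → x = 0) → facetCount (π '' Q) ≤ m) := by
  have hfin : {F | IsFacetOf F Q}.Finite := finite_of_ncard_pos (by
    rw [facetCount] at hm; omega)
  have : Finite {F | IsFacetOf F Q} := hfin
  have e : {F | IsFacetOf F Q} ≃ Fin m :=
    Finite.equivFinOfCardEq (by rw [Nat.card_coe_set_eq]; exact hm)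
  have hface := fun F : {F | IsFacetOf F Q} => isFaceOf_iff.1 F.2.1
  choose φ hφ hφF using hface
  let σ : ((Fin M → ℝ) × ℝ) →ₗ[ℝ] (Fin m → ℝ) := LinearMap.pi fun i => φ (e.symm i)
  set W := Submodule.span ℝ (hat '' Q) with hW
  have hcone : ∀ x ∈ W, (∀ i, 0 ≤ σ x i) → x ∈ homCone Q := by
    intro x hx hσ
    by_contra hxc
    obtain ⟨F, hF, hsep⟩ := exists_facet_separating hQ hne hx hxc
    have h1 := hsep (φ ⟨F, hF⟩) (hφ ⟨F, hF⟩) (hφF ⟨F, hF⟩)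
    have h2 := hσ (e ⟨F, hF⟩)
    simp only [σ, LinearMap.pi_apply, Equiv.symm_apply_apply] at h2
    linarith
  have hσinj : ∀ x ∈ W, σ x = 0 → x = 0 := by
    intro x hx h0
    obtain ⟨a, ha, y, -, rfl⟩ := hcone x hx (by simp [h0])
    obtain ⟨b, hb, z, -, hz⟩ := hcone (-(a • hat y)) (W.neg_mem hx) (by simp [h0])
    have := congrArg Prod.snd hz
    simp only [hat, Prod.snd_neg, Prod.smul_snd, smul_eq_mul, mul_one] at this
    have ha0 : a = 0 := by linarith
    rw [ha0, zero_smul]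
  obtain ⟨ρ, hρ⟩ := (σ.domRestrict W).exists_leftInverse_of_injective (by
    rw [LinearMap.ker_eq_bot']
    intro x hx
    exact Subtype.ext (hσinj x x.2 hx))
  have hρ' : ∀ x (hx : x ∈ W), (ρ (σ x) : (Fin M → ℝ) × ℝ) = x := fun x hx =>
    congrArg Subtype.val (LinearMap.congr_fun hρ ⟨x, hx⟩)
  have hΦ : ∀ x ∈ W, (homMap π ∘ₗ W.subtype ∘ₗ ρ) (σ x) = homMap π x := by
    intro x hx
    simp only [LinearMap.comp_apply, Submodule.subtype_apply, hρ' x hx]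
  refine ⟨W.map σ, homMap π ∘ₗ W.subtype ∘ₗ ρ, ?_, ?_, ?_⟩
  · rintro _ ⟨x, hx, rfl⟩ h0
    rw [hΦ x hx]
    obtain ⟨a, ha, y, hy, rfl⟩ := hcone x hx h0
    exact ⟨a, ha, π y, mem_image_of_mem _ hy, by rw [map_smul, homMap_hat]⟩
  · rintro _ ⟨y, hy, rfl⟩
    have hyW : hat y ∈ W := Submodule.subset_span ⟨y, hy, rfl⟩
    exact ⟨σ (hat y), ⟨_, hyW, rfl⟩, fun i => hφ _ y hy, by rw [hΦ _ hyW, homMap_hat]⟩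
  · intro hinj
    rw [← hm]
    refine facetCount_image_le π hfin fun x hx h0 => hσinj x hx ?_
    exact hinj _ ⟨x, hx, rfl⟩ (by rw [hΦ x hx, h0])

/-- Indices of the extremal rays of the cone `{x ≥ 0 | t ⬝ x = 0}`. -/
abbrev CircuitIndex {m : ℕ} (t : Fin m → ℝ) : Type :=
  {k // t k = 0} ⊕ ({i // t i < 0} × {j // 0 < t j})

/-- Generators of the extremal rays of the cone `{x ≥ 0 | t ⬝ x = 0}`. -/
def circuit {m : ℕ} (t : Fin m → ℝ) : CircuitIndex t → Fin m → ℝ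
  | Sum.inl k => Pi.single k.1 1
  | Sum.inr ij => t ij.2.1 • Pi.single ij.1.1 1 - t ij.1.1 • Pi.single ij.2.1 1

lemma circuit_inl_apply {m : ℕ} (t : Fin m → ℝ) (k : {k // t k = 0}) (l : Fin m) :
    circuit t (Sum.inl k) l = if l = k.1 then 1 else 0 := by
  simp [circuit, Pi.single_apply]

lemma circuit_inr_apply {m : ℕ} (t : Fin m → ℝ) (i : {i // t i < 0}) (j : {j // 0 < t j})
    (l : Fin m) :
    circuit t (Sum.inr (i, j)) l = (if l = i.1 then t j else 0) - (if l = j.1 then t i else 0) := by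
  simp [circuit, Pi.single_apply]

lemma circuit_nonneg {m : ℕ} (t : Fin m → ℝ) (g : CircuitIndex t) (l : Fin m) :
    0 ≤ circuit t g l := by
  rcases g with k | ⟨i, j⟩
  · rw [circuit_inl_apply]; split_ifs <;> norm_num
  · rw [circuit_inr_apply]
    have := i.2
    have := j.2
    split_ifs <;> linarith

lemma dotProduct_circuit_inl {m : ℕ} (t y : Fin m → ℝ) (k : {k // t k = 0}) :
    dotProduct y (circuit t (Sum.inl k)) = y k := by
  simp [circuit]

lemma dotProduct_circuit_inr {m : ℕ} (t y : Fin m → ℝ) (i : {i // t i < 0}) (j : {j // 0 < t j}) :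
    dotProduct y (circuit t (Sum.inr (i, j))) = t j * y i - t i * y j := by
  simp [circuit, dotProduct_sub, dotProduct_smul]

lemma dotProduct_self_circuit {m : ℕ} (t : Fin m → ℝ) (g : CircuitIndex t) :
    dotProduct t (circuit t g) = 0 := by
  rcases g with k | ⟨i, j⟩
  · rw [dotProduct_circuit_inl, k.2]
  · rw [dotProduct_circuit_inr]; ring

lemma card_circuitIndex {m : ℕ} (t : Fin m → ℝ) :
    Fintype.card (CircuitIndex t) + Fintype.card {i // t i < 0} + Fintype.card {j // 0 < t j} =
      m + Fintype.card {i // t i < 0} * Fintype.card {j // 0 < t j} := by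
  have h : m = Fintype.card {k // t k = 0} + Fintype.card {i // t i < 0} +
      Fintype.card {j // 0 < t j} := by
    simp only [Fintype.card_subtype]
    rw [← Finset.card_union_of_disjoint, ← Finset.card_union_of_disjoint]
    · conv_lhs => rw [← Finset.card_fin m]
      congr 1
      ext l
      rcases lt_trichotomy (t l) 0 with h | h | h <;> simp [h]
    · rw [Finset.disjoint_left]
      intro l
      simp only [Finset.mem_union, Finset.mem_filter, Finset.mem_univ, true_and]
      rintro (h | h) <;> linarith
    · rw [Finset.disjoint_left]
      intro l
      simp only [Finset.mem_filter, Finset.mem_univ, true_and]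
      intro h; linarith
  rw [Fintype.card_sum, Fintype.card_prod]
  omega

lemma sum_subtype_ite {m : ℕ} {p : Fin m → Prop} [DecidablePred p] (a : Fin m → ℝ)
    (l : Fin m) : ∑ k : {k // p k}, (if l = k.1 then a k else 0) = if p l then a l else 0 := by
  split_ifs with h
  · rw [Finset.sum_eq_single ⟨l, h⟩]
    · simp
    · rintro ⟨k, hk⟩ - hne
      rw [if_neg]
      rintro rfl
      exact hne rfl
    · simp
  · refine Finset.sum_eq_zero fun k _ => if_neg ?_
    rintro rfl
    exact h k.2

lemma exists_circuit_decomposition {m : ℕ} (t x : Fin m → ℝ) (hx : ∀ i, 0 ≤ x i)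
    (ht : dotProduct t x = 0) :
    ∃ c : CircuitIndex t → ℝ, (∀ g, 0 ≤ c g) ∧ x = ∑ g, c g • circuit t g := by
  set T := ∑ j : {j // 0 < t j}, t j * x j with hT
  have hT' : ∑ i : {i // t i < 0}, -(t i * x i) = T := by
    have h1 : ∀ l, t l * x l = (if 0 < t l then t l * x l else 0) -
        (if t l < 0 then -(t l * x l) else 0) := by
      intro l
      rcases lt_trichotomy (t l) 0 with h | h | h
      · rw [if_neg h.not_gt, if_pos h]; ring
      · simp [h]
      · rw [if_pos h, if_neg h.not_gt]; ring
    have h2 : dotProduct t x = ∑ l, ((if 0 < t l then t l * x l else 0) -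
        (if t l < 0 then -(t l * x l) else 0)) := Finset.sum_congr rfl fun l _ => h1 l
    rw [ht, Finset.sum_sub_distrib, ← Finset.sum_filter, ← Finset.sum_filter,
      Finset.sum_subtype (p := fun l => 0 < t l) _ (by simp),
      Finset.sum_subtype (p := fun l => t l < 0) _ (by simp)] at h2
    linarith
  have hT0 : 0 ≤ T := Finset.sum_nonneg fun j _ => mul_nonneg j.2.le (hx j)
  refine ⟨Sum.elim (fun k => x k) (fun ij => x ij.1 * x ij.2 / T), ?_, ?_⟩
  · rintro (k | ij)
    · exact hx k
    · exact div_nonneg (mul_nonneg (hx _) (hx _)) hT0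
  · ext l
    rw [Finset.sum_apply, Fintype.sum_sum_type, Fintype.sum_prod_type]
    simp only [Sum.elim_inl, Sum.elim_inr, Pi.smul_apply, smul_eq_mul, circuit_inl_apply,
      circuit_inr_apply, mul_sub, mul_ite, mul_one, mul_zero, Finset.sum_sub_distrib]
    rw [sum_subtype_ite (p := fun k => t k = 0) x l]
    have e1 : ∑ i : {i // t i < 0}, ∑ j : {j // 0 < t j},
        (if l = i.1 then x i * x j / T * t j else 0) = if t l < 0 then x l * (T / T) else 0 := by
      rw [← sum_subtype_ite (p := fun k => t k < 0) (fun l => x l * (T / T)) l]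
      refine Finset.sum_congr rfl fun i _ => ?_
      split_ifs
      · rw [hT, Finset.sum_div, Finset.mul_sum]
        exact Finset.sum_congr rfl fun j _ => by rw [← hT]; ring
      · simp
    have e2 : ∑ i : {i // t i < 0}, ∑ j : {j // 0 < t j},
        (if l = j.1 then x i * x j / T * t i else 0) = if 0 < t l then -(x l * (T / T)) else 0 := by
      rw [Finset.sum_comm, ← sum_subtype_ite (p := fun k => 0 < t k) (fun l => -(x l * (T / T))) l]
      refine Finset.sum_congr rfl fun j _ => ?_
      split_ifs
      · nth_rw 2 [← hT']
        rw [Finset.sum_div, Finset.mul_sum, ← Finset.sum_neg_distrib]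
        exact Finset.sum_congr rfl fun i _ => by ring
      · simp
    rw [e1, e2]
    have hTT : t l ≠ 0 → x l * (T / T) = x l := by
      intro hl
      by_cases h : T = 0
      · have : x l = 0 := by
          rcases lt_or_gt_of_ne hl with h' | h'
          · have := (Finset.sum_eq_zero_iff_of_nonneg (fun i _ => by
              have := i.2; have := hx i.1; nlinarith)).1 (hT'.trans h) ⟨l, h'⟩ (Finset.mem_univ _)
            simpa [hl] using this
          · have := (Finset.sum_eq_zero_iff_of_nonneg (fun j _ =>
              mul_nonneg j.2.le (hx j.1))).1 (hT.symm.trans h) ⟨l, h'⟩ (Finset.mem_univ _)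
            simpa [hl] using this
        rw [this, zero_mul]
      · rw [div_self h, mul_one]
    rcases lt_trichotomy (t l) 0 with h | h | h
    · rw [if_neg h.ne, if_pos h, if_neg h.not_gt, hTT h.ne]; ring
    · simp [h]
    · rw [if_neg h.ne', if_neg h.not_gt, if_pos h, hTT h.ne']; ring

lemma exists_add_smul_nonneg {m : ℕ} (t y : Fin m → ℝ)
    (h : ∀ g, 0 ≤ dotProduct y (circuit t g)) : ∃ a : ℝ, ∀ l, 0 ≤ y l + a * t l := by
  have hz : ∀ l, t l = 0 → 0 ≤ y l := fun l hl => by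
    simpa [dotProduct_circuit_inl] using h (Sum.inl ⟨l, hl⟩)
  have hp : ∀ i j, t i < 0 → 0 < t j → 0 ≤ t j * y i - t i * y j := fun i j hi hj => by
    simpa [dotProduct_circuit_inr] using h (Sum.inr (⟨i, hi⟩, ⟨j, hj⟩))
  by_cases hpos : ∃ j, 0 < t j
  · obtain ⟨j₀, hj₀⟩ := hpos
    obtain ⟨j, hj, hmax⟩ := Finset.exists_max_image (Finset.univ.filter fun j => 0 < t j)
      (fun j => -y j / t j) ⟨j₀, by simpa using hj₀⟩
    simp only [Finset.mem_filter, Finset.mem_univ, true_and] at hj hmax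
    refine ⟨-y j / t j, fun l => ?_⟩
    rcases lt_trichotomy (t l) 0 with hl | hl | hl
    · have := hp l j hl hj
      have e : y l + -y j / t j * t l = (t j * y l - t l * y j) / t j := by
        field_simp; ring
      rw [e]
      exact div_nonneg this hj.le
    · simpa [hl] using hz l hl
    · have := (div_le_iff₀ hl).1 (hmax l hl)
      linarith
  · by_cases hneg : ∃ i, t i < 0
    · obtain ⟨i₀, hi₀⟩ := hneg
      obtain ⟨i, hi, hmin⟩ := Finset.exists_min_image (Finset.univ.filter fun i => t i < 0)
        (fun i => y i / (-t i)) ⟨i₀, by simpa using hi₀⟩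
      simp only [Finset.mem_filter, Finset.mem_univ, true_and] at hi hmin
      refine ⟨y i / (-t i), fun l => ?_⟩
      rcases lt_trichotomy (t l) 0 with hl | hl | hl
      · have := (le_div_iff₀ (neg_pos.2 hl)).1 (hmin l hl)
        linarith
      · simpa [hl] using hz l hl
      · exact absurd ⟨l, hl⟩ hpos
    · push Not at hpos hneg
      refine ⟨0, fun l => ?_⟩
      have := hz l (le_antisymm (hpos l) (hneg l))
      simpa using this

lemma eq_smul_circuit {m : ℕ} (t x : Fin m → ℝ) (ht : dotProduct t x = 0) (g : CircuitIndex t)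
    (h : ∀ l, circuit t g l = 0 → x l = 0) : ∃ a : ℝ, x = a • circuit t g := by
  rcases g with k | ⟨i, j⟩
  · refine ⟨x k, ?_⟩
    ext l
    have := h l
    rw [circuit_inl_apply] at this
    rw [Pi.smul_apply, circuit_inl_apply]
    split_ifs with hl
    · simp [hl]
    · simpa [hl] using this
  · have hi := i.2
    have hj := j.2
    have hij : i.1 ≠ j.1 := by rintro hij; rw [hij] at hi; linarith
    have h0 : ∀ l, l ≠ i.1 → l ≠ j.1 → x l = 0 := fun l h1 h2 => h l (by
      rw [circuit_inr_apply, if_neg h1, if_neg h2, sub_zero])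
    have hsum : t i * x i + t j * x j = 0 := by
      refine Eq.trans ?_ ht
      rw [dotProduct, ← Finset.sum_pair (f := fun l => t l * x l) hij]
      refine Finset.sum_subset (Finset.subset_univ _) fun l _ hl => ?_
      simp only [Finset.mem_insert, Finset.mem_singleton, not_or] at hl
      rw [h0 l hl.1 hl.2, mul_zero]
    refine ⟨x i / t j, ?_⟩
    ext l
    rw [Pi.smul_apply, circuit_inr_apply, smul_eq_mul]
    by_cases h1 : l = i.1
    · rw [if_pos h1, if_neg (fun h2 => hij (h1.symm.trans h2)), h1]
      field_simp; ring
    · by_cases h2 : l = j.1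
      · rw [if_neg h1, if_pos h2, h2]
        field_simp
        linarith
      · rw [if_neg h1, if_neg h2, h0 l h1 h2]; ring

lemma circuit_support_injective {m : ℕ} (t : Fin m → ℝ) {g g' : CircuitIndex t}
    (h : ∀ l, circuit t g l = 0 → circuit t g' l = 0) : g' = g := by
  rcases g with k | ⟨i, j⟩ <;> rcases g' with k' | ⟨i', j'⟩
  · have := h k'
    simp only [circuit_inl_apply] at this
    by_cases e : k'.1 = k.1
    · rw [Subtype.ext e]
    · simp [e] at this
  · have h1 := h i'
    have h2 := i'.2
    have h3 := j'.2
    have h4 := k.2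
    have e1 : i'.1 ≠ k.1 := by rintro e; rw [e] at h2; linarith
    have e2 : i'.1 ≠ j'.1 := by rintro e; rw [e] at h2; linarith
    simp [circuit_inl_apply, circuit_inr_apply, e1, e2, h3.ne'] at h1
  · have h1 := h k'
    have h2 := i.2
    have h3 := j.2
    have h4 := k'.2
    have e1 : k'.1 ≠ i.1 := by rintro e; rw [← e] at h2; linarith
    have e2 : k'.1 ≠ j.1 := by rintro e; rw [← e] at h3; linarith
    simp [circuit_inl_apply, circuit_inr_apply, e1, e2] at h1
  · have h1 := h i'
    have h2 := h j'
    have hi := i.2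
    have hj := j.2
    have hi' := i'.2
    have hj' := j'.2
    have e1 : i'.1 ≠ j.1 := by rintro e; rw [e] at hi'; linarith
    have e2 : i'.1 ≠ j'.1 := by rintro e; rw [e] at hi'; linarith
    have e3 : j'.1 ≠ i.1 := by rintro e; rw [e] at hj'; linarith
    by_cases e4 : i'.1 = i.1
    · by_cases e5 : j'.1 = j.1
      · rw [Subtype.ext e4, Subtype.ext e5]
      · simp [circuit_inr_apply, e2.symm, e3, e5, hi'.ne] at h2
    · simp [circuit_inr_apply, e1, e2, e4, hj'.ne'] at h1

lemma dotProduct_map_single {m : ℕ} (f : (Fin m → ℝ) →ₗ[ℝ] ℝ) (x : Fin m → ℝ) :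
    dotProduct (fun l => f (Pi.single l 1)) x = f x := by
  conv_rhs => rw [pi_eq_sum_univ' x]
  simp only [map_sum, map_smul, dotProduct, smul_eq_mul, mul_comm]

lemma smul_hat_eq {N : ℕ} {a b : ℝ} {v w : Fin N → ℝ} (ha : 0 < a)
    (h : a • hat v = b • hat w) : a = b ∧ v = w := by
  have h2 : a = b := by simpa [hat] using congrArg Prod.snd h
  subst h2
  exact ⟨rfl, hat_injective (smul_right_injective _ ha.ne' h)⟩

lemma exists_smul_hat_of_vertex {N : ℕ} {P : Set (Fin N → ℝ)} {G : Type*} [Fintype G]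
    {u : G → (Fin N → ℝ) × ℝ} (hu : ∀ g, u g ∈ homCone P) {v : Fin N → ℝ} (hv : IsVertexOf v P)
    {c : G → ℝ} (hc : ∀ g, 0 ≤ c g) (e : hat v = ∑ g, c g • u g) :
    ∃ g, ∃ a : ℝ, 0 < a ∧ u g = a • hat v := by
  obtain ⟨f, hf, hfv⟩ := isFaceOf_iff.1 hv
  choose a ha y hy hay using hu
  have hv0 : f (hat v) = 0 := by
    have : v ∈ {x ∈ P | f (hat x) = 0} := hfv ▸ mem_singleton v
    exact this.2
  have hs : ∑ g, c g * (a g * f (hat (y g))) = 0 := by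
    rw [← hv0, e, map_sum]
    simp only [hay, map_smul, smul_eq_mul]
  have hz := (Finset.sum_eq_zero_iff_of_nonneg fun g _ =>
    mul_nonneg (hc g) (mul_nonneg (ha g) (hf _ (hy g)))).1 hs
  have h1 : (1 : ℝ) = ∑ g, c g * a g := by
    have := congrArg Prod.snd e
    simpa [hat, hay, Prod.snd_sum] using this
  obtain ⟨g, -, hg⟩ := Finset.exists_ne_zero_of_sum_ne_zero (h1 ▸ one_ne_zero)
  have hag : a g ≠ 0 := right_ne_zero_of_mul hg
  have hcg : c g ≠ 0 := left_ne_zero_of_mul hg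
  refine ⟨g, a g, lt_of_le_of_ne (ha g) hag.symm, ?_⟩
  have hfy : f (hat (y g)) = 0 := by
    have := hz g (Finset.mem_univ g)
    simpa [hag, hcg] using this
  have : y g ∈ ({v} : Set (Fin N → ℝ)) := hfv ▸ ⟨hy g, hfy⟩
  rw [hay g, mem_singleton_iff.1 this]

lemma circuit_ne_zero {m : ℕ} (t : Fin m → ℝ) (g : CircuitIndex t) : ∃ l, circuit t g l ≠ 0 := by
  rcases g with k | ⟨i, j⟩
  · exact ⟨k, by simp [circuit_inl_apply]⟩
  · refine ⟨i, ?_⟩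
    have hi := i.2
    have hj := j.2
    rw [circuit_inr_apply, if_pos rfl]
    split_ifs <;> linarith

/-- A representation of the cone over `P` as the image of the section of the positive orthant
by the hyperplane `t ⬝ x = 0`, under a linear map with one-dimensional kernel spanned by `r`. -/
structure OrthantSection {m N : ℕ} (P : Set (Fin N → ℝ)) (t r : Fin m → ℝ)
    (Φ : (Fin m → ℝ) →ₗ[ℝ] ((Fin N → ℝ) × ℝ)) : Prop where
  mem_homCone : ∀ x, dotProduct t x = 0 → (∀ i, 0 ≤ x i) → Φ x ∈ homCone P
  exists_lift : ∀ y ∈ P, ∃ x, dotProduct t x = 0 ∧ (∀ i, 0 ≤ x i) ∧ Φ x = hat y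
  dotProduct_eq : dotProduct t r = 0
  map_eq : Φ r = 0
  eq_smul : ∀ x, dotProduct t x = 0 → Φ x = 0 → ∃ a : ℝ, x = a • r
  span_eq : Submodule.span ℝ (hat '' P) = ⊤

namespace OrthantSection

variable {m N : ℕ} {P : Set (Fin N → ℝ)} {t r : Fin m → ℝ}
  {Φ : (Fin m → ℝ) →ₗ[ℝ] ((Fin N → ℝ) × ℝ)}

lemma neg (h : OrthantSection P t r Φ) : OrthantSection P t (-r) Φ where
  mem_homCone := h.mem_homCone
  exists_lift := h.exists_lift
  dotProduct_eq := by rw [dotProduct_neg, h.dotProduct_eq, neg_zero]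
  map_eq := by rw [map_neg, h.map_eq, neg_zero]
  eq_smul x hx hx' := by
    obtain ⟨a, ha⟩ := h.eq_smul x hx hx'
    exact ⟨-a, by rw [ha, smul_neg, neg_smul, neg_neg]⟩
  span_eq := h.span_eq

lemma exists_factor (h : OrthantSection P t r Φ) (y : Fin m → ℝ) (hy : dotProduct y r = 0) :
    ∃ φ : ((Fin N → ℝ) × ℝ) →ₗ[ℝ] ℝ, ∀ x, dotProduct t x = 0 → φ (Φ x) = dotProduct y x := by
  let T : (Fin m → ℝ) →ₗ[ℝ] ℝ := dotProductBilin ℝ ℝ t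
  let Y : (Fin m → ℝ) →ₗ[ℝ] ℝ := dotProductBilin ℝ ℝ y
  have hsurj : LinearMap.range (Φ.domRestrict (LinearMap.ker T)) = ⊤ := by
    rw [eq_top_iff, ← h.span_eq, Submodule.span_le]
    rintro _ ⟨p, hp, rfl⟩
    obtain ⟨x, hx, -, e⟩ := h.exists_lift p hp
    exact ⟨⟨x, hx⟩, e⟩
  obtain ⟨s, hs⟩ := LinearMap.exists_rightInverse_of_surjective _ hsurj
  refine ⟨Y ∘ₗ (LinearMap.ker T).subtype ∘ₗ s, fun x hx => ?_⟩
  have h1 : Φ (s (Φ x)).1 = Φ x := LinearMap.congr_fun hs (Φ x)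
  have h2 : dotProduct t (s (Φ x)).1 = 0 := (s (Φ x)).2
  obtain ⟨a, ha⟩ := h.eq_smul (x - (s (Φ x)).1) (by rw [dotProduct_sub, hx, h2, sub_zero])
    (by rw [map_sub, h1, sub_self])
  have h3 : dotProduct y (x - (s (Φ x)).1) = 0 := by
    rw [ha, dotProduct_smul, hy, smul_zero]
  rw [dotProduct_sub, sub_eq_zero] at h3
  exact h3.symm

lemma exists_vertex (h : OrthantSection P t r Φ) (g : CircuitIndex t) {i j : Fin m}
    (hi : circuit t g i = 0) (hj : circuit t g j = 0) (hri : r i < 0) (hrj : 0 < r j) :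
    ∃ v ∈ vertexSet P, (∃ c : ℝ, 0 < c ∧ Φ (circuit t g) = c • hat v) ∧
      ∀ g' (c' : ℝ), 0 < c' → Φ (circuit t g') = c' • hat v → g' = g := by
  classical
  obtain ⟨y, hy0, hyz, hyp, hyr⟩ : ∃ y : Fin m → ℝ, (∀ l, 0 ≤ y l) ∧
      (∀ l, circuit t g l ≠ 0 → y l = 0) ∧ (∀ l, circuit t g l = 0 → 0 < y l) ∧
      dotProduct y r = 0 := by
    let y₀ : Fin m → ℝ := fun l => if circuit t g l = 0 then 1 else 0
    let s : ℝ := dotProduct y₀ r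
    let α : ℝ := max s 0 / (-r i)
    let β : ℝ := max (-s) 0 / r j
    have hα : 0 ≤ α := div_nonneg (le_max_right _ _) (by linarith)
    have hβ : 0 ≤ β := div_nonneg (le_max_right _ _) hrj.le
    let y : Fin m → ℝ := y₀ + Pi.single i α + Pi.single j β
    have hsi : ∀ l, 0 ≤ Pi.single (M := fun _ : Fin m => ℝ) i α l := fun l => by
      rw [Pi.single_apply]; split_ifs <;> simp [hα]
    have hsj : ∀ l, 0 ≤ Pi.single (M := fun _ : Fin m => ℝ) j β l := fun l => by
      rw [Pi.single_apply]; split_ifs <;> simp [hβ]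
    have hpos : ∀ l, circuit t g l = 0 → 0 < y l :=
      fun l hl => by
        have := hsi l
        have := hsj l
        have : y₀ l = 1 := if_pos hl
        simp only [y, Pi.add_apply]
        linarith
    have hzero : ∀ l, circuit t g l ≠ 0 → y l = 0 :=
      fun l hl => by
        have h1 : l ≠ i := fun e => hl (e ▸ hi)
        have h2 : l ≠ j := fun e => hl (e ▸ hj)
        simp [y, y₀, hl, h1, h2]
    refine ⟨y, fun l => ?_, hzero, hpos, ?_⟩
    · by_cases hl : circuit t g l = 0
      · exact (hpos l hl).le
      · exact (hzero l hl).ge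
    · simp only [y]
      rw [add_dotProduct, add_dotProduct, single_dotProduct, single_dotProduct]
      have h1 : α * r i = - max s 0 := by
        have := hri.ne
        simp only [α]
        field_simp
      have h2 : β * r j = max (-s) 0 := by simp only [β]; field_simp
      rw [h1, h2]
      change s + _ + _ = 0
      rcases le_total 0 s with hs | hs
      · rw [max_eq_left hs, max_eq_right (by linarith)]; ring
      · rw [max_eq_right hs, max_eq_left (by linarith)]; ring
  obtain ⟨φ, hφ⟩ := h.exists_factor y hyr
  have hcirc : dotProduct y (circuit t g) = 0 := by
    refine Finset.sum_eq_zero fun l _ => ?_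
    by_cases hl : circuit t g l = 0
    · rw [hl, mul_zero]
    · rw [hyz l hl, zero_mul]
  have hvanish : ∀ x : Fin m → ℝ, (∀ l, 0 ≤ x l) → dotProduct y x = 0 →
      ∀ l, circuit t g l = 0 → x l = 0 := by
    intro x hx hxy l hl
    have := (Finset.sum_eq_zero_iff_of_nonneg fun l _ => mul_nonneg (hy0 l) (hx l)).1 hxy l
      (Finset.mem_univ l)
    exact (mul_eq_zero.1 this).resolve_left (hyp l hl).ne'
  obtain ⟨c, hc, v, hvP, hcv⟩ := h.mem_homCone _ (dotProduct_self_circuit t g) (circuit_nonneg t g)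
  have hc0 : c ≠ 0 := by
    rintro rfl
    rw [zero_smul] at hcv
    obtain ⟨a, ha⟩ := h.eq_smul _ (dotProduct_self_circuit t g) hcv
    obtain ⟨l, hl⟩ := circuit_ne_zero t g
    have h1 : a * r i = 0 := by rw [← hi, ha]; rfl
    have ha0 : a = 0 := (mul_eq_zero.1 h1).resolve_right hri.ne
    rw [ha, ha0, zero_smul] at hl
    exact hl rfl
  have hcpos : 0 < c := lt_of_le_of_ne hc hc0.symm
  have hφv : φ (hat v) = 0 := by
    have := hφ _ (dotProduct_self_circuit t g)
    rw [hcirc, hcv, map_smul, smul_eq_mul] at this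
    exact (mul_eq_zero.1 this).resolve_left hc0
  refine ⟨v, ?_, ⟨c, hcpos, hcv⟩, fun g' c' hc' e => ?_⟩
  · refine isFaceOf_iff.2 ⟨φ, fun p hp => ?_, ?_⟩
    · obtain ⟨x, hx, hx0, e⟩ := h.exists_lift p hp
      rw [← e, hφ x hx]
      exact Finset.sum_nonneg fun l _ => mul_nonneg (hy0 l) (hx0 l)
    · ext p
      simp only [mem_singleton_iff, mem_ofPred_eq]
      constructor
      · rintro rfl; exact ⟨hvP, hφv⟩
      · rintro ⟨hp, hφp⟩
        obtain ⟨x, hx, hx0, e⟩ := h.exists_lift p hp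
        rw [← e, hφ x hx] at hφp
        obtain ⟨a, rfl⟩ := eq_smul_circuit t x hx g (hvanish x hx0 hφp)
        rw [map_smul, hcv, smul_smul] at e
        exact (smul_hat_eq one_pos ((one_smul _ _).trans e.symm)).2
  · refine circuit_support_injective t (hvanish _ (circuit_nonneg t g') ?_)
    rw [← hφ _ (dotProduct_self_circuit t g'), e, map_smul, hφv, smul_zero]

lemma exists_injective_circuit (h : OrthantSection P t r Φ) :
    ∃ τ : vertexSet P → CircuitIndex t, Function.Injective τ ∧
      ∀ v, ∃ c : ℝ, 0 < c ∧ Φ (circuit t (τ v)) = c • hat v.1 := by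
  have key : ∀ v : vertexSet P, ∃ g, ∃ c : ℝ, 0 < c ∧ Φ (circuit t g) = c • hat v.1 := by
    intro v
    have hvP : v.1 ∈ P := v.2.subset (mem_singleton _)
    obtain ⟨x, hx, hx0, e⟩ := h.exists_lift _ hvP
    obtain ⟨c, hc, hxc⟩ := exists_circuit_decomposition t x hx0 hx
    refine exists_smul_hat_of_vertex (u := fun g => Φ (circuit t g))
      (fun g => h.mem_homCone _ (dotProduct_self_circuit t g) (circuit_nonneg t g)) v.2 hc ?_
    rw [← e, hxc, map_sum]
    simp only [map_smul]
  choose τ c hc hτ using key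
  refine ⟨τ, fun v w hvw => ?_, fun v => ⟨c v, hc v, hτ v⟩⟩
  have := hτ v
  rw [hvw, hτ w] at this
  exact Subtype.ext (smul_hat_eq (hc w) this).2.symm

lemma facetCount_le (h : OrthantSection P t r Φ) :
    facetCount P ≤ Fintype.card (CircuitIndex r) := by
  classical
  let Z : CircuitIndex r → Set (Fin N → ℝ) := fun q =>
    {p ∈ P | ∀ x, dotProduct t x = 0 → Φ x = hat p → dotProduct (circuit r q) x = 0}
  have hsub : {F | IsFacetOf F P} ⊆ range Z := by
    rintro F ⟨hF, hdim⟩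
    obtain ⟨f, hf, hFe⟩ := isFaceOf_iff.1 hF
    have hfF : ∀ p ∈ F, f (hat p) = 0 := fun p hp => by rw [hFe] at hp; exact hp.2
    have hrank : Module.finrank ℝ (Submodule.span ℝ (hat '' F)) + 1 =
        Module.finrank ℝ (Submodule.span ℝ (hat '' P)) := by
      rw [pdim_eq, pdim_eq] at hdim; omega
    have hne : ∃ p ∈ P, f (hat p) ≠ 0 := by
      by_contra! hall
      have : F = P := by
        rw [hFe]; ext p; exact ⟨fun hp => hp.1, fun hp => ⟨hp, hall p hp⟩⟩
      rw [this] at hrank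
      omega
    obtain ⟨p, hp, hfp⟩ := hne
    obtain ⟨x, hx, hx0, e⟩ := h.exists_lift p hp
    let y₀ : Fin m → ℝ := fun l => f (Φ (Pi.single l 1))
    have hy₀ : ∀ x, dotProduct y₀ x = f (Φ x) := dotProduct_map_single (f.comp Φ)
    obtain ⟨a, ha⟩ := exists_add_smul_nonneg t y₀ fun g => by
      rw [hy₀]
      obtain ⟨c, hc, z, hz, hcz⟩ :=
        h.mem_homCone _ (dotProduct_self_circuit t g) (circuit_nonneg t g)
      rw [hcz, map_smul]
      exact mul_nonneg hc (hf z hz)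
    have hy : ∀ x, dotProduct t x = 0 → dotProduct (y₀ + a • t) x = f (Φ x) := by
      intro x hx
      rw [add_dotProduct, smul_dotProduct, hx, smul_zero, add_zero, hy₀]
    obtain ⟨c, hc, hyc⟩ := exists_circuit_decomposition r (y₀ + a • t) ha (by
      rw [dotProduct_comm, hy r h.dotProduct_eq, h.map_eq, map_zero])
    have hsum : ∀ x, dotProduct t x = 0 → f (Φ x) = ∑ q, c q * dotProduct (circuit r q) x := by
      intro x hx
      rw [← hy x hx, hyc, sum_dotProduct]
      simp only [smul_dotProduct, smul_eq_mul]
    have hcn : ∀ q (x : Fin m → ℝ), (∀ l, 0 ≤ x l) → 0 ≤ dotProduct (circuit r q) x :=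
      fun q x hx => Finset.sum_nonneg fun l _ => mul_nonneg (circuit_nonneg r q l) (hx l)
    obtain ⟨q, -, hq⟩ := Finset.exists_ne_zero_of_sum_ne_zero
      (show ∑ q, c q * dotProduct (circuit r q) x ≠ 0 by rwa [← hsum x hx, e])
    obtain ⟨φ, hφ⟩ := h.exists_factor (circuit r q) (by
      rw [dotProduct_comm, dotProduct_self_circuit])
    have hφp : φ (hat p) ≠ 0 := by rw [← e, hφ x hx]; exact right_ne_zero_of_mul hq
    have hφF : ∀ p' ∈ F, φ (hat p') = 0 := by
      intro p' hp'
      obtain ⟨x', hx', hx0', e'⟩ := h.exists_lift p' (hF.subset hp')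
      have h0 := hfF p' hp'
      rw [← e', hsum x' hx'] at h0
      have := (Finset.sum_eq_zero_iff_of_nonneg fun q _ =>
        mul_nonneg (hc q) (hcn q x' hx0')).1 h0 q (Finset.mem_univ q)
      rw [← e', hφ x' hx']
      exact (mul_eq_zero.1 this).resolve_left (left_ne_zero_of_mul hq)
    have hφ0 : φ ≠ 0 := by rintro rfl; exact hφp rfl
    have hspanle : Submodule.span ℝ (hat '' F) ≤ LinearMap.ker φ := by
      rw [Submodule.span_le]
      rintro _ ⟨p', hp', rfl⟩
      exact hφF p' hp'
    have hker : LinearMap.ker φ ≤ LinearMap.ker f := by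
      have h1 : Module.finrank ℝ (LinearMap.ker φ) + 1 =
          Module.finrank ℝ ((Fin N → ℝ) × ℝ) := by
        have := LinearMap.finrank_range_add_finrank_ker φ
        rw [LinearMap.range_eq_top.2 (LinearMap.surjective hφ0), finrank_top,
          Module.finrank_self] at this
        omega
      rw [h.span_eq, finrank_top, ← h1] at hrank
      rw [← Submodule.eq_of_le_of_finrank_eq hspanle (by omega), Submodule.span_le]
      rintro _ ⟨p', hp', rfl⟩
      exact hfF p' hp'
    refine ⟨q, ?_⟩
    ext p'
    constructor
    · rintro ⟨hp', hz⟩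
      obtain ⟨x', hx', -, e'⟩ := h.exists_lift p' hp'
      rw [hFe]
      refine ⟨hp', hker ?_⟩
      rw [LinearMap.mem_ker, ← e', hφ x' hx']
      exact hz x' hx' e'
    · intro hp'
      refine ⟨hF.subset hp', fun x' hx' e' => ?_⟩
      rw [← hφ x' hx', e', hφF p' hp']
  calc facetCount P ≤ (range Z).ncard := ncard_le_ncard hsub (finite_range Z)
    _ ≤ Nat.card (CircuitIndex r) := by
      rw [← image_univ, ← ncard_univ]; exact ncard_image_le
    _ = _ := Nat.card_eq_fintype_card

end OrthantSection

lemma two_le_of_add_lt_mul {a b : ℕ} (h : a + b < a * b) : 2 ≤ a ∧ 2 ≤ b := by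
  constructor
  · by_contra! ha
    interval_cases a <;> omega
  · by_contra! hb
    interval_cases b <;> omega

lemma two_three_of_add_lt_mul {a b : ℕ} (h : a + b < a * b) :
    (2 ≤ a ∧ 3 ≤ b) ∨ (3 ≤ a ∧ 2 ≤ b) := by
  obtain ⟨ha, hb⟩ := two_le_of_add_lt_mul h
  by_cases ha' : a = 2
  · subst ha'; omega
  · omega

lemma exists_embeddings_avoiding {α β : Type*} [Fintype α] [Fintype β] {good : α → β → Prop}
    (h : Fintype.card α + Fintype.card β + 1 < Fintype.card α * Fintype.card β)
    (hbad : ∀ a b a' b', ¬ good a b → ¬ good a' b' → a = a' ∧ b = b') :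
    (∃ (x : Fin 2 ↪ α) (y : Fin 3 ↪ β), ∀ i j, good (x i) (y j)) ∨
      ∃ (x : Fin 3 ↪ α) (y : Fin 2 ↪ β), ∀ i j, good (x i) (y j) := by
  classical
  have emb : ∀ {γ : Type _} [Fintype γ] (k : ℕ), k ≤ Fintype.card γ → Nonempty (Fin k ↪ γ) :=
    fun k hk => Function.Embedding.nonempty_of_card_le (by simpa using hk)
  have emb' : ∀ {γ : Type _} [Fintype γ] (k : ℕ), k ≤ Fintype.card γ → Nonempty (Fin k ↪ γ) :=
    fun k hk => Function.Embedding.nonempty_of_card_le (by simpa using hk)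
  obtain ⟨ha, hb⟩ := two_le_of_add_lt_mul (a := Fintype.card α) (b := Fintype.card β) (by omega)
  by_cases hex : ∃ u v, ¬ good u v
  · obtain ⟨u, v, huv⟩ := hex
    have hα : Fintype.card {a // a ≠ u} = Fintype.card α - 1 := by
      rw [Fintype.card_subtype_compl, Fintype.card_subtype_eq]
    have hβ : Fintype.card {b // b ≠ v} = Fintype.card β - 1 := by
      rw [Fintype.card_subtype_compl, Fintype.card_subtype_eq]
    have hrow : ∀ (a : {a // a ≠ u}) b, good a.1 b := fun a b => by
      by_contra hab
      exact a.2 (hbad _ _ _ _ hab huv).1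
    have hcol : ∀ a (b : {b // b ≠ v}), good a b.1 := fun a b => by
      by_contra hab
      exact b.2 (hbad _ _ _ _ hab huv).2
    by_cases h4 : 4 ≤ Fintype.card β
    · obtain ⟨x⟩ := emb (γ := α) 2 ha
      obtain ⟨y⟩ := emb' (γ := {b // b ≠ v}) 3 (by omega)
      exact Or.inl ⟨x, y.trans (Function.Embedding.subtype _), fun i j => hcol _ _⟩
    by_cases h4' : 4 ≤ Fintype.card α
    · obtain ⟨x⟩ := emb (γ := {a // a ≠ u}) 3 (by omega)
      obtain ⟨y⟩ := emb' (γ := β) 2 hb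
      exact Or.inr ⟨x.trans (Function.Embedding.subtype _), y, fun i j => hrow _ _⟩
    have h3 : Fintype.card α = 3 ∧ Fintype.card β = 3 := by
      generalize Fintype.card α = a at *
      generalize Fintype.card β = b at *
      push Not at h4 h4'
      interval_cases a <;> interval_cases b <;> omega
    obtain ⟨x⟩ := emb (γ := {a // a ≠ u}) 2 (by omega)
    obtain ⟨y⟩ := emb' (γ := β) 3 (by omega)
    exact Or.inl ⟨x.trans (Function.Embedding.subtype _), y, fun i j => hrow _ _⟩
  · push Not at hex
    rcases two_three_of_add_lt_mul (show Fintype.card α + Fintype.card β < _ by omega) with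
      ⟨h1, h2⟩ | ⟨h1, h2⟩
    · obtain ⟨x⟩ := emb (γ := α) 2 h1
      obtain ⟨y⟩ := emb' (γ := β) 3 h2
      exact Or.inl ⟨x, y, fun i j => hex _ _⟩
    · obtain ⟨x⟩ := emb (γ := α) 3 h1
      obtain ⟨y⟩ := emb' (γ := β) 2 h2
      exact Or.inr ⟨x, y, fun i j => hex _ _⟩

namespace OrthantSection

variable {m N : ℕ} {P : Set (Fin N → ℝ)} {t r : Fin m → ℝ}
  {Φ : (Fin m → ℝ) →ₗ[ℝ] ((Fin N → ℝ) × ℝ)}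

/-- The circuit `g` spans a ray mapped to a vertex of `P`, and is the only such circuit. -/
def Good (P : Set (Fin N → ℝ)) (t : Fin m → ℝ) (Φ : (Fin m → ℝ) →ₗ[ℝ] ((Fin N → ℝ) × ℝ))
    (g : CircuitIndex t) : Prop :=
  ∃ v ∈ vertexSet P, (∃ c : ℝ, 0 < c ∧ Φ (circuit t g) = c • hat v) ∧
    ∀ g' (c' : ℝ), 0 < c' → Φ (circuit t g') = c' • hat v → g' = g

lemma negative_eq_of_not_good (h : OrthantSection P t r Φ)
    (hn : 2 ≤ Fintype.card {l // r l < 0}) (hp : 3 ≤ Fintype.card {l // 0 < r l})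
    (i : {i // t i < 0}) (j : {j // 0 < t j}) (hg : ¬ Good P t Φ (Sum.inr (i, j))) :
    Finset.univ.filter (fun l => r l < 0) = {i.1, j.1} := by
  classical
  rw [Fintype.card_subtype] at hn hp
  have hz : ∀ l, l ∉ ({i.1, j.1} : Finset (Fin m)) → circuit t (Sum.inr (i, j)) l = 0 := by
    intro l hl
    simp only [Finset.mem_insert, Finset.mem_singleton, not_or] at hl
    rw [circuit_inr_apply, if_neg hl.1, if_neg hl.2, sub_zero]
  have h2 : ({i.1, j.1} : Finset (Fin m)).card ≤ 2 := Finset.card_le_two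
  obtain ⟨l', hl', hl'n⟩ := Finset.exists_mem_notMem_of_card_lt_card
    (show ({i.1, j.1} : Finset (Fin m)).card < _ from lt_of_le_of_lt h2 hp)
  refine Finset.eq_of_subset_of_card_le (fun l hl => ?_) (h2.trans hn)
  by_contra hln
  exact hg (h.exists_vertex _ (hz l hln) (hz l' hl'n) (by simpa using hl) (by simpa using hl'))

lemma not_good_unique (h : OrthantSection P t r Φ)
    (hn : 2 ≤ Fintype.card {l // r l < 0}) (hp : 3 ≤ Fintype.card {l // 0 < r l})
    (i : {i // t i < 0}) (j : {j // 0 < t j}) (i' : {i // t i < 0}) (j' : {j // 0 < t j})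
    (hg : ¬ Good P t Φ (Sum.inr (i, j))) (hg' : ¬ Good P t Φ (Sum.inr (i', j'))) :
    i = i' ∧ j = j' := by
  have e := (h.negative_eq_of_not_good hn hp i j hg).symm.trans
    (h.negative_eq_of_not_good hn hp i' j' hg')
  have hi : i.1 ∈ ({i'.1, j'.1} : Finset (Fin m)) := e ▸ by simp
  have hj : j.1 ∈ ({i'.1, j'.1} : Finset (Fin m)) := e ▸ by simp
  simp only [Finset.mem_insert, Finset.mem_singleton] at hi hj
  refine ⟨Subtype.ext (hi.resolve_right fun e' => ?_), Subtype.ext (hj.resolve_left fun e' => ?_)⟩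
  · have h1 := i.2
    have h2 := j'.2
    rw [e'] at h1
    linarith
  · have h1 := j.2
    have h2 := i'.2
    rw [e'] at h1
    linarith

lemma exists_vertex_grid {ι κ : Type*} (x : ι ↪ {i // t i < 0}) (y : κ ↪ {j // 0 < t j})
    (hg : ∀ i j, Good P t Φ (Sum.inr (x i, y j))) :
    ∃ w : ι × κ → vertexSet P, Function.Injective w ∧ ∃ (s : ι × κ → ℝ)
      (A : ι → (Fin N → ℝ) × ℝ) (B : κ → (Fin N → ℝ) × ℝ), (∀ k, 0 < s k) ∧
      ∀ i j, s (i, j) • hat (w (i, j)).1 = A i + B j := by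
  choose v hv hc huniq using hg
  choose c hc hvc using hc
  refine ⟨fun k => ⟨v k.1 k.2, hv k.1 k.2⟩, ?_,
    fun k => c k.1 k.2 / (-t (x k.1) * t (y k.2)),
    fun i => (-t (x i))⁻¹ • Φ (Pi.single (x i).1 1), fun j => (t (y j))⁻¹ • Φ (Pi.single (y j).1 1),
    fun k => div_pos (hc _ _) (mul_pos (neg_pos.2 (x k.1).2) (y k.2).2), fun i j => ?_⟩
  · rintro ⟨i, j⟩ ⟨i', j'⟩ e
    have e' : v i j = v i' j' := congrArg Subtype.val e
    have := huniq i j (Sum.inr (x i', y j')) _ (hc i' j') (by rw [hvc, e'])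
    simp only [Sum.inr.injEq, Prod.mk.injEq, EmbeddingLike.apply_eq_iff_eq] at this
    rw [this.1, this.2]
  · have hx := (x i).2.ne
    have hy := (y j).2.ne'
    have := hvc i j
    simp only [circuit, map_sub, map_smul] at this
    simp only
    rw [div_eq_inv_mul, ← smul_smul, ← this, smul_sub, smul_smul, smul_smul, sub_eq_add_neg,
      ← neg_smul]
    congr 2 <;> field_simp

/-- The `2 × 3` grid of vertices of `P` whose homogenizations, suitably scaled, are sums of
a row vector and a column vector. -/
def HasPrismGrid (P : Set (Fin N → ℝ)) : Prop :=
  ∃ w : Fin 2 × Fin 3 → vertexSet P, Function.Injective w ∧ ∃ (s : Fin 2 × Fin 3 → ℝ)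
    (A : Fin 2 → (Fin N → ℝ) × ℝ) (B : Fin 3 → (Fin N → ℝ) × ℝ), (∀ k, 0 < s k) ∧
    ∀ i j, s (i, j) • hat (w (i, j)).1 = A i + B j

lemma hasPrismGrid_of_embeddings (h :
    (∃ (x : Fin 2 ↪ {i // t i < 0}) (y : Fin 3 ↪ {j // 0 < t j}),
      ∀ i j, Good P t Φ (Sum.inr (x i, y j))) ∨
    ∃ (x : Fin 3 ↪ {i // t i < 0}) (y : Fin 2 ↪ {j // 0 < t j}),
      ∀ i j, Good P t Φ (Sum.inr (x i, y j))) : HasPrismGrid P := by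
  rcases h with ⟨x, y, hg⟩ | ⟨x, y, hg⟩
  · exact exists_vertex_grid x y hg
  · obtain ⟨w, hw, s, A, B, hs, e⟩ := exists_vertex_grid x y hg
    exact ⟨w ∘ Prod.swap, hw.comp Prod.swap_injective, s ∘ Prod.swap, B, A, fun k => hs _,
      fun i j => (e j i).trans (add_comm _ _)⟩

lemma hasPrismGrid_of_card (h : OrthantSection P t r Φ) (hfin : (vertexSet P).Finite)
    (hv : vertexCount P = m + 1)
    (hn : 2 ≤ Fintype.card {l // r l < 0}) (hp : 3 ≤ Fintype.card {l // 0 < r l}) :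
    HasPrismGrid P := by
  classical
  have : Fintype (vertexSet P) := hfin.fintype
  have hcard : Fintype.card (vertexSet P) = m + 1 := by
    rw [← hv, vertexCount, ← Nat.card_coe_set_eq, Nat.card_eq_fintype_card]
  obtain ⟨τ, hτ, hτc⟩ := h.exists_injective_circuit
  have hle := Fintype.card_le_of_injective τ hτ
  have hG := card_circuitIndex t
  apply hasPrismGrid_of_embeddings (t := t) (Φ := Φ)
  by_cases he : Fintype.card (CircuitIndex t) = m + 1
  · have hbij : Function.Bijective τ :=
      (Fintype.bijective_iff_injective_and_card τ).2 ⟨hτ, hcard.trans he.symm⟩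
    have hgood : ∀ g, Good P t Φ g := by
      intro g
      obtain ⟨v, rfl⟩ := hbij.2 g
      refine ⟨v, v.2, hτc v, fun g' c' hc' e => ?_⟩
      obtain ⟨v', rfl⟩ := hbij.2 g'
      obtain ⟨c, hc, e'⟩ := hτc v'
      rw [e] at e'
      rw [Subtype.ext (smul_hat_eq hc' e').2]
    rcases two_three_of_add_lt_mul (a := Fintype.card {i // t i < 0})
      (b := Fintype.card {j // 0 < t j}) (by omega) with ⟨h1, h2⟩ | ⟨h1, h2⟩
    · obtain ⟨x⟩ := Function.Embedding.nonempty_of_card_le (α := Fin 2)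
        (β := {i // t i < 0}) (by rwa [Fintype.card_fin])
      obtain ⟨y⟩ := Function.Embedding.nonempty_of_card_le (α := Fin 3)
        (β := {j // 0 < t j}) (by rwa [Fintype.card_fin])
      exact Or.inl ⟨x, y, fun i j => hgood _⟩
    · obtain ⟨x⟩ := Function.Embedding.nonempty_of_card_le (α := Fin 3)
        (β := {i // t i < 0}) (by rwa [Fintype.card_fin])
      obtain ⟨y⟩ := Function.Embedding.nonempty_of_card_le (α := Fin 2)
        (β := {j // 0 < t j}) (by rwa [Fintype.card_fin])
      exact Or.inr ⟨x, y, fun i j => hgood _⟩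
  · exact exists_embeddings_avoiding (good := fun i j => Good P t Φ (Sum.inr (i, j)))
      (by omega) fun i j i' j' => h.not_good_unique hn hp i j i' j'

lemma hasPrismGrid (h : OrthantSection P t r Φ) (hfin : (vertexSet P).Finite)
    (hv : vertexCount P = m + 1) (hf : m + 1 ≤ facetCount P) : HasPrismGrid P := by
  have hR := card_circuitIndex r
  have hle := h.facetCount_le
  rcases two_three_of_add_lt_mul (a := Fintype.card {i // r i < 0})
    (b := Fintype.card {j // 0 < r j}) (by omega) with ⟨h1, h2⟩ | ⟨h1, h2⟩
  · exact h.hasPrismGrid_of_card hfin hv h1 h2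
  · refine h.neg.hasPrismGrid_of_card hfin hv (h2.trans_eq ?_) (h1.trans_eq ?_)
    · exact Fintype.card_congr (Equiv.subtypeEquivRight (by simp))
    · exact Fintype.card_congr (Equiv.subtypeEquivRight (by simp))

end OrthantSection

lemma span_hat_eq_top {d : ℕ} {P : Set (Fin d → ℝ)} (hdP : pdim P = d) :
    Submodule.span ℝ (hat '' P) = ⊤ := by
  apply Submodule.eq_top_of_finrank_eq
  rw [pdim_eq] at hdP
  have hE : Module.finrank ℝ ((Fin d → ℝ) × ℝ) = d + 1 := by simp
  omega

lemma hasPrismGrid_of_xc {d : ℕ} {P : Set (Fin d → ℝ)} (hP : IsPolytope P) (hdP : pdim P = d)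
    (hv : vertexCount P = d + 4) (hf : d + 4 ≤ facetCount P) (hxc : xc P = d + 3) :
    OrthantSection.HasPrismGrid P := by
  have hmem := Nat.sInf_mem (Nat.nonempty_of_pos_sInf (show 0 < xc P by omega))
  obtain ⟨e, Q, π, hQ, hπ, hfQ⟩ := hmem
  have hne : P.Nonempty := by
    by_contra hne
    simp only [pdim, hne, if_false] at hdP
    omega
  have hneQ : Q.Nonempty := by rw [← hπ] at hne; exact hne.of_image
  obtain ⟨L, Φ, h1, h2, h3⟩ := exists_orthant_section hQ hneQ (hfQ.trans hxc) (by omega) π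
  rw [hπ] at h1 h2 h3
  have hE : Module.finrank ℝ ((Fin d → ℝ) × ℝ) = d + 1 := by simp
  have hspan := span_hat_eq_top hdP
  have hfin := hP.exists_vertexSet_eq.1
  have hrange : LinearMap.range (Φ.domRestrict L) = ⊤ := by
    rw [eq_top_iff, ← hspan, Submodule.span_le]
    rintro _ ⟨p, hp, rfl⟩
    obtain ⟨x, hx, -, ex⟩ := h2 p hp
    exact ⟨⟨x, hx⟩, ex⟩
  have hrank := LinearMap.finrank_range_add_finrank_ker (Φ.domRestrict L)
  rw [hrange, finrank_top, hE] at hrank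
  have hle := Submodule.finrank_le L
  rw [Module.finrank_fin_fun] at hle
  obtain hk | hk | hk : Module.finrank ℝ (LinearMap.ker (Φ.domRestrict L)) = 0 ∨
      Module.finrank ℝ (LinearMap.ker (Φ.domRestrict L)) = 1 ∨
      Module.finrank ℝ (LinearMap.ker (Φ.domRestrict L)) = 2 := by omega
  · have hbot := Submodule.finrank_eq_zero.1 hk
    have := h3 fun x hx hx0 => by
      have : (⟨x, hx⟩ : L) ∈ LinearMap.ker (Φ.domRestrict L) := hx0
      rw [hbot, Submodule.mem_bot] at this
      exact congrArg Subtype.val this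
    omega
  · have hLlt : L < ⊤ := by
      rw [lt_top_iff_ne_top]
      rintro rfl
      rw [finrank_top, Module.finrank_fin_fun] at hrank
      omega
    obtain ⟨f, hf0, hLf⟩ := Submodule.exists_le_ker_of_lt_top L hLlt
    have hLeq : L = LinearMap.ker f := by
      apply Submodule.eq_of_le_of_finrank_eq hLf
      have := LinearMap.finrank_range_add_finrank_ker f
      rw [LinearMap.range_eq_top.2 (LinearMap.surjective hf0), finrank_top,
        Module.finrank_self, Module.finrank_fin_fun] at this
      omega
    have hLt : ∀ x, dotProduct (fun l => f (Pi.single l 1)) x = 0 ↔ x ∈ L := by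
      intro x
      rw [dotProduct_map_single, hLeq, LinearMap.mem_ker]
    rw [← Submodule.finrank_map_subtype_eq L] at hk
    obtain ⟨⟨_, ⟨r, hr, rfl⟩⟩, -, hspanr⟩ := finrank_eq_one_iff'.1 hk
    have hsec : OrthantSection P (fun l => f (Pi.single l 1)) r.1 Φ :=
      { mem_homCone := fun x hx hx0 => h1 x ((hLt x).1 hx) hx0
        exists_lift := fun y hy => by
          obtain ⟨x, hx, hx0, ex⟩ := h2 y hy
          exact ⟨x, (hLt x).2 hx, hx0, ex⟩
        dotProduct_eq := (hLt _).2 r.2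
        map_eq := hr
        eq_smul := fun x hx hx0 => by
          obtain ⟨a, ha⟩ := hspanr ⟨x, ⟨⟨x, (hLt x).1 hx⟩, hx0, rfl⟩⟩
          exact ⟨a, (congrArg Subtype.val ha).symm⟩
        span_eq := hspan }
    exact hsec.hasPrismGrid hfin (by omega) (by omega)
  · have htop : L = ⊤ := by
      apply Submodule.eq_top_of_finrank_eq
      rw [Module.finrank_fin_fun]
      omega
    exfalso
    have key : ∀ v : vertexSet P, ∃ g, ∃ c : ℝ, 0 < c ∧ Φ (Pi.single g 1) = c • hat v.1 := by
      intro v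
      have hvP : v.1 ∈ P := v.2.subset (mem_singleton _)
      obtain ⟨x, hx, hx0, ex⟩ := h2 _ hvP
      refine exists_smul_hat_of_vertex (u := fun g => Φ (Pi.single g 1)) (fun g => ?_) v.2 hx0 ?_
      · refine h1 _ (htop ▸ Submodule.mem_top) fun i => ?_
        rw [Pi.single_apply]
        split_ifs <;> simp
      · conv_lhs => rw [← ex, pi_eq_sum_univ' x]
        simp only [map_sum, map_smul]
    choose τ c hc hτ using key
    have hinj : Function.Injective τ := fun v w hvw => by
      have := hτ v
      rw [hvw, hτ w] at this
      exact Subtype.ext (smul_hat_eq (hc w) this).2.symm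
    have := Nat.card_le_card_of_injective τ hinj
    rw [Nat.card_coe_set_eq, Nat.card_eq_fintype_card, Fintype.card_fin] at this
    unfold vertexCount at hv
    omega

/-- The index set of the vertices of the `k`-fold pyramid over the triangular prism. -/
abbrev PrismIndex (k : ℕ) : Type := (Fin 2 × Fin 3) ⊕ Fin k

/-- The vertices of the simplex `simplexF 1`. -/
def segmentVertex : Fin 2 → Fin 1 → ℝ := ![Pi.single 0 1, fun _ => -1]

/-- The vertices of the simplex `simplexF 2`. -/
def triangleVertex : Fin 3 → Fin 2 → ℝ := ![Pi.single 0 1, Pi.single 1 1, fun _ => -1]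

/-- The vertices of the canonical `k`-fold pyramid over the triangular prism. -/
def prismPyramidVertex (k : ℕ) : PrismIndex k → Fin (1 + 2 + k) → ℝ :=
  Sum.elim (fun p => Fin.append (Fin.append (segmentVertex p.1) (triangleVertex p.2)) 0)
    (fun l => Fin.append 0 (Pi.single l 1))

lemma simplexF_one : simplexF 1 = convexHull ℝ (range segmentVertex) := by
  unfold simplexF
  congr 1
  ext x
  simp [segmentVertex, eq_comm]

lemma simplexF_two : simplexF 2 = convexHull ℝ (range triangleVertex) := by
  unfold simplexF
  congr 1
  ext x
  simp only [triangleVertex, mem_union, mem_range, mem_singleton_iff, Fin.exists_fin_succ,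
    eq_comm (b := x)]
  simp
  tauto

lemma isLinearMap_append (m n : ℕ) :
    IsLinearMap ℝ (fun z : (Fin m → ℝ) × (Fin n → ℝ) => Fin.append z.1 z.2) where
  map_add x y := by
    ext i
    refine Fin.addCases (fun i => ?_) (fun i => ?_) i <;> simp
  map_smul c x := by
    ext i
    refine Fin.addCases (fun i => ?_) (fun i => ?_) i <;> simp

lemma isLinearMap_append_zero (m n : ℕ) :
    IsLinearMap ℝ (fun a : Fin m → ℝ => Fin.append a (0 : Fin n → ℝ)) where
  map_add x y := by
    ext i
    refine Fin.addCases (fun i => ?_) (fun i => ?_) i <;> simp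
  map_smul c x := by
    ext i
    refine Fin.addCases (fun i => ?_) (fun i => ?_) i <;> simp

lemma prodP_one_two : prodP 1 2 = convexHull ℝ
    (range fun p : Fin 2 × Fin 3 => Fin.append (segmentVertex p.1) (triangleVertex p.2)) := by
  have e : prodP 1 2 = (fun z : (Fin 1 → ℝ) × (Fin 2 → ℝ) => Fin.append z.1 z.2) ''
      (simplexF 1 ×ˢ simplexF 2) := by
    ext z
    simp only [prodP, mem_image, mem_prod, Prod.exists, mem_ofPred_eq]
    constructor
    · rintro ⟨a, ha, b, hb, rfl⟩; exact ⟨a, b, ⟨ha, hb⟩, rfl⟩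
    · rintro ⟨a, b, ⟨ha, hb⟩, rfl⟩; exact ⟨a, ha, b, hb, rfl⟩
  rw [e, simplexF_one, simplexF_two, ← convexHull_prod, (isLinearMap_append 1 2).image_convexHull,
    prod_range_range_eq, ← range_comp]
  rfl

lemma pyrK_prodP (k : ℕ) :
    pyrK k (prodP 1 2) = convexHull ℝ (range (prismPyramidVertex k)) := by
  rw [pyrK, prodP_one_two, (isLinearMap_append_zero _ k).image_convexHull, ← range_comp,
    convexHull_convexHull_union_left, prismPyramidVertex, Sum.elim_range]
  rfl

lemma slackForm_prismPyramidVertex {k : ℕ} (a : Fin 1 → ℝ) (c : Fin 2 → ℝ) (e : Fin k → ℝ)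
    (b : ℝ) (j : PrismIndex k) :
    slackForm (Fin.append (Fin.append a c) e) b (hat (prismPyramidVertex k j)) =
      Sum.elim (fun p => b - (a 0 * segmentVertex p.1 0 +
        (c 0 * triangleVertex p.2 0 + c 1 * triangleVertex p.2 1))) (fun l => b - e l) j := by
  rw [slackForm_hat]
  rcases j with ⟨i, j⟩ | l
  · simp [prismPyramidVertex, Fin.sum_univ_add (a := 1 + 2) (b := k),
      Fin.sum_univ_add (a := 1) (b := 2)]
  · simp [prismPyramidVertex, Fin.sum_univ_add, Pi.single_apply]

lemma exists_form_prismPyramidVertex_iff {k : ℕ} (y : PrismIndex k → ℝ) :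
    (∃ g : ((Fin (1 + 2 + k) → ℝ) × ℝ) →ₗ[ℝ] ℝ, ∀ j, y j = g (hat (prismPyramidVertex k j))) ↔
      ∃ (α : Fin 2 → ℝ) (β : Fin 3 → ℝ), ∀ i j, y (Sum.inl (i, j)) = α i + β j := by
  constructor
  · rintro ⟨g, hg⟩
    obtain ⟨c, b, rfl⟩ := exists_slackForm_eq g
    obtain ⟨a, c', e, rfl⟩ : ∃ a c' e, c = Fin.append (Fin.append a c') e :=
      ⟨fun i => c (Fin.castAdd k (Fin.castAdd 2 i)), fun i => c (Fin.castAdd k (Fin.natAdd 1 i)),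
        fun i => c (Fin.natAdd _ i), by
          ext i
          refine Fin.addCases (fun i => ?_) (fun i => ?_) i
          · refine Fin.addCases (fun i => ?_) (fun i => ?_) i <;> simp
          · simp⟩
    refine ⟨fun i => -(a 0 * segmentVertex i 0),
      fun j => b - (c' 0 * triangleVertex j 0 + c' 1 * triangleVertex j 1), fun i j => ?_⟩
    rw [hg, slackForm_prismPyramidVertex, Sum.elim_inl]
    ring
  · rintro ⟨α, β, h⟩
    set b := (α 0 + α 1) / 2 + (β 0 + β 1 + β 2) / 3 with hb
    refine ⟨slackForm (Fin.append (Fin.append (fun _ => (α 1 - α 0) / 2)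
      ![b - (α 0 + α 1) / 2 - β 0, b - (α 0 + α 1) / 2 - β 1]) (fun l => b - y (Sum.inr l))) b,
      fun j => ?_⟩
    rw [slackForm_prismPyramidVertex]
    rcases j with ⟨i, j⟩ | l
    · rw [h, Sum.elim_inl, hb]
      fin_cases i <;> fin_cases j <;> simp [segmentVertex, triangleVertex] <;> ring
    · simp

lemma hat_ne_zero {N : ℕ} (x : Fin N → ℝ) : hat x ≠ 0 := fun h => by
  simpa [hat] using congrArg Prod.snd h

lemma pdim_singleton {N : ℕ} (x : Fin N → ℝ) : pdim ({x} : Set (Fin N → ℝ)) = 0 := by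
  rw [pdim_eq, image_singleton, finrank_span_singleton (hat_ne_zero x)]
  norm_num

/-- The linear map forgetting the last coordinate. -/
def projLinear (d : ℕ) : (Fin (d + 1) → ℝ) →ₗ[ℝ] (Fin d → ℝ) :=
  LinearMap.funLeft ℝ ℝ Fin.castSucc

lemma projFun_snoc {d : ℕ} (v : Fin d → ℝ) (a : ℝ) :
    projFun d (Fin.snoc (α := fun _ => ℝ) v a) = v := by
  ext i
  simp [projFun]

/-- The form on the homogenization of `ℝ^{d+1}` induced by a form on that of `ℝ^d`
and a coefficient for the last coordinate. -/
def liftForm {d : ℕ} (f : ((Fin d → ℝ) × ℝ) →ₗ[ℝ] ℝ) (c : ℝ) :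
    ((Fin (d + 1) → ℝ) × ℝ) →ₗ[ℝ] ℝ :=
  f ∘ₗ (projLinear d).prodMap LinearMap.id +
    c • (LinearMap.proj (Fin.last d) ∘ₗ LinearMap.fst ℝ (Fin (d + 1) → ℝ) ℝ)

lemma liftForm_apply {d : ℕ} (f : ((Fin d → ℝ) × ℝ) →ₗ[ℝ] ℝ) (c : ℝ)
    (z : (Fin (d + 1) → ℝ) × ℝ) :
    liftForm f c z = f (projFun d z.1, z.2) + c * z.1 (Fin.last d) := rfl

lemma liftForm_hat_snoc {d : ℕ} (f : ((Fin d → ℝ) × ℝ) →ₗ[ℝ] ℝ) (c : ℝ) (v : Fin d → ℝ)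
    (a : ℝ) : liftForm f c (hat (Fin.snoc (α := fun _ => ℝ) v a)) = f (hat v) + c * a := by
  rw [liftForm_apply]
  simp only [hat, projFun_snoc, Fin.snoc_last]

lemma exists_liftForm_eq {d : ℕ} (g : ((Fin (d + 1) → ℝ) × ℝ) →ₗ[ℝ] ℝ) :
    ∃ f c, g = liftForm f c := by
  let ι : (Fin d → ℝ) →ₗ[ℝ] (Fin (d + 1) → ℝ) :=
    { toFun := fun v => Fin.snoc (α := fun _ => ℝ) v 0
      map_add' := fun x y => by
        ext i
        refine Fin.lastCases ?_ (fun i => ?_) i <;> simp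
      map_smul' := fun a x => by
        ext i
        refine Fin.lastCases ?_ (fun i => ?_) i <;> simp }
  refine ⟨g ∘ₗ ι.prodMap LinearMap.id, g (Pi.single (Fin.last d) 1, 0), ?_⟩
  refine LinearMap.ext fun z => ?_
  rw [liftForm_apply, LinearMap.comp_apply, mul_comm, ← smul_eq_mul, ← map_smul, ← map_add]
  congr 1
  refine Prod.ext ?_ ?_
  · ext i
    refine Fin.lastCases ?_ (fun i => ?_) i
    · simp [ι]
    · simp [ι, projFun]
  · simp

lemma exists_extension_of_grid {d k : ℕ} {v : PrismIndex k → Fin d → ℝ} (hk : k + 2 = d)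
    (hspan : Submodule.span ℝ (range fun j => hat (v j)) = ⊤) {s : Fin 2 × Fin 3 → ℝ}
    {A : Fin 2 → (Fin d → ℝ) × ℝ} {B : Fin 3 → (Fin d → ℝ) × ℝ} (hs : ∀ p, 0 < s p)
    (h : ∀ i j, s (i, j) • hat (v (Sum.inl (i, j))) = A i + B j) :
    ∃ η : PrismIndex k → ℝ, (¬ ∃ f : ((Fin d → ℝ) × ℝ) →ₗ[ℝ] ℝ, ∀ j, η j = f (hat (v j))) ∧
      ∀ y : PrismIndex k → ℝ,
        (∃ (α : Fin 2 → ℝ) (β : Fin 3 → ℝ), ∀ i j, s (i, j) * y (Sum.inl (i, j)) = α i + β j) ↔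
          ∃ (f : ((Fin d → ℝ) × ℝ) →ₗ[ℝ] ℝ) (c : ℝ), ∀ j, y j = f (hat (v j)) + c * η j := by
  let Ψ : (ℝ × (Fin 3 → ℝ) × (Fin k → ℝ)) →ₗ[ℝ] (PrismIndex k → ℝ) :=
    { toFun := fun z => Sum.elim (fun p => (s p)⁻¹ * ((if p.1 = 0 then 0 else z.1) + z.2.1 p.2)) z.2.2
      map_add' := fun x y => by
        ext j
        rcases j with p | l
        · simp only [Sum.elim_inl, Pi.add_apply, Prod.fst_add, Prod.snd_add]
          split_ifs <;> ring
        · simp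
      map_smul' := fun a x => by
        ext j
        rcases j with p | l
        · simp only [Sum.elim_inl, Pi.smul_apply, Prod.smul_fst, Prod.smul_snd, smul_eq_mul,
            RingHom.id_apply]
          split_ifs <;> ring
        · simp }
  have hΨ : ∀ y, y ∈ LinearMap.range Ψ ↔
      ∃ (α : Fin 2 → ℝ) (β : Fin 3 → ℝ), ∀ i j, s (i, j) * y (Sum.inl (i, j)) = α i + β j := by
    intro y
    constructor
    · rintro ⟨z, rfl⟩
      refine ⟨fun i => if i = 0 then 0 else z.1, z.2.1, fun i j => ?_⟩
      simp only [Ψ, LinearMap.coe_mk, AddHom.coe_mk, Sum.elim_inl]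
      rw [mul_inv_cancel_left₀ (hs _).ne']
    · rintro ⟨α, β, hy⟩
      refine ⟨(α 1 - α 0, fun j => α 0 + β j, fun l => y (Sum.inr l)), ?_⟩
      ext j
      rcases j with ⟨i, j⟩ | l
      · simp only [Ψ, LinearMap.coe_mk, AddHom.coe_mk, Sum.elim_inl]
        rw [inv_mul_eq_iff_eq_mul₀ (hs _).ne', hy]
        fin_cases i
        · simp
        · simp; ring
      · rfl
  have hΨinj : Function.Injective Ψ := by
    rw [← LinearMap.ker_eq_bot, LinearMap.ker_eq_bot']
    rintro ⟨a, β, γ⟩ hz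
    have h1 : ∀ p : Fin 2 × Fin 3, (if p.1 = 0 then 0 else a) + β p.2 = 0 := fun p => by
      have := congrFun hz (Sum.inl p)
      simpa [Ψ, (hs p).ne'] using this
    have hβ : β = 0 := by ext j; simpa using h1 (0, j)
    have ha : a = 0 := by simpa [hβ] using h1 (1, 0)
    have hγ : γ = 0 := by ext l; exact congrFun hz (Sum.inr l)
    rw [ha, hβ, hγ]; rfl
  have hW : Module.finrank ℝ (LinearMap.range Ψ) = d + 2 := by
    rw [LinearMap.finrank_range_of_inj hΨinj]
    simp only [Module.finrank_prod, Module.finrank_self, Module.finrank_fin_fun]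
    omega
  let ρ : Module.Dual ℝ ((Fin d → ℝ) × ℝ) →ₗ[ℝ] (PrismIndex k → ℝ) :=
    LinearMap.pi fun j => LinearMap.applyₗ (hat (v j))
  have hρinj : Function.Injective ρ := by
    rw [← LinearMap.ker_eq_bot, LinearMap.ker_eq_bot']
    intro f hf
    have : (⊤ : Submodule ℝ ((Fin d → ℝ) × ℝ)) ≤ LinearMap.ker f := by
      rw [← hspan, Submodule.span_le]
      rintro _ ⟨j, rfl⟩
      exact congrFun hf j
    exact LinearMap.ker_eq_top.1 (top_le_iff.1 this)
  have hR : Module.finrank ℝ (LinearMap.range ρ) = d + 1 := by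
    rw [LinearMap.finrank_range_of_inj hρinj, Subspace.dual_finrank_eq]
    simp
  have hRW : LinearMap.range ρ ≤ LinearMap.range Ψ := by
    rintro _ ⟨f, rfl⟩
    refine (hΨ _).2 ⟨fun i => f (A i), fun j => f (B j), fun i j => ?_⟩
    rw [← map_add, ← h, map_smul]
    rfl
  obtain ⟨η, hη, hηR⟩ : ∃ η ∈ LinearMap.range Ψ, η ∉ LinearMap.range ρ := by
    by_contra! hall
    have := Submodule.finrank_mono (R := ℝ) (show LinearMap.range Ψ ≤ LinearMap.range ρ from hall)
    omega
  have hsup : LinearMap.range ρ ⊔ Submodule.span ℝ {η} = LinearMap.range Ψ := by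
    have hle : LinearMap.range ρ ⊔ Submodule.span ℝ {η} ≤ LinearMap.range Ψ :=
      sup_le hRW ((Submodule.span_singleton_le_iff_mem _ _).2 hη)
    have hlt : LinearMap.range ρ < LinearMap.range ρ ⊔ Submodule.span ℝ {η} :=
      lt_of_le_of_ne le_sup_left fun e => hηR (e ▸
        Submodule.mem_sup_right (Submodule.mem_span_singleton_self η))
    have h1 := Submodule.finrank_lt_finrank_of_lt hlt
    have h2 := Submodule.finrank_mono hle
    exact Submodule.eq_of_le_of_finrank_eq hle (by omega)
  refine ⟨η, ?_, fun y => ?_⟩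
  · rintro ⟨f, hf⟩
    exact hηR ⟨f, funext fun j => (hf j).symm⟩
  · rw [← hΨ, ← hsup, Submodule.mem_sup]
    constructor
    · rintro ⟨_, ⟨f, rfl⟩, z, hz, rfl⟩
      obtain ⟨c, rfl⟩ := Submodule.mem_span_singleton.1 hz
      exact ⟨f, c, fun j => rfl⟩
    · rintro ⟨f, c, e⟩
      exact ⟨ρ f, ⟨f, rfl⟩, c • η, Submodule.mem_span_singleton.2 ⟨c, rfl⟩,
        (funext e).symm⟩

lemma exists_prismIndex_equiv {k : ℕ} {V : Type*} [Finite V] (hV : Nat.card V = k + 6)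
    {w : Fin 2 × Fin 3 → V} (hw : Function.Injective w) :
    ∃ e : PrismIndex k ≃ V, ∀ p, e (Sum.inl p) = w p := by
  classical
  have hr : Nat.card (range w) = 6 := by
    rw [Nat.card_congr (Equiv.ofInjective w hw).symm]; simp
  have hc : Nat.card ((range w)ᶜ : Set V) = k := by
    have := Nat.card_congr (Equiv.Set.sumCompl (range w))
    rw [Nat.card_sum, hr] at this
    omega
  refine ⟨((Equiv.ofInjective w hw).sumCongr (Finite.equivFinOfCardEq hc).symm).trans
    (Equiv.Set.sumCompl (range w)), fun p => ?_⟩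
  simp

/-- The points obtained by lifting `v j` to height `η j`. -/
def liftPoint {d : ℕ} {J : Type*} (v : J → Fin d → ℝ) (η : J → ℝ) (j : J) : Fin (d + 1) → ℝ :=
  Fin.snoc (α := fun _ => ℝ) (v j) (η j)

lemma projFun_image_convexHull_liftPoint {d : ℕ} {J : Type*} (v : J → Fin d → ℝ) (η : J → ℝ) :
    projFun d '' convexHull ℝ (range (liftPoint v η)) = convexHull ℝ (range v) := by
  change projLinear d '' _ = _
  rw [(projLinear d).image_convexHull, ← range_comp]
  congr 2
  ext1 j
  exact projFun_snoc _ _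

lemma pdim_convexHull_liftPoint {d : ℕ} {J : Type*} [Fintype J] {v : J → Fin d → ℝ} {η : J → ℝ}
    (hspan : Submodule.span ℝ (range fun j => hat (v j)) = ⊤)
    (hη : ¬ ∃ f : ((Fin d → ℝ) × ℝ) →ₗ[ℝ] ℝ, ∀ j, η j = f (hat (v j))) :
    pdim (convexHull ℝ (range (liftPoint v η))) = d + 1 := by
  have htop : Submodule.span ℝ (hat '' convexHull ℝ (range (liftPoint v η))) = ⊤ := by
    by_contra hne
    obtain ⟨g, hg0, hg⟩ := Submodule.exists_le_ker_of_lt_top _ (lt_top_iff_ne_top.2 hne)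
    obtain ⟨f, c, rfl⟩ := exists_liftForm_eq g
    have hj : ∀ j, f (hat (v j)) + c * η j = 0 := by
      intro j
      rw [← liftForm_hat_snoc]
      exact hg (Submodule.subset_span (mem_image_of_mem _
        (subset_convexHull _ _ (mem_range_self j))))
    by_cases hc : c = 0
    · have : (⊤ : Submodule ℝ ((Fin d → ℝ) × ℝ)) ≤ LinearMap.ker f := by
        rw [← hspan, Submodule.span_le]
        rintro _ ⟨j, rfl⟩
        simpa [hc] using hj j
      have hf := LinearMap.ker_eq_top.1 (top_le_iff.1 this)
      refine hg0 (LinearMap.ext fun z => ?_)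
      rw [liftForm_apply, hf, hc]
      simp
    · refine hη ⟨(-c⁻¹) • f, fun j => ?_⟩
      have := hj j
      rw [LinearMap.smul_apply, smul_eq_mul, eq_neg_of_add_eq_zero_left this]
      field_simp
  rw [pdim_eq, htop, finrank_top]
  simp

lemma strictlyPreservedFace_liftPoint {d : ℕ} {J : Type*} [Fintype J] {v : J → Fin d → ℝ}
    {η : J → ℝ} (hinj : Function.Injective v)
    (hvert : ∀ j, IsVertexOf (v j) (convexHull ℝ (range v))) (j : J) :
    StrictlyPreservedFace (convexHull ℝ (range (liftPoint v η))) {liftPoint v η j} := by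
  have hproj : projFun d '' {liftPoint v η j} = {v j} := by
    rw [image_singleton, liftPoint, projFun_snoc]
  have hmem : ∀ i, liftPoint v η i ∈ convexHull ℝ (range (liftPoint v η)) :=
    fun i => subset_convexHull _ _ (mem_range_self i)
  refine ⟨⟨?_, ?_⟩, by rw [hproj, pdim_singleton, pdim_singleton]⟩
  · rw [hproj, projFun_image_convexHull_liftPoint]
    exact hvert j
  · rw [hproj]
    obtain ⟨f, hf, hfe⟩ := isFaceOf_iff.1 (hvert j)
    have hface : IsFaceOf (projFun d ⁻¹' {v j} ∩ convexHull ℝ (range (liftPoint v η)))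
        (convexHull ℝ (range (liftPoint v η))) := by
      have hpr : ∀ x ∈ convexHull ℝ (range (liftPoint v η)),
          projFun d x ∈ convexHull ℝ (range v) := fun x hx => by
        rw [← projFun_image_convexHull_liftPoint v η]
        exact mem_image_of_mem _ hx
      have happ : ∀ x, liftForm f 0 (hat x) = f (hat (projFun d x)) := fun x => by
        rw [liftForm_apply, zero_mul, add_zero]; rfl
      refine isFaceOf_iff.2 ⟨liftForm f 0, fun x hx => ?_, ?_⟩
      · rw [happ]
        exact hf _ (hpr x hx)
      · ext x
        rw [hfe]
        simp only [mem_inter_iff, mem_preimage, mem_ofPred_eq, happ]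
        exact ⟨fun hx => ⟨hx.2, hx.1.2⟩, fun hx => ⟨⟨hpr x hx.1, hx.2⟩, hx.1⟩⟩
    rw [hface.eq_convexHull]
    have : {i | liftPoint v η i ∈ projFun d ⁻¹' {v j} ∩ convexHull ℝ (range (liftPoint v η))} =
        {j} := by
      ext i
      simp only [mem_ofPred_eq, mem_inter_iff, hmem, and_true, mem_preimage, mem_singleton_iff]
      rw [liftPoint, projFun_snoc, hinj.eq_iff]
    rw [this, image_singleton, convexHull_singleton]

lemma exists_prism_pyramid_lift {d : ℕ} {P : Set (Fin d → ℝ)} (hP : IsPolytope P)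
    (hdP : pdim P = d) (hv : vertexCount P = d + 4) (hgrid : OrthantSection.HasPrismGrid P) :
    ∃ Q : Set (Fin (d + 1) → ℝ),
      IsPolytope Q ∧ pdim Q = d + 1 ∧
      CombEquiv Q (pyrK (d - 2) (prodP 1 2)) ∧
      projFun d '' Q = P ∧
      ∀ v : Fin (d + 1) → ℝ, IsVertexOf v Q → StrictlyPreservedFace Q {v} := by
  obtain ⟨w, hw, s, A, B, hs, hAB⟩ := hgrid
  obtain ⟨hfin, hPv⟩ := hP.exists_vertexSet_eq
  have : Finite (vertexSet P) := hfin
  have hcard : Nat.card (vertexSet P) = d + 4 := by rw [Nat.card_coe_set_eq]; exact hv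
  have h6 := Nat.card_le_card_of_injective w hw
  rw [hcard] at h6
  have hk : d - 2 + 2 = d := by
    have : Nat.card (Fin 2 × Fin 3) = 6 := by simp
    omega
  obtain ⟨e, he⟩ := exists_prismIndex_equiv (k := d - 2) (by omega) hw
  set v : PrismIndex (d - 2) → Fin d → ℝ := fun j => (e j).1 with hvdef
  have hrange : range v = vertexSet P := by
    rw [hvdef, show (fun j => (e j).1) = Subtype.val ∘ e from rfl, range_comp, e.range_eq_univ,
      image_univ, Subtype.range_coe]
  have hPconv : P = convexHull ℝ (range v) := by rw [hrange]; exact hPv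
  have hvert : ∀ j, IsVertexOf (v j) (convexHull ℝ (range v)) := fun j => by
    rw [← hPconv]; exact (e j).2
  have hinj : Function.Injective v := Subtype.val_injective.comp e.injective
  have hspan : Submodule.span ℝ (range fun j => hat (v j)) = ⊤ := by
    have := span_hat_eq_top hdP
    rwa [hPconv, ← image_univ, span_hat_convexHull, image_univ] at this
  obtain ⟨η, hη, hiff⟩ := exists_extension_of_grid (v := v) hk hspan hs (A := A) (B := B)
    fun i j => by rw [hvdef]; simp only [he, hAB]
  refine ⟨convexHull ℝ (range (liftPoint v η)), isPolytope_convexHull_range _,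
    pdim_convexHull_liftPoint hspan hη, ?_, ?_, fun x hx => ?_⟩
  · rw [pyrK_prodP]
    refine combEquiv_of_proportional_slacks (s := Sum.elim s fun _ => 1) ?_ (fun g => ?_)
      fun g => ?_
    · rintro (p | l)
      · exact hs p
      · exact one_pos
    · obtain ⟨f, c, rfl⟩ := exists_liftForm_eq g
      refine (exists_form_prismPyramidVertex_iff _).2 ?_
      exact (hiff _).2 ⟨f, c, fun j => liftForm_hat_snoc _ _ _ _⟩
    · obtain ⟨α, β, hαβ⟩ := (exists_form_prismPyramidVertex_iff
        fun j => g (hat (prismPyramidVertex (d - 2) j))).1 ⟨g, fun _ => rfl⟩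
      obtain ⟨f, c, hfc⟩ := (hiff fun j => (Sum.elim s (fun _ => 1) j)⁻¹ *
        g (hat (prismPyramidVertex (d - 2) j))).1 ⟨α, β, fun i j => by
          rw [Sum.elim_inl, mul_inv_cancel_left₀ (hs _).ne', hαβ]⟩
      refine ⟨liftForm f c, fun j => ?_⟩
      rw [liftPoint, liftForm_hat_snoc, ← hfc, mul_inv_cancel_left₀]
      rcases j with p | l
      · exact (hs p).ne'
      · exact one_ne_zero
  · rw [projFun_image_convexHull_liftPoint, ← hPconv]
  · obtain ⟨j, rfl⟩ := hx.exists_eq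
    exact strictlyPreservedFace_liftPoint hinj hvert j

theorem xc_d_plus_three_comes_from_prism_pyramid (d : ℕ) (P : Set (Fin d → ℝ))
    (hP : IsPolytope P) (hdP : pdim P = d)
    (hv : vertexCount P = d + 4) (hf : d + 4 ≤ facetCount P)
    (hxc : xc P = d + 3) :
    ∃ Q : Set (Fin (d + 1) → ℝ),
      IsPolytope Q ∧ pdim Q = d + 1 ∧
      CombEquiv Q (pyrK (d - 2) (prodP 1 2)) ∧
      projFun d '' Q = P ∧
      ∀ v : Fin (d + 1) → ℝ, IsVertexOf v Q → StrictlyPreservedFace Q {v} := by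
  exact exists_prism_pyramid_lift hP hdP hv (hasPrismGrid_of_xc hP hdP hv hf hxc)

end
end
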